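/- For every countable family {f_i}_{i ∈ ℕ} of recurrent elements of Diff^∞(ℝ/ℤ), there exists a single finite subset S ⊆ Diff^∞(ℝ/ℤ) such that every f_i lies in the subgroup generated by S and, for every i, d_S(f_i^n, id)/n → 0 as n → ∞ (i.e. all the f_i are simultaneously distortion elements of one finitely generated subgroup). -/

import Mathlib

open Filter Topology Set

noncomputable section

/-- The circle ℝ/ℤ. -/
abbrev S1 := AddCircle (1 : ℝ)

/-- `F : ℝ → ℝ` is a lift of the circle map `f`: it is C^∞, commutes with the unit
translation, has everywhere positive derivative, and descends to `f` on ℝ/ℤ. -/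
def IsLift (f : Equiv.Perm S1) (F : ℝ → ℝ) : Prop :=
  ContDiff ℝ (⊤ : ℕ∞) F ∧ (∀ x, F (x + 1) = F x + 1) ∧ (∀ x, 0 < deriv F x) ∧
    ∀ x : ℝ, f (x : S1) = ((F x : ℝ) : S1)

/-- `f` is an orientation preserving C^∞ diffeomorphism of ℝ/ℤ. -/
def HasLift (f : Equiv.Perm S1) : Prop := ∃ F, IsLift f F

/-- max over 0 ≤ j ≤ k of sup over x of |F^(j)(x) - G^(j)(x)|. -/
noncomputable def liftDist (k : ℕ) (F G : ℝ → ℝ) : ℝ :=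
  ⨆ j : Fin (k + 1), ⨆ x : ℝ, |iteratedDeriv (j : ℕ) F x - iteratedDeriv (j : ℕ) G x|

/-- The C^k distance between two smooth circle diffeomorphisms: infimum over lifts. -/
noncomputable def distC (k : ℕ) (f g : Equiv.Perm S1) : ℝ :=
  sInf {d | ∃ F G, IsLift f F ∧ IsLift g G ∧ d = liftDist k F G}

/-- `f` is recurrent: for every k and ε > 0 there are arbitrarily large n ≥ 1 with
‖f^n − id‖_{C^k} < ε. -/
def Recurrent (f : Equiv.Perm S1) : Prop :=
  ∀ k : ℕ, ∀ ε : ℝ, 0 < ε → ∀ N : ℕ, ∃ n : ℕ, N ≤ n ∧ 1 ≤ n ∧ distC k (f ^ n) 1 < ε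

/-- The word length of `g` with respect to the generating set `S`: the least `k` such that
`g` is a product of `k` elements of `S ∪ S⁻¹`. -/
noncomputable def wordLength (S : Set (Equiv.Perm S1)) (g : Equiv.Perm S1) : ℕ :=
  sInf {k | ∃ l : List (Equiv.Perm S1),
    l.length = k ∧ (∀ x ∈ l, x ∈ S ∨ x⁻¹ ∈ S) ∧ l.prod = g}

/-- The rotation by `t` on ℝ/ℤ, `x ↦ x + t`. -/
def rot (t : S1) : Equiv.Perm S1 := Equiv.addRight t

/-- `f` is a distortion element of Diff^∞(ℝ/ℤ). -/
def IsDistortion (f : Equiv.Perm S1) : Prop :=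
  ∃ S : Finset (Equiv.Perm S1), (∀ g ∈ S, HasLift g) ∧
    f ∈ Subgroup.closure (S : Set (Equiv.Perm S1)) ∧
    Tendsto (fun n : ℕ => (wordLength (S : Set (Equiv.Perm S1)) (f ^ n) : ℝ) / n)
      atTop (nhds 0)

/-- The open arc in ℝ/ℤ which is the image of the interval `(a,b)`. -/
def arcOO (a b : ℝ) : Set S1 := (fun x : ℝ => (x : S1)) '' Set.Ioo a b

/-- The closed arc in ℝ/ℤ which is the image of the interval `[a,b]`. -/
def arcCC (a b : ℝ) : Set S1 := (fun x : ℝ => (x : S1)) '' Set.Icc a b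

/-- `f` is supported on `U`: it is the identity outside `U`. -/
def SupportedOn (f : Equiv.Perm S1) (U : Set S1) : Prop := ∀ x : S1, x ∉ U → f x = x

/-- `f` has rotation number `t ∈ ℝ/ℤ`. -/
def HasRotNum (f : Equiv.Perm S1) (t : S1) : Prop :=
  ∃ F : ℝ → ℝ, ∃ τ : ℝ, IsLift f F ∧ ((τ : ℝ) : S1) = t ∧
    Tendsto (fun n : ℕ => F^[n] 0 / n) atTop (nhds τ)

/-- A real number is Diophantine. -/
def DiophantineReal (t : ℝ) : Prop :=
  ∃ C : ℝ, 0 < C ∧ ∃ n : ℕ, 0 < n ∧ ∀ p q : ℤ, q ≠ 0 →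
    C / |(q : ℝ)| ^ n < |(q : ℝ) * t - (p : ℝ)|

/-- An element of ℝ/ℤ is Diophantine if some (equivalently, every) lift is. -/
def Diophantine (t : S1) : Prop := ∃ τ : ℝ, (τ : S1) = t ∧ DiophantineReal τ


set_option linter.unusedVariables false


/-- smooth functions -/
abbrev Sm (f : ℝ → ℝ) : Prop := ContDiff ℝ (⊤ : ℕ∞) f

def Bd (f : ℝ → ℝ) (a l : ℝ) (r : ℕ) : Prop :=
  ∀ j ≤ r, ∀ x, |iteratedDeriv j f x| ≤ a * l ^ j

lemma Sm.deriv {f : ℝ → ℝ} (h : Sm f) : Sm (deriv f) :=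
  (contDiff_infty_iff_deriv.1 h).2

lemma Sm.diff {f : ℝ → ℝ} (h : Sm f) : Differentiable ℝ f :=
  (contDiff_infty_iff_deriv.1 h).1

lemma Sm.da {f : ℝ → ℝ} (h : Sm f) (x : ℝ) : DifferentiableAt ℝ f x := h.diff x

lemma Sm.iter {f : ℝ → ℝ} (h : Sm f) (n : ℕ) : Sm (iteratedDeriv n f) := by
  induction n with
  | zero => simpa using h
  | succ n ih => rw [iteratedDeriv_succ]; exact ih.deriv

lemma Bd.zero_iff {f : ℝ → ℝ} {a l : ℝ} : Bd f a l 0 ↔ ∀ x, |f x| ≤ a := by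
  simp [Bd]

lemma Bd.b0 {f : ℝ → ℝ} {a l : ℝ} {r : ℕ} (h : Bd f a l r) (x : ℝ) : |f x| ≤ a := by
  simpa using h 0 (Nat.zero_le _) x

lemma Bd.nonneg {f : ℝ → ℝ} {a l : ℝ} {r : ℕ} (h : Bd f a l r) : 0 ≤ a :=
  (abs_nonneg _).trans (h.b0 0)

lemma Bd.succ_iff {f : ℝ → ℝ} {a l : ℝ} {r : ℕ} :
    Bd f a l (r + 1) ↔ (∀ x, |f x| ≤ a) ∧ Bd (deriv f) (a * l) l r := by
  constructor
  · intro h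
    refine ⟨h.b0, fun j hj x => ?_⟩
    have := h (j + 1) (by omega) x
    rw [iteratedDeriv_succ'] at this
    rw [pow_succ'] at this; rw [mul_assoc]; exact this
  · rintro ⟨h0, h1⟩ j hj x
    cases j with
    | zero => simpa using h0 x
    | succ j =>
      have := h1 j (by omega) x
      rw [iteratedDeriv_succ', pow_succ', ← mul_assoc]; exact this

lemma Bd.mono {f : ℝ → ℝ} {a b l m : ℝ} {r s : ℕ} (h : Bd f a l r) (hab : a ≤ b) (hl : 0 ≤ l)
    (hlm : l ≤ m) (hsr : s ≤ r) : Bd f b m s := fun j hj x =>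
  (h j (hj.trans hsr) x).trans (by
    have := h.nonneg
    have : 0 ≤ b := this.trans hab
    gcongr)

lemma Bd.le {f : ℝ → ℝ} {a l : ℝ} {r s : ℕ} (h : Bd f a l r) (hsr : s ≤ r) : Bd f a l s :=
  fun j hj x => h j (hj.trans hsr) x

lemma Bd.mono_a {f : ℝ → ℝ} {a b l : ℝ} {r : ℕ} (h : Bd f a l r) (hab : a ≤ b) (hl : 0 ≤ l) :
    Bd f b l r := h.mono hab hl le_rfl le_rfl

lemma Bd.add {f g : ℝ → ℝ} {a b l : ℝ} {r : ℕ} (hf : Sm f) (hg : Sm g) (h : Bd f a l r)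
    (h' : Bd g b l r) : Bd (fun x => f x + g x) (a + b) l r := by
  intro j hj x
  have : iteratedDeriv j (fun x => f x + g x) x = iteratedDeriv j f x + iteratedDeriv j g x :=
    iteratedDeriv_fun_add ((hf.of_le (by exact_mod_cast le_top)).contDiffAt)
      ((hg.of_le (by exact_mod_cast le_top)).contDiffAt)
  rw [this, add_mul]
  exact (abs_add_le _ _).trans (add_le_add (h j hj x) (h' j hj x))

lemma Bd.cmul {f : ℝ → ℝ} {a l : ℝ} {r : ℕ} (hf : Sm f) (h : Bd f a l r) (c : ℝ) :
    Bd (fun x => c * f x) (|c| * a) l r := by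
  intro j hj x
  have : iteratedDeriv j (fun x => c * f x) x = c * iteratedDeriv j f x :=
    iteratedDeriv_const_mul_field c f
  rw [this, abs_mul, mul_assoc]
  exact mul_le_mul_of_nonneg_left (h j hj x) (abs_nonneg _)

lemma Bd.mul {r : ℕ} : ∀ {f g : ℝ → ℝ} {a b l : ℝ} (_ : 0 ≤ l) (_ : Sm f) (_ : Sm g)
    (_ : Bd f a l r) (_ : Bd g b l r), Bd (fun x => f x * g x) (2 ^ r * a * b) l r := by
  induction r with
  | zero =>
    intro f g a b l hl hf hg h h'
    rw [Bd.zero_iff] at *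
    intro x
    rw [abs_mul]
    have := (abs_nonneg _).trans (h x)
    simpa using mul_le_mul (h x) (h' x) (abs_nonneg _) this
  | succ r ih =>
    intro f g a b l hl hf hg h h'
    have h0 := h.nonneg
    have h0' := h'.nonneg
    have hh := Bd.succ_iff.1 h
    have hh' := Bd.succ_iff.1 h'
    rw [Bd.succ_iff]
    constructor
    · intro x
      rw [abs_mul]
      calc |f x| * |g x| ≤ a * b := mul_le_mul (h.b0 x) (h'.b0 x) (abs_nonneg _) h0
        _ = 1 * a * b := by ring
        _ ≤ 2 ^ (r+1) * a * b := by
          gcongr; exact one_le_pow₀ (by norm_num)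
    · have e : deriv (fun x => f x * g x) = fun x => deriv f x * g x + f x * deriv g x := by
        ext x; exact deriv_fun_mul (hf.da x) (hg.da x)
      rw [e]
      have := Bd.add (hf.deriv.mul hg) (hf.mul hg.deriv) (ih hl hf.deriv hg hh.2 (h'.le (by omega)))
        (ih hl hf hg.deriv (h.le (by omega)) hh'.2)
      refine this.mono_a (le_of_eq ?_) hl
      ring

lemma deriv_comp' {g F : ℝ → ℝ} (hg : Sm g) (hF : Sm F) :
    deriv (fun x => g (F x)) = fun x => deriv g (F x) * deriv F x := by
  ext x
  exact deriv_comp (h₂ := g) (h := F) x (hg.da _) (hF.da _)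

lemma Bd.comp' {r : ℕ} {A l : ℝ} {F : ℝ → ℝ} (hA : 1 ≤ A) (hl : 0 ≤ l) (hF : Sm F)
    (hB : Bd (deriv F) A l r) : ∀ s, s ≤ r + 1 → ∀ {g : ℝ → ℝ} {a : ℝ}, Sm g → Bd g a l s →
    Bd (fun x => g (F x)) ((2 ^ r * A) ^ s * a) l s := by
  intro s
  induction s with
  | zero =>
    intro _ g a hg h
    rw [Bd.zero_iff] at *
    intro x; simpa using h (F x)
  | succ s ih =>
    intro hs g a hg h
    have h0 := h.nonneg
    have hh := Bd.succ_iff.1 h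
    rw [Bd.succ_iff]
    have h2 : (1:ℝ) ≤ 2 ^ r * A := one_le_mul_of_one_le_of_one_le (one_le_pow₀ (by norm_num)) hA
    constructor
    · intro x
      refine (h.b0 _).trans ?_
      exact le_mul_of_one_le_left h0 (one_le_pow₀ h2)
    · rw [deriv_comp' hg hF]
      have := Bd.mul hl (hg.deriv.comp hF) hF.deriv (ih (by omega) hg.deriv hh.2)
        (hB.le (by omega : s ≤ r))
      refine this.mono_a ?_ hl
      have : (2:ℝ) ^ s ≤ 2 ^ r := pow_le_pow_right₀ (by norm_num) (by omega)
      calc 2 ^ s * ((2 ^ r * A) ^ s * (a * l)) * A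
          ≤ 2 ^ r * ((2 ^ r * A) ^ s * (a * l)) * A := by gcongr
        _ = _ := by ring

lemma Bd.comp {r : ℕ} {A l : ℝ} {F : ℝ → ℝ} (hA : 1 ≤ A) (hl : 0 ≤ l) (hF : Sm F)
    (hB : Bd (deriv F) A l r) {g : ℝ → ℝ} {a : ℝ} (hg : Sm g) (h : Bd g a l r) :
    Bd (fun x => g (F x)) ((2 ^ r * A) ^ r * a) l r := Bd.comp' hA hl hF hB r (by omega) hg h

/-- reciprocal -/
lemma Bd.recip (r : ℕ) (c A : ℝ) (hc : 0 < c) (hA : 0 ≤ A) : ∃ C : ℝ, 1 ≤ C ∧ ∀ (X : ℝ → ℝ) (l : ℝ),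
    0 ≤ l → Sm X → (∀ x, c ≤ X x) → Bd X A l r → Bd (fun x => (X x)⁻¹) C l r := by
  induction r with
  | zero =>
    refine ⟨max 1 c⁻¹, le_max_left _ _, fun X l hl hX hc' h => ?_⟩
    rw [Bd.zero_iff]
    intro x
    have : 0 < X x := hc.trans_le (hc' x)
    rw [abs_inv, abs_of_pos this]
    exact le_max_of_le_right (inv_anti₀ hc (hc' x))
  | succ r ih =>
    obtain ⟨C, hC, H⟩ := ih
    refine ⟨max C (2 ^ r * A * (2 ^ r * C * C)), le_max_of_le_left hC, fun X l hl hX hc' h => ?_⟩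
    have hp : ∀ x, X x ≠ 0 := fun x => (hc.trans_le (hc' x)).ne'
    have hi : Sm (fun x => (X x)⁻¹) := hX.inv hp
    have hI := H X l hl hX hc' (h.le (by omega))
    rw [Bd.succ_iff]
    refine ⟨fun x => (hI.b0 x).trans (le_max_left _ _), ?_⟩
    have e : deriv (fun x => (X x)⁻¹) = fun x => (-1) * (deriv X x * ((X x)⁻¹ * (X x)⁻¹)) := by
      ext x
      rw [deriv_fun_inv'' (hX.da x) (hp x)]
      have := hp x
      field_simp
    rw [e]
    have h1 := Bd.cmul (hX.deriv.mul (hi.mul hi)) (Bd.mul hl hX.deriv (hi.mul hi)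
      (Bd.succ_iff.1 h).2 (Bd.mul hl hi hi hI hI)) (-1)
    refine h1.mono_a ?_ hl
    calc _ = (2 ^ r * A * (2 ^ r * C * C)) * l := by norm_num; ring
      _ ≤ _ := by gcongr; exact le_max_right _ _

/-- composition with an inverse diffeo -/
lemma deriv_inv_fun {X G : ℝ → ℝ} (hX : Sm X) (hG : Sm G) (hXG : ∀ x, X (G x) = x) (x : ℝ) :
    deriv G x = (deriv X (G x))⁻¹ := by
  have h1 : deriv (fun x => X (G x)) x = 1 := by
    have : (fun x => X (G x)) = fun x => x := by ext; simp [hXG]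
    rw [this]; simp
  rw [deriv_comp' hX hG] at h1
  exact eq_inv_of_mul_eq_one_right h1

lemma deriv_comp_inv {X G g : ℝ → ℝ} (hX : Sm X) (hG : Sm G) (hXG : ∀ x, X (G x) = x)
    (hg : Sm g) : deriv (fun x => g (G x)) =
      fun x => (fun y => deriv g y * (deriv X y)⁻¹) (G x) := by
  rw [deriv_comp' hg hG]
  ext x
  rw [deriv_inv_fun hX hG hXG]

lemma Bd.comp_inv (r : ℕ) (c A : ℝ) (hc : 0 < c) (hA : 0 ≤ A) : ∃ C : ℝ, 1 ≤ C ∧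
    ∀ (X G g : ℝ → ℝ) (l a : ℝ), 0 ≤ l → Sm X → Sm G → (∀ x, X (G x) = x) →
    (∀ x, c ≤ deriv X x) → Bd (deriv X) A l r → Sm g → Bd g a l r →
    Bd (fun x => g (G x)) (C * a) l r := by
  induction r with
  | zero =>
    refine ⟨1, le_rfl, fun X G g l a hl hX hG hXG hc' h hg hb => ?_⟩
    rw [Bd.zero_iff] at *
    intro x; simpa using hb (G x)
  | succ r ih =>
    obtain ⟨C, hC, H⟩ := ih
    obtain ⟨D, hD, HD⟩ := Bd.recip r c A hc hA
    refine ⟨max 1 (C * (2 ^ r * D)), le_max_left _ _, fun X G g l a hl hX hG hXG hc' h hg hb => ?_⟩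
    have h0 := hb.nonneg
    have hY : Sm (fun x => (deriv X x)⁻¹) := hX.deriv.inv (fun x => (hc.trans_le (hc' x)).ne')
    rw [Bd.succ_iff]
    constructor
    · intro x
      exact (hb.b0 _).trans (le_mul_of_one_le_left h0 (le_max_left _ _))
    · rw [deriv_comp_inv hX hG hXG hg]
      have h1 := Bd.mul hl hg.deriv hY (Bd.succ_iff.1 hb).2
        (HD _ l hl hX.deriv hc' (h.le (by omega)))
      have h2 := H X G _ l _ hl hX hG hXG hc' (h.le (by omega)) (hg.deriv.mul hY) h1
      refine h2.mono_a ?_ hl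
      calc _ = (C * (2 ^ r * D)) * a * l := by ring
        _ ≤ _ := by gcongr; exact le_max_right _ _

/-- smooth with values and derivative controlled -/
structure BD (g : ℝ → ℝ) (a l : ℝ) (r : ℕ) : Prop where
  sm : Sm g
  b0 : ∀ x, |g x| ≤ a
  b1 : Bd (deriv g) a l r

lemma BD.nonneg {g : ℝ → ℝ} {a l : ℝ} {r : ℕ} (h : BD g a l r) : 0 ≤ a :=
  (abs_nonneg _).trans (h.b0 0)

lemma BD.le {f : ℝ → ℝ} {a l : ℝ} {r s : ℕ} (h : BD f a l r) (hsr : s ≤ r) : BD f a l s :=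
  ⟨h.sm, h.b0, h.b1.le hsr⟩

lemma BD.mono {f : ℝ → ℝ} {a b l m : ℝ} {r s : ℕ} (h : BD f a l r) (hab : a ≤ b) (hl : 0 ≤ l)
    (hlm : l ≤ m) (hsr : s ≤ r) : BD f b m s :=
  ⟨h.sm, fun x => (h.b0 x).trans hab, h.b1.mono hab hl hlm hsr⟩

lemma BD.mono_a {f : ℝ → ℝ} {a b l : ℝ} {r : ℕ} (h : BD f a l r) (hab : a ≤ b) (hl : 0 ≤ l) :
    BD f b l r := h.mono hab hl le_rfl le_rfl

lemma BD.bd {f : ℝ → ℝ} {a l : ℝ} {r : ℕ} (h : BD f a l r) (hl : 1 ≤ l) : Bd f a l r := by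
  intro j hj x
  have ha := h.nonneg
  cases j with
  | zero => simpa using h.b0 x
  | succ j =>
    rw [iteratedDeriv_succ']
    refine (h.b1 j (by omega) x).trans ?_
    gcongr
    omega

lemma BD.add {f g : ℝ → ℝ} {a b l : ℝ} {r : ℕ} (h : BD f a l r) (h' : BD g b l r) :
    BD (fun x => f x + g x) (a + b) l r := by
  refine ⟨h.sm.add h'.sm, fun x => (abs_add_le _ _).trans (add_le_add (h.b0 x) (h'.b0 x)), ?_⟩
  have : deriv (fun x => f x + g x) = fun x => deriv f x + deriv g x := by
    ext x; exact deriv_fun_add (h.sm.da x) (h'.sm.da x)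
  rw [this]
  exact h.b1.add h.sm.deriv h'.sm.deriv h'.b1

lemma BD.cmul {f : ℝ → ℝ} {a l : ℝ} {r : ℕ} (h : BD f a l r) (c : ℝ) :
    BD (fun x => c * f x) (|c| * a) l r := by
  refine ⟨contDiff_const.mul h.sm, fun x => ?_, ?_⟩
  · rw [abs_mul]; exact mul_le_mul_of_nonneg_left (h.b0 x) (abs_nonneg _)
  · have : deriv (fun x => c * f x) = fun x => c * deriv f x := by
      ext x; exact deriv_const_mul _ (h.sm.da x)
    rw [this]; exact h.b1.cmul h.sm.deriv c

lemma BD.mul {f g : ℝ → ℝ} {a b l : ℝ} {r : ℕ} (hl : 1 ≤ l) (h : BD f a l r) (h' : BD g b l r) :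
    BD (fun x => f x * g x) (2 ^ (r + 1) * a * b) l r := by
  have h0 := h.nonneg
  have h0' := h'.nonneg
  refine ⟨h.sm.mul h'.sm, fun x => ?_, ?_⟩
  · rw [abs_mul]
    calc _ ≤ a * b := mul_le_mul (h.b0 x) (h'.b0 x) (abs_nonneg _) h0
      _ = 1 * a * b := by ring
      _ ≤ _ := by gcongr; exact one_le_pow₀ (by norm_num)
  · have e : deriv (fun x => f x * g x) = fun x => deriv f x * g x + f x * deriv g x := by
        ext x; exact deriv_fun_mul (h.sm.da x) (h'.sm.da x)
    rw [e]
    refine (Bd.add (h.sm.deriv.mul h'.sm) (h.sm.mul h'.sm.deriv)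
      (Bd.mul (by linarith) h.sm.deriv h'.sm h.b1 (h'.bd hl))
      (Bd.mul (by linarith) h.sm h'.sm.deriv (h.bd hl) h'.b1)).mono_a (le_of_eq (by ring))
        (by linarith)

lemma BD.comp_inv (r : ℕ) (c A : ℝ) (hc : 0 < c) (hA : 0 ≤ A) : ∃ C : ℝ, 1 ≤ C ∧
    ∀ (X G g : ℝ → ℝ) (l a : ℝ), 0 ≤ l → Sm X → Sm G → (∀ x, X (G x) = x) →
    (∀ x, c ≤ deriv X x) → Bd (deriv X) A l r → BD g a l r →
    BD (fun x => g (G x)) (C * a) l r := by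
  obtain ⟨C, hC, H⟩ := Bd.comp_inv r c A hc hA
  obtain ⟨D, hD, HD⟩ := Bd.recip r c A hc hA
  refine ⟨max 1 (C * (2 ^ r * D)), le_max_left _ _, fun X G g l a hl hX hG hXG hc' h hb => ?_⟩
  have h0 := hb.nonneg
  have hg := hb.sm
  have hY : Sm (fun x => (deriv X x)⁻¹) := hX.deriv.inv (fun x => (hc.trans_le (hc' x)).ne')
  refine ⟨hg.comp hG, fun x => (hb.b0 _).trans (le_mul_of_one_le_left h0 (le_max_left _ _)), ?_⟩
  rw [deriv_comp_inv hX hG hXG hg]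
  have h1 := Bd.mul hl hg.deriv hY hb.b1 (HD _ l hl hX.deriv hc' h)
  have h2 := H X G _ l _ hl hX hG hXG hc' h (hg.deriv.mul hY) h1
  refine h2.mono_a ?_ hl
  calc _ = (C * (2 ^ r * D)) * a := by ring
    _ ≤ _ := by gcongr; exact le_max_right _ _

/-- affine change of variable -/
lemma Bd.shift {f : ℝ → ℝ} {a l : ℝ} {r : ℕ} (h : Bd f a l r) (s : ℝ) :
    Bd (fun x => f (x + s)) a l r := by
  intro j hj x
  rw [iteratedDeriv_comp_add_const]
  exact h j hj _

lemma BD.shift {f : ℝ → ℝ} {a l : ℝ} {r : ℕ} (h : BD f a l r) (s : ℝ) :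
    BD (fun x => f (x + s)) a l r := by
  refine ⟨h.sm.comp (contDiff_id.add contDiff_const), fun x => h.b0 _, ?_⟩
  have : deriv (fun x => f (x + s)) = fun x => deriv f (x + s) := by
    ext x; exact deriv_comp_add_const _ _ _
  rw [this]; exact h.b1.shift s


lemma Sm.cmp {f g : ℝ → ℝ} (hf : Sm f) (hg : Sm g) : Sm (fun x => f (g x)) := ContDiff.comp hf hg

lemma Sm.of_at {f : ℝ → ℝ} (h : ∀ x, ContDiffAt ℝ (⊤ : ℕ∞) f x) : Sm f :=
  contDiff_iff_contDiffAt.2 h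

lemma Bd.const (c l : ℝ) (hl : 0 ≤ l) (r : ℕ) : Bd (fun _ => c) |c| l r := by
  induction r with
  | zero => rw [Bd.zero_iff]; simp
  | succ r ih =>
    rw [Bd.succ_iff]
    refine ⟨fun x => le_rfl, fun j hj x => ?_⟩
    simp only [deriv_const']
    have : iteratedDeriv j (fun _ : ℝ => (0:ℝ)) x = 0 := by
      have := iteratedDeriv_const (𝕜 := ℝ) (n := j) (c := (0:ℝ)) (x := x)
      simp [this]
    rw [this]; simp; positivity

lemma sharp_mul (r : ℕ) : ∀ {f g : ℝ → ℝ} {A b l : ℝ}, 0 ≤ l → Sm f → Sm g →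
    Bd (deriv g) (b * l) l r → Bd f A l r → ∀ x,
    |iteratedDeriv (r + 1) (fun x => g x * f x) x - g x * iteratedDeriv (r + 1) f x| ≤
      2 ^ (r + 1) * A * b * l ^ (r + 1) := by
  induction r with
  | zero =>
    intro f g A b l hl hf hg hb hf' x
    have e : deriv (fun x => g x * f x) x = deriv g x * f x + g x * deriv f x :=
      deriv_fun_mul (hg.da x) (hf.da x)
    simp only [zero_add, iteratedDeriv_one, pow_one]
    rw [e, add_sub_cancel_right, abs_mul]
    have h1 := hb.b0 x
    have h2 := hf'.b0 x
    have := mul_le_mul h1 h2 (abs_nonneg _) hb.nonneg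
    have h3 := mul_nonneg hb.nonneg hf'.nonneg
    nlinarith
  | succ r ih =>
    intro f g A b l hl hf hg hb hf' x
    have e : deriv (fun x => g x * f x) = fun x => deriv g x * f x + g x * deriv f x := by
      ext x; exact deriv_fun_mul (hg.da x) (hf.da x)
    have hf1 := Bd.succ_iff.1 hf'
    have h1 := ih hl hf.deriv hg (hb.le (by omega)) hf1.2 x
    have h2 := Bd.mul hl hg.deriv hf hb hf' (r+1) le_rfl x
    rw [iteratedDeriv_succ', iteratedDeriv_succ' (f := f), e]
    have e2 : iteratedDeriv (r+1) (fun x => deriv g x * f x + g x * deriv f x) x =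
      iteratedDeriv (r+1) (fun x => deriv g x * f x) x +
      iteratedDeriv (r+1) (fun x => g x * deriv f x) x :=
      iteratedDeriv_fun_add ((hg.deriv.mul hf).of_le (by exact_mod_cast le_top)).contDiffAt
        ((hg.mul hf.deriv).of_le (by exact_mod_cast le_top)).contDiffAt
    rw [e2, add_sub_assoc]
    refine (abs_add_le _ _).trans ((add_le_add h2 h1).trans (le_of_eq ?_))
    ring

/-- displacement of the n-fold product -/
def phiW (t : ℝ) (U : ℝ → ℝ) : ℕ → ℝ → ℝ
  | 0 => fun _ => 0
  | n + 1 => fun x => phiW t U n (x + (-t)) + U (x + phiW t U n (x + (-t)))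

lemma phiW_sm (t : ℝ) {U : ℝ → ℝ} (hU : Sm U) (n : ℕ) : Sm (phiW t U n) := by
  induction n with
  | zero => exact contDiff_const
  | succ n ih =>
    have : Sm (fun x => phiW t U n (x + (-t))) := ih.comp (contDiff_id.add contDiff_const)
    exact this.add (hU.comp (contDiff_id.add this))

lemma phiW_bd0 (t : ℝ) {U : ℝ → ℝ} {ε : ℝ} (h : ∀ x, |U x| ≤ ε) (n : ℕ) (x : ℝ) :
    |phiW t U n x| ≤ n * ε := by
  induction n generalizing x with
  | zero => simp [phiW]
  | succ n ih =>
    simp only [phiW]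
    refine (abs_add_le _ _).trans ?_
    have := ih (x + -t)
    have := h (x + phiW t U n (x + -t))
    push_cast; linarith

lemma phiW_deriv (t : ℝ) {U : ℝ → ℝ} (hU : Sm U) (n : ℕ) :
    deriv (phiW t U (n+1)) = fun x => deriv (phiW t U n) (x + -t) +
      deriv U (x + phiW t U n (x + -t)) * (1 + deriv (phiW t U n) (x + -t)) := by
  ext x
  have hs : Sm (fun x => phiW t U n (x + (-t))) :=
    (phiW_sm t hU n).comp (contDiff_id.add contDiff_const)
  have hF : Sm (fun x => x + phiW t U n (x + (-t))) := contDiff_id.add hs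
  have e1 : deriv (fun x => phiW t U n (x + (-t))) x = deriv (phiW t U n) (x + -t) :=
    deriv_comp_add_const _ _ _
  have e2 : deriv (fun x => x + phiW t U n (x + (-t))) x = 1 + deriv (phiW t U n) (x + -t) := by
    rw [deriv_fun_add differentiableAt_fun_id (hs.da x), e1]; simp
  show deriv (fun x => phiW t U n (x + (-t)) + U (x + phiW t U n (x + (-t)))) x = _
  rw [deriv_fun_add (hs.da x) ((hU.cmp hF).da x), e1]
  have := congrFun (deriv_comp' hU hF) x
  rw [show deriv (fun x => U (x + phiW t U n (x + -t))) x = _ from this, e2]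

lemma phiW_BD (r : ℕ) : ∃ C : ℝ, 1 ≤ C ∧ ∀ (t : ℝ) (U : ℝ → ℝ) (ε l : ℝ) (n : ℕ), 0 ≤ l →
    BD U ε l r → n * ε ≤ 1 / 4 → BD (phiW t U n) (C * (n * ε)) l r := by
  induction r with
  | zero =>
    refine ⟨2, by norm_num, fun t U ε l n hl hU hn => ⟨phiW_sm t hU.sm n, fun x => ?_, ?_⟩⟩
    · have := phiW_bd0 t hU.b0 n x
      have := (abs_nonneg _).trans this
      linarith
    rw [Bd.zero_iff]
    have hε := hU.nonneg
    induction n with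
    | zero => intro x; simp [phiW]
    | succ n ih =>
      intro x
      have hn' : (n:ℝ) * ε ≤ 1 / 4 := by push_cast at hn; linarith
      have h1 := ih hn' (x + -t)
      rw [phiW_deriv t hU.sm]
      simp only
      set d := deriv (phiW t U n) (x + -t)
      have h2 := hU.b1.b0 (x + phiW t U n (x + -t))
      set e := deriv U (x + phiW t U n (x + -t))
      have h3 : |1 + d| ≤ 3 / 2 := by
        refine (abs_add_le _ _).trans ?_
        rw [abs_one]; linarith
      have h4 : |e * (1 + d)| ≤ ε * (3/2) := by
        rw [abs_mul]; exact mul_le_mul h2 h3 (abs_nonneg _) hε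
      refine (abs_add_le _ _).trans ?_
      push_cast; linarith
  | succ r ih =>
    obtain ⟨C, hC, H⟩ := ih
    set A := 1 + C with hA
    set B := 2 ^ r * ((2 ^ r * A) ^ r) * A with hB
    set S := 2 ^ (r + 1) * A * B with hS
    have hA1 : 1 ≤ A := by linarith
    have hS0 : 0 ≤ S := by positivity
    refine ⟨max C (2 * S), le_max_of_le_left hC, fun t U ε l n hl hU hn => ?_⟩
    have hε := hU.nonneg
    have hBn : ∀ m : ℕ, m * ε ≤ 1 / 4 → BD (phiW t U m) (C * (m * ε)) l r := fun m hm =>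
      H t U ε l m hl (hU.le (by omega)) hm
    have top : ∀ m : ℕ, m * ε ≤ 1 / 4 → ∀ x, |iteratedDeriv (r+1) (deriv (phiW t U m)) x| ≤
        2 * S * (m * ε) * l ^ (r + 1) := by
      intro m
      induction m with
      | zero =>
        intro _ x
        have : deriv (phiW t U 0) = fun _ => 0 := by
          ext x; simp [phiW]
        rw [this]
        have := Bd.const 0 l hl (r+1) (r+1) le_rfl x
        simp
      | succ m ihm =>
        intro hm x
        have hm' : (m:ℝ) * ε ≤ 1 / 4 := by push_cast at hm; linarith
        have h1 := ihm hm'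
        have hsm := phiW_sm t hU.sm m
        have hs : Sm (fun x => phiW t U m (x + (-t))) :=
          hsm.comp (contDiff_id.add contDiff_const)
        set F : ℝ → ℝ := fun x => x + phiW t U m (x + (-t)) with hF
        have hFs : Sm F := contDiff_id.add hs
        have hds : Sm (fun x => deriv (phiW t U m) (x + -t)) :=
          hsm.deriv.comp (contDiff_id.add contDiff_const)
        have hdF : deriv F = fun x => 1 + deriv (phiW t U m) (x + -t) := by
          ext x
          have e1 : deriv (fun x => phiW t U m (x + (-t))) x = deriv (phiW t U m) (x + -t) :=
            deriv_comp_add_const _ _ _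
          rw [hF, deriv_fun_add differentiableAt_fun_id (hs.da x), e1]; simp
        have bF : Bd (deriv F) A l r := by
          rw [hdF]
          refine (Bd.add contDiff_const hds (Bd.const 1 l hl r)
            ((hBn m hm').b1.shift (-t))).mono_a ?_ hl
          rw [abs_one, hA]
          have : C * (m * ε) ≤ C * 1 := by gcongr; linarith
          linarith
        rw [phiW_deriv t hU.sm]
        have e2 : (fun x => deriv (phiW t U m) (x + -t) +
            deriv U (x + phiW t U m (x + -t)) * (1 + deriv (phiW t U m) (x + -t))) =
            fun x => deriv (phiW t U m) (x + -t) + (fun x => deriv U (F x)) x * (deriv F) x := by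
          rw [hdF]
        have hg : Sm (fun x => deriv U (F x)) := hU.sm.deriv.comp hFs
        have e3 : iteratedDeriv (r+1) (fun x => deriv (phiW t U m) (x + -t) +
            (fun x => deriv U (F x)) x * (deriv F) x) x =
            iteratedDeriv (r+1) (fun x => deriv (phiW t U m) (x + -t)) x +
            iteratedDeriv (r+1) (fun x => (fun x => deriv U (F x)) x * (deriv F) x) x :=
          iteratedDeriv_fun_add (hds.of_le (by exact_mod_cast le_top)).contDiffAt
            ((hg.mul hFs.deriv).of_le (by exact_mod_cast le_top)).contDiffAt
        rw [e2, e3]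
        have hg' : Bd (deriv (fun x => deriv U (F x))) (B * ε * l) l r := by
          rw [deriv_comp' hU.sm.deriv hFs]
          have := Bd.mul hl (hU.sm.deriv.deriv.comp hFs) hFs.deriv
            (Bd.comp hA1 hl hFs bF hU.sm.deriv.deriv (Bd.succ_iff.1 hU.b1).2) bF
          refine this.mono_a (le_of_eq ?_) hl
          rw [hB]; ring
        have hsh := sharp_mul r hl hFs.deriv hg hg' bF x
        have e4 : iteratedDeriv (r+1) (deriv F) x =
            iteratedDeriv (r+1) (deriv (phiW t U m)) (x + -t) := by
          rw [hdF, iteratedDeriv_succ', iteratedDeriv_succ']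
          have : deriv (fun x => 1 + deriv (phiW t U m) (x + -t)) =
            fun x => deriv (deriv (phiW t U m)) (x + -t) := by
            ext x
            rw [deriv_const_add]
            exact deriv_comp_add_const _ _ _
          rw [this, iteratedDeriv_comp_add_const]
        have e5 : iteratedDeriv (r+1) (fun x => deriv (phiW t U m) (x + -t)) x =
            iteratedDeriv (r+1) (deriv (phiW t U m)) (x + -t) := by
          rw [iteratedDeriv_comp_add_const]
        rw [e4] at hsh
        rw [e5]
        have h6 := h1 (x + -t)
        set a := iteratedDeriv (r+1) (deriv (phiW t U m)) (x + -t)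
        set P := iteratedDeriv (r+1) (fun x => (fun x => deriv U (F x)) x * (deriv F) x) x
        have h7 : |deriv U (F x)| ≤ ε := hU.b1.b0 _
        have h8 : |deriv U (F x) * a| ≤ ε * (2 * S * (m * ε) * l ^ (r + 1)) := by
          rw [abs_mul]; exact mul_le_mul h7 h6 (abs_nonneg _) hε
        have h9 : |a + P| ≤ |a| + |P - deriv U (F x) * a| + |deriv U (F x) * a| := by
          calc |a + P| = |a + (P - deriv U (F x) * a) + deriv U (F x) * a| := by ring_nf
            _ ≤ _ := abs_add_three _ _ _
        refine h9.trans ?_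
        have hsh' : |P - deriv U (F x) * a| ≤ S * ε * l ^ (r+1) := by
          refine hsh.trans (le_of_eq ?_)
          rw [hS]; ring
        have hl' : 0 ≤ l ^ (r+1) := by positivity
        have : ε * (2 * S * (m * ε) * l ^ (r + 1)) ≤ S * ε * l ^ (r+1) * (1/2) := by
          have : S * ε * l ^ (r+1) * (2 * (m * ε)) ≤ S * ε * l ^ (r+1) * (1/2) := by
            gcongr; linarith
          linarith
        have h10 : 0 ≤ S * ε * l ^ (r+1) := by positivity
        push_cast
        linarith
    have hb := hBn n hn
    have hnε : 0 ≤ n * ε := by positivity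
    refine ⟨hb.sm, fun x => (hb.b0 x).trans (by gcongr; exact le_max_left _ _), ?_⟩
    intro j hj x
    rcases Nat.lt_or_ge j (r+1) with hj' | hj'
    · refine (hb.b1 j (by omega) x).trans ?_
      gcongr; exact le_max_left _ _
    · obtain rfl : j = r + 1 := by omega
      refine (top n hn x).trans ?_
      gcongr; exact le_max_right _ _

/-- inverse of a diffeo of the line -/
lemma exists_inv {X : ℝ → ℝ} (hX : Sm X) (hp : ∀ x, 0 < deriv X x) (hs : Function.Surjective X) :
    ∃ G : ℝ → ℝ, Sm G ∧ (∀ x, X (G x) = x) ∧ ∀ x, G (X x) = x := by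
  have hm : StrictMono X := strictMono_of_deriv_pos hp
  let e : ℝ ≃o ℝ := hm.orderIsoOfSurjective X hs
  let ho : ℝ ≃ₜ ℝ := e.toHomeomorph
  refine ⟨e.symm, ?_, fun x => e.apply_symm_apply x, fun x => e.symm_apply_apply x⟩
  refine Sm.of_at ?_
  intro y
  have hd : HasDerivAt ho.toOpenPartialHomeomorph (deriv X (e.symm y)) (e.symm y) :=
    (hX.da (e.symm y)).hasDerivAt
  exact ho.toOpenPartialHomeomorph.contDiffAt_symm_deriv (hp _).ne' (by simp) hd hX.contDiffAt

lemma surj_of_bdd {u : ℝ → ℝ} (hu : Continuous u) (a : ℝ) (hb : ∀ x, |u x| ≤ a) :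
    Function.Surjective (fun x => x + u x) := by
  intro y
  have h1 := abs_le.1 (hb (y - a))
  have h2 := abs_le.1 (hb (y + a))
  have := intermediate_value_Icc (f := fun x => x + u x) (a := y - a) (b := y + a)
    (by linarith) (by fun_prop)
  obtain ⟨x, -, hx⟩ := this (show y ∈ Icc _ _ from ⟨by linarith, by linarith⟩)
  exact ⟨x, hx⟩

lemma deriv_id_add {u : ℝ → ℝ} (hu : Sm u) (x : ℝ) : deriv (fun x => x + u x) x = 1 + deriv u x := by
  rw [deriv_fun_add differentiableAt_fun_id (hu.da x)]; simp

/-- near-identity diffeo as a permutation -/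
def dP (u : ℝ → ℝ) : Equiv.Perm ℝ := by
  classical
  exact if h : Function.Bijective (fun x => x + u x) then Equiv.ofBijective _ h else 1

/-- good displacement -/
def Gd (u : ℝ → ℝ) : Prop := BD u 1 1 0 ∧ ∀ x, |deriv u x| ≤ 1 / 2

lemma BD.gd {u : ℝ → ℝ} {a l : ℝ} {r : ℕ} (h : BD u a l r) (ha : a ≤ 1 / 2) : Gd u := by
  refine ⟨⟨h.sm, fun x => (h.b0 x).trans (by linarith), ?_⟩, fun x => (h.b1.b0 x).trans ha⟩
  rw [Bd.zero_iff]; exact fun x => (h.b1.b0 x).trans (by linarith)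

lemma Gd.inv {u : ℝ → ℝ} (h : Gd u) : ∃ G : ℝ → ℝ, Sm G ∧ (∀ x, G x + u (G x) = x) ∧
    ∀ x, G (x + u x) = x := by
  refine exists_inv (X := fun x => x + u x) (contDiff_id.add h.1.sm) (fun x => ?_)
    (surj_of_bdd h.1.sm.continuous 1 h.1.b0)
  rw [deriv_id_add h.1.sm]
  have := abs_le.1 (h.2 x); linarith

lemma dP_apply {u : ℝ → ℝ} (h : Gd u) (x : ℝ) : dP u x = x + u x := by
  obtain ⟨G, -, h1, h2⟩ := h.inv
  have : Function.Bijective (fun x => x + u x) :=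
    ⟨Function.LeftInverse.injective h2, Function.RightInverse.surjective h1⟩
  simp [dP, this]

lemma Gd.mono {u : ℝ → ℝ} (h : Gd u) : StrictMono (fun x => x + u x) := by
  apply strictMono_of_deriv_pos
  intro x
  rw [deriv_id_add h.1.sm]
  have := abs_le.1 (h.2 x); linarith

/-- periodic extension -/
lemma periodic_ext {w : ℝ → ℝ} (hw : Sm w) {t : ℝ} (ht : 0 < t) (ht1 : t ≤ 1 / 2)
    (hp : ∀ x ∈ Icc (11:ℝ) 15, w (x + t) = w x) :
    ∃ m : ℝ → ℝ, Sm m ∧ (∀ x, m (x + t) = m x) ∧ (∀ x ∈ Icc (11:ℝ) 14, m x = w x) ∧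
      ∀ {a l : ℝ} {r : ℕ}, BD w a l r → BD m a l r := by
  have hk : ∀ (k : ℕ) x, 11 ≤ x → x + k * t ≤ 15 → w (x + k * t) = w x := by
    intro k
    induction k with
    | zero => intro x _ _; simp
    | succ k ih =>
      intro x hx hx'
      push_cast at *
      have := hp (x + k * t) ⟨by nlinarith [Nat.cast_nonneg (α := ℝ) k], by linarith⟩
      rw [show x + (k + 1) * t = x + k * t + t by ring, this, ih x hx (by linarith)]
  have hz : ∀ (k l : ℤ) x, x + k * t ∈ Icc (11:ℝ) 15 → x + l * t ∈ Icc (11:ℝ) 15 →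
      w (x + k * t) = w (x + l * t) := by
    have key : ∀ (k l : ℤ), k ≤ l → ∀ x, x + k * t ∈ Icc (11:ℝ) 15 → x + l * t ∈ Icc (11:ℝ) 15 →
      w (x + k * t) = w (x + l * t) := by
      intro k l hkl x h1 h2
      obtain ⟨n, rfl⟩ := Int.le.dest hkl
      have e : x + ((k + n : ℤ) : ℝ) * t = x + k * t + n * t := by push_cast; ring
      rw [e] at h2 ⊢
      exact (hk n _ h1.1 h2.2).symm
    intro k l x h1 h2
    rcases le_total k l with h | h
    · exact key k l h x h1 h2
    · exact (key l k h x h2 h1).symm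
  let K : ℝ → ℤ := fun x => ⌈(12 - x) / t⌉
  have hK : ∀ x, x + K x * t ∈ Ico (12:ℝ) (12 + t) := by
    intro x
    have h1 := Int.le_ceil ((12 - x) / t)
    have h2 := Int.ceil_lt_add_one ((12 - x) / t)
    rw [div_le_iff₀ ht] at h1
    have h3 : (12 - x) / t * t = 12 - x := by field_simp
    have h4 : (K x : ℝ) * t < ((12 - x) / t + 1) * t := mul_lt_mul_of_pos_right h2 ht
    constructor
    · show 12 ≤ x + (K x : ℝ) * t
      have : 12 - x ≤ (K x : ℝ) * t := h1
      linarith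
    · show x + (K x : ℝ) * t < 12 + t
      nlinarith
  let m : ℝ → ℝ := fun x => w (x + K x * t)
  have hm : ∀ (k : ℤ) x, x + k * t ∈ Icc (11:ℝ) 15 → m x = w (x + k * t) := by
    intro k x h
    have := hK x
    exact hz _ _ _ ⟨by linarith [this.1], by linarith [this.2]⟩ h
  have hloc : ∀ x, m =ᶠ[𝓝 x] fun y => w (y + K x * t) := by
    intro x
    have h := hK x
    have : Ioo (x - 1/2) (x + 1/2) ∈ 𝓝 x := Ioo_mem_nhds (by linarith) (by linarith)
    filter_upwards [this] with y hy
    exact hm _ _ ⟨by linarith [h.1, hy.1], by linarith [h.2, hy.2]⟩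
  have hms : Sm m := by
    refine Sm.of_at ?_
    intro x
    exact ContDiffAt.congr_of_eventuallyEq
      (hw.comp (contDiff_id.add contDiff_const)).contDiffAt (hloc x)
  refine ⟨m, hms, ?_, ?_, ?_⟩
  · intro x
    have h := hK x
    rw [hm (K x - 1) (x + t) ⟨by push_cast; linarith [h.1], by push_cast; linarith [h.2]⟩]
    show _ = w _
    congr 1; push_cast; ring
  · intro x hx
    rw [hm 0 x ⟨by push_cast; linarith [hx.1], by push_cast; linarith [hx.2]⟩]; simp
  · intro a l r h
    refine ⟨hms, fun x => h.b0 _, fun j hj x => ?_⟩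
    rw [← iteratedDeriv_succ', (hloc x).iteratedDeriv_eq, iteratedDeriv_comp_add_const,
      iteratedDeriv_succ']
    exact h.b1 j hj _

/-- Rolle gain -/
lemma rolle_gain {m : ℝ → ℝ} (hm : Sm m) {t : ℝ} (ht : 0 < t) (hp : ∀ x, m (x + t) = m x)
    (h0 : ∃ x, m x = 0) {a : ℝ} (ha : ∀ x, |deriv m x| ≤ a) (x : ℝ) : |m x| ≤ t * a := by
  obtain ⟨z, hz⟩ := h0
  have hper : Function.Periodic m t := hp
  obtain ⟨y, hy, hxy⟩ := hper.exists_mem_Ico ht x z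
  rw [hxy]
  have := Convex.norm_image_sub_le_of_norm_deriv_le (f := m) (s := univ) (x := z) (y := y) (C := a)
    (fun x _ => hm.da x) (fun x _ => by simpa using ha x) convex_univ (mem_univ _) (mem_univ _)
  rw [hz, sub_zero, Real.norm_eq_abs, Real.norm_eq_abs] at this
  have ha0 := (abs_nonneg _).trans (ha 0)
  refine this.trans ?_
  rw [abs_of_nonneg (by linarith [hy.1]), mul_comm]
  gcongr
  linarith [hy.2]

lemma rolle_zero {m : ℝ → ℝ} (hm : Sm m) {t : ℝ} (ht : 0 < t) (hp : ∀ x, m (x + t) = m x) :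
    ∃ x, deriv m x = 0 := by
  obtain ⟨c, -, hc⟩ := exists_deriv_eq_zero (f := m) (a := 0) (b := t) ht hm.continuous.continuousOn
    (by rw [← hp 0]; simp)
  exact ⟨c, hc⟩

lemma BD.gain {m : ℝ → ℝ} {t a l : ℝ} (ht : 0 < t) (ht1 : t ≤ 1) (hl : 1 ≤ l)
    (hp : ∀ x, m (x + t) = m x) (h0 : ∃ x, m x = 0) (r p : ℕ) (h : BD m a l (r + p)) :
    BD m (a * (t * l) ^ p) l r := by
  have ha := h.nonneg
  have hpi : ∀ j x, iteratedDeriv j m (x + t) = iteratedDeriv j m x := by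
    intro j x
    have : (fun z => m (z + t)) = m := by ext; exact hp _
    conv_rhs => rw [← this]
    rw [iteratedDeriv_comp_add_const]
  have hz : ∀ j, ∃ x, iteratedDeriv j m x = 0 := by
    intro j
    cases j with
    | zero => simpa using h0
    | succ j =>
      rw [iteratedDeriv_succ]
      exact rolle_zero (h.sm.iter j) ht (hpi j)
  have one : ∀ j b, (∀ x, |iteratedDeriv (j+1) m x| ≤ b) → ∀ x, |iteratedDeriv j m x| ≤ t * b := by
    intro j b hb
    exact rolle_gain (h.sm.iter j) ht (hpi j) (hz j) (by rw [← iteratedDeriv_succ]; exact hb)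
  have many : ∀ p j b, (∀ x, |iteratedDeriv (j+p) m x| ≤ b) →
      ∀ x, |iteratedDeriv j m x| ≤ t ^ p * b := by
    intro p
    induction p with
    | zero => intro j b hb; simpa using hb
    | succ p ih =>
      intro j b hb x
      have := ih j (t * b) (one (j + p) b hb) x
      rw [pow_succ, mul_assoc]; exact this
  have main : Bd (deriv m) (a * (t * l) ^ p) l r := by
    intro j hj x
    rw [← iteratedDeriv_succ']
    refine (many p (j+1) (a * l ^ (j + p)) (fun y => ?_) x).trans (le_of_eq ?_)
    · rw [show j + 1 + p = (j + p) + 1 by ring, iteratedDeriv_succ']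
      exact h.b1 (j + p) (by omega) y
    · rw [pow_add, mul_pow]; ring
  refine ⟨h.sm, fun x => ?_, main⟩
  have := one 0 (a * (t * l) ^ p) (fun y => by simpa using main.b0 y) x
  simp only [iteratedDeriv_zero] at this
  refine this.trans ?_
  have : 0 ≤ a * (t * l) ^ p := by positivity
  nlinarith


def Cut (f : ℝ → ℝ) : Prop := Sm f ∧ ∀ r, ∃ B : ℝ, 1 ≤ B ∧ ∀ l, 1 ≤ l → BD f B l r

lemma cut_of_const {f : ℝ → ℝ} (hf : Sm f) (R k1 k2 : ℝ) (h1 : ∀ x, R ≤ x → f x = k1)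
    (h2 : ∀ x, x ≤ -R → f x = k2) : Cut f := by
  refine ⟨hf, fun r => ?_⟩
  have hz : ∀ j x, R < |x| → iteratedDeriv j (deriv f) x = 0 := by
    intro j x hx
    rw [← iteratedDeriv_succ']
    have : ∃ k, f =ᶠ[𝓝 x] fun _ => k := by
      rcases lt_abs.1 hx with h | h
      · exact ⟨k1, by filter_upwards [Ioi_mem_nhds h] with y hy using h1 y (le_of_lt hy)⟩
      · exact ⟨k2, by filter_upwards [Iio_mem_nhds (show x < -R by linarith)] with y hy
                    using h2 y (le_of_lt hy)⟩
    obtain ⟨k, hk⟩ := this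
    rw [hk.iteratedDeriv_eq, iteratedDeriv_const]; simp
  have hb : ∀ j, ∃ B, ∀ x, |iteratedDeriv j (deriv f) x| ≤ B := by
    intro j
    obtain ⟨B, hB⟩ := (isCompact_Icc (a := -|R|) (b := |R|)).exists_bound_of_continuousOn
      ((hf.deriv.iter j).continuous.continuousOn)
    refine ⟨max B 0, fun x => ?_⟩
    by_cases hx : x ∈ Icc (-|R|) |R|
    · exact le_max_of_le_left (hB x hx)
    · rw [hz j x ?_]; · simp
      by_contra hc
      exact hx (abs_le.1 ((not_lt.1 hc).trans (le_abs_self R)))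
  have hb0 : ∃ B, ∀ x, |f x| ≤ B := by
    obtain ⟨B, hB⟩ := (isCompact_Icc (a := -|R|) (b := |R|)).exists_bound_of_continuousOn
      (hf.continuous.continuousOn)
    refine ⟨max B (max |k1| |k2|), fun x => ?_⟩
    by_cases hx : x ∈ Icc (-|R|) |R|
    · exact le_max_of_le_left (hB x hx)
    · apply le_max_of_le_right
      have : R < |x| := by
        by_contra hc
        exact hx (abs_le.1 ((not_lt.1 hc).trans (le_abs_self R)))
      rcases lt_abs.1 this with h | h
      · rw [h1 x h.le]; exact le_max_left _ _
      · rw [h2 x (by linarith)]; exact le_max_right _ _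
  choose b hb using hb
  obtain ⟨b0, hb0⟩ := hb0
  refine ⟨1 + |b0| + ∑ j ∈ Finset.range (r+1), |b j|, ?_, fun l hl => ⟨hf, fun x => ?_, ?_⟩⟩
  · have : 0 ≤ ∑ j ∈ Finset.range (r+1), |b j| := Finset.sum_nonneg (fun _ _ => abs_nonneg _)
    have := abs_nonneg b0; linarith
  · have : 0 ≤ ∑ j ∈ Finset.range (r+1), |b j| := Finset.sum_nonneg (fun _ _ => abs_nonneg _)
    have := le_abs_self b0; linarith [hb0 x]
  · intro j hj x
    have h3 : |b j| ≤ ∑ j ∈ Finset.range (r+1), |b j| :=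
      Finset.single_le_sum (f := fun j => |b j|) (fun _ _ => abs_nonneg _)
        (Finset.mem_range.2 (by omega))
    have h4 := abs_nonneg b0
    have h5 := abs_nonneg (b j)
    calc _ ≤ b j := hb j x
      _ ≤ |b j| := le_abs_self _
      _ ≤ (1 + |b0| + ∑ j ∈ Finset.range (r+1), |b j|) := by linarith
      _ ≤ _ := le_mul_of_one_le_right (by linarith) (one_le_pow₀ hl)

lemma Bd.scale {f : ℝ → ℝ} {a l : ℝ} {r : ℕ} (hf : Sm f) (h : Bd f a l r) {k : ℝ} (hk : 0 ≤ k)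
    (hk1 : k ≤ 1) : Bd (fun x => f (k * x)) a l r := by
  intro j hj x
  rw [iteratedDeriv_comp_const_mul (hf.of_le (by exact_mod_cast le_top))]
  rw [abs_mul, abs_of_nonneg (pow_nonneg hk _)]
  have := h j hj (k * x)
  have h2 : k ^ j ≤ 1 := pow_le_one₀ hk hk1
  nlinarith [abs_nonneg (iteratedDeriv j f (k * x)), pow_nonneg hk j]

lemma BD.scale {f : ℝ → ℝ} {a l : ℝ} {r : ℕ} (h : BD f a l r) {k : ℝ} (hk : 0 ≤ k)
    (hk1 : k ≤ 1) : BD (fun x => f (k * x)) a l r := by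
  refine ⟨h.sm.cmp (contDiff_const.mul contDiff_id), fun x => h.b0 _, ?_⟩
  have : deriv (fun x => f (k * x)) = fun x => k * deriv f (k * x) := by
    ext x
    simpa using deriv_comp_mul_left k f x
  rw [this]
  have hnn := h.nonneg
  have := (h.b1.scale h.sm.deriv hk hk1).cmul
    (h.sm.deriv.cmp (contDiff_const.mul contDiff_id)) k
  intro j hj x
  refine (this j hj x).trans ?_
  rw [abs_of_nonneg hk]
  have h2 : 0 ≤ a * l ^ j := (abs_nonneg _).trans (h.b1 j hj 0)
  nlinarith

open Real (smoothTransition)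

lemma Sm.st {f : ℝ → ℝ} (hf : Sm f) : Sm (fun x => smoothTransition (f x)) :=
  Sm.cmp Real.smoothTransition.contDiff hf

lemma st_abs (x : ℝ) : |smoothTransition x| ≤ 1 := by
  rw [abs_of_nonneg (Real.smoothTransition.nonneg _)]; exact Real.smoothTransition.le_one _

def zt (x : ℝ) : ℝ := smoothTransition ((900 - x ^ 2) / 500)
def bt (x : ℝ) : ℝ := smoothTransition (9 - x ^ 2)
def et (x : ℝ) : ℝ := smoothTransition (2 * x - 1 / 2)
def th (x : ℝ) : ℝ := smoothTransition (13 - x)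

lemma zt_one {x : ℝ} (h : |x| ≤ 20) : zt x = 1 := by
  apply Real.smoothTransition.one_of_one_le
  have := abs_le.1 h; nlinarith

lemma zt_zero {x : ℝ} (h : 30 ≤ |x|) : zt x = 0 := by
  apply Real.smoothTransition.zero_of_nonpos
  have := sq_abs x; nlinarith

lemma bt_one {x : ℝ} (h : |x| ≤ 2) : bt x = 1 := by
  apply Real.smoothTransition.one_of_one_le
  have := abs_le.1 h; nlinarith

lemma bt_zero {x : ℝ} (h : 3 ≤ |x|) : bt x = 0 := by
  apply Real.smoothTransition.zero_of_nonpos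
  have := sq_abs x; nlinarith

lemma bt_anti {x y : ℝ} (h : |x| ≤ |y|) : bt y ≤ bt x := by
  apply Real.smoothTransition.monotone
  have := sq_le_sq.2 h; linarith

lemma bt_nonneg (x : ℝ) : 0 ≤ bt x := Real.smoothTransition.nonneg _
lemma bt_abs (x : ℝ) : |bt x| ≤ 1 := st_abs _

lemma zt_cut : Cut zt := by
  refine cut_of_const (R := 30) (k1 := 0) (k2 := 0) ?_ ?_ ?_
  · exact Sm.st (show ContDiff ℝ (⊤ : ℕ∞) _ by fun_prop)
  · intro x hx; exact zt_zero (le_abs.2 (Or.inl hx))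
  · intro x hx; exact zt_zero (le_abs.2 (Or.inr (by linarith)))

lemma bt_cut : Cut bt := by
  refine cut_of_const (R := 3) (k1 := 0) (k2 := 0) ?_ ?_ ?_
  · exact Sm.st (show ContDiff ℝ (⊤ : ℕ∞) _ by fun_prop)
  · intro x hx; exact bt_zero (le_abs.2 (Or.inl hx))
  · intro x hx; exact bt_zero (le_abs.2 (Or.inr (by linarith)))

lemma et_cut : Cut et := by
  refine cut_of_const (R := 3) (k1 := 1) (k2 := 0) ?_ ?_ ?_
  · exact Sm.st (show ContDiff ℝ (⊤ : ℕ∞) _ by fun_prop)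
  · intro x hx; exact Real.smoothTransition.one_of_one_le (by linarith)
  · intro x hx; exact Real.smoothTransition.zero_of_nonpos (by linarith)

lemma th_cut : Cut th := by
  refine cut_of_const (R := 13) (k1 := 0) (k2 := 1) ?_ ?_ ?_
  · exact Sm.st (show ContDiff ℝ (⊤ : ℕ∞) _ by fun_prop)
  · intro x hx; exact Real.smoothTransition.zero_of_nonpos (by linarith)
  · intro x hx; exact Real.smoothTransition.one_of_one_le (by linarith)

def ta (x : ℝ) : ℝ := (x - 6) * zt x

lemma ta_cut : Cut ta := by
  refine cut_of_const (R := 30) (k1 := 0) (k2 := 0) ?_ ?_ ?_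
  · exact ContDiff.mul (by fun_prop) zt_cut.1
  · intro x hx; simp [ta, zt_zero (le_abs.2 (Or.inl hx))]
  · intro x hx; simp [ta, zt_zero (le_abs.2 (Or.inr (by linarith : 30 ≤ -x)))]

def bs (x : ℝ) : ℝ := bt (x + (-6))

lemma bs_cut : Cut bs :=
  ⟨bt_cut.1.cmp (contDiff_id.add contDiff_const), fun r => by
    obtain ⟨B, hB, h⟩ := bt_cut.2 r
    exact ⟨B, hB, fun l hl => (h l hl).shift (-6)⟩⟩

lemma Cut.gd {f : ℝ → ℝ} (h : Cut f) : ∃ c > 0, ∀ s, |s| ≤ c → Gd (fun x => s * f x) := by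
  obtain ⟨B, hB, hb⟩ := h.2 0
  refine ⟨1 / (2 * B), by positivity, fun s hs => ?_⟩
  refine ((hb 1 le_rfl).cmul s).gd ?_
  calc |s| * B ≤ 1 / (2 * B) * B := by gcongr
    _ = 1 / 2 := by field_simp

def Yf (s x : ℝ) : ℝ := (1 + s) * bt ((1 + s)⁻¹ * (x + (-6))) + (-1) * bs x

lemma Yf_BD (r : ℕ) : ∃ C : ℝ, 1 ≤ C ∧ ∀ s l, 0 ≤ s → s ≤ 1 → 1 ≤ l → BD (Yf s) C l r := by
  obtain ⟨B, hB, h⟩ := bt_cut.2 r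
  refine ⟨3 * B, by linarith, fun s l hs hs1 hl => ?_⟩
  have h1 := (((h l hl).scale (k := (1+s)⁻¹) (by positivity)
    (inv_le_one_of_one_le₀ (by linarith))).shift (-6)).cmul (1+s)
  have h2 := ((h l hl).shift (-6)).cmul (-1)
  refine (h1.add h2).mono_a ?_ (by linarith)
  rw [abs_of_nonneg (by linarith), abs_neg, abs_one]
  nlinarith

lemma Yf_ge {s : ℝ} (hs : 0 ≤ s) (x : ℝ) : s * bs x ≤ Yf s x := by
  have : bt (x + -6) ≤ bt ((1 + s)⁻¹ * (x + (-6))) := by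
    apply bt_anti
    rw [abs_mul, abs_of_nonneg (by positivity)]
    exact mul_le_of_le_one_left (abs_nonneg _) (inv_le_one_of_one_le₀ (by linarith))
  have h2 := mul_le_mul_of_nonneg_left this (show 0 ≤ 1 + s by linarith)
  simp only [Yf, bs]
  linarith

lemma Yf_zero {s : ℝ} (hs : 0 ≤ s) (hs1 : s ≤ 1 / 10) {x : ℝ} (h : 33 / 10 ≤ |x + (-6)|) :
    Yf s x = 0 := by
  simp only [Yf, bs]
  rw [bt_zero, bt_zero]
  · simp
  · linarith
  · rw [abs_mul, abs_of_nonneg (by positivity), inv_mul_eq_div, le_div_iff₀ (by positivity)]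
    nlinarith

def Fc (c x : ℝ) : ℝ := c * bs x
def TD (t x : ℝ) : ℝ := t * zt x
def tD (s x : ℝ) : ℝ := s * ta x

/-- displacement of the commutator -/
def eD (s c x : ℝ) : ℝ := c * Yf s ((dP (Fc c)).symm x)

lemma sym_eq {u : ℝ → ℝ} (h : Gd u) {x : ℝ} : (dP u).symm x + u ((dP u).symm x) = x := by
  rw [← dP_apply h]; simp

lemma sym_sm {u : ℝ → ℝ} (h : Gd u) : Sm (dP u).symm := by
  obtain ⟨G, hG, h1, h2⟩ := h.inv
  have : ⇑(dP u).symm = G := by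
    ext x; rw [Equiv.symm_apply_eq, dP_apply h, h1]
  rw [this]; exact hG

lemma Fc_abs (c x : ℝ) : |Fc c x| ≤ |c| := by
  rw [Fc, abs_mul]; exact mul_le_of_le_one_right (abs_nonneg _) (bt_abs _)

lemma comm_eq {s c : ℝ} (hs : 0 ≤ s) (hs1 : s ≤ 1 / 10) (hc : |c| ≤ 1 / 2) (hF : Gd (Fc c))
    (ht : Gd (tD s)) (x : ℝ) :
    (dP (tD s) * dP (Fc c) * (dP (tD s))⁻¹ * (dP (Fc c))⁻¹) x = x + eD s c x := by
  have key : ∀ z, dP (tD s) (dP (Fc c) z) =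
      dP (tD s) z + c * ((1 + s) * bt ((1 + s)⁻¹ * (dP (tD s) z + (-6)))) := by
    intro z
    rw [dP_apply hF, dP_apply ht, dP_apply ht]
    have hs' : (1 + s) ≠ 0 := by linarith
    have hFz := abs_le.1 (Fc_abs c z)
    rcases le_or_gt (|z + -6|) 3 with h | h
    · have h' := abs_le.1 h
      have hc' := hc
      have z1 : zt z = 1 := zt_one (abs_le.2 ⟨by linarith, by linarith⟩)
      have z2 : zt (z + Fc c z) = 1 := zt_one (abs_le.2 ⟨by linarith, by linarith⟩)
      simp only [tD, ta, z1, z2]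
      rw [show (1 + s)⁻¹ * (z + s * ((z - 6) * 1) + -6) = z + -6 by field_simp; ring]
      simp only [Fc, bs]; ring
    · have : Fc c z = 0 := by simp [Fc, bs, bt_zero h.le]
      rw [this, add_zero, bt_zero]; · simp
      rw [abs_mul, abs_of_nonneg (by positivity), inv_mul_eq_div, le_div_iff₀ (by positivity)]
      rcases le_or_gt |z| 20 with hz | hz
      · have z1 : zt z = 1 := zt_one hz
        simp only [tD, ta, z1]
        rw [show z + s * ((z - 6) * 1) + -6 = (1 + s) * (z + -6) by ring, abs_mul,
          abs_of_nonneg (by linarith)]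
        nlinarith
      · have hz1 : 0 ≤ zt z := Real.smoothTransition.nonneg _
        simp only [tD, ta]
        rw [show z + s * ((z - 6) * zt z) + -6 = (1 + s * zt z) * (z + -6) by ring, abs_mul,
          abs_of_nonneg (by positivity)]
        have : 14 ≤ |z + -6| := by
          rcases lt_abs.1 hz with h | h
          · exact le_abs.2 (Or.inl (by linarith))
          · exact le_abs.2 (Or.inr (by linarith))
        have : 0 ≤ s * zt z := by positivity
        nlinarith
  simp only [Equiv.Perm.mul_apply]
  set y := (dP (Fc c))⁻¹ x with hy
  set z := (dP (tD s))⁻¹ y with hz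
  have hyz : dP (tD s) z = y := by rw [hz]; simp
  have hxy : dP (Fc c) y = x := by rw [hy]; simp
  have h1 := key z
  rw [hyz] at h1
  rw [h1]
  have h2 : x = y + c * bs y := by rw [← hxy, dP_apply hF]; rfl
  have h3 : eD s c x = c * Yf s y := rfl
  rw [h3]; simp only [Yf]
  linarith

lemma eD_BD {c1 : ℝ} (hc1 : c1 ≤ 1) (hF : ∀ c, |c| ≤ c1 → Gd (Fc c)) (r : ℕ) :
    ∃ C : ℝ, 1 ≤ C ∧ ∀ s c l, 0 ≤ s → s ≤ 1 → |c| ≤ c1 → 1 ≤ l → BD (eD s c) (C * |c|) l r := by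
  obtain ⟨B, hB, h⟩ := bs_cut.2 r
  obtain ⟨D, hD, hY⟩ := Yf_BD r
  obtain ⟨C, hC, hI⟩ := BD.comp_inv r (1/2) (1 + B) (by norm_num) (by linarith)
  refine ⟨C * D, one_le_mul_of_one_le_of_one_le hC hD, fun s c l hs hs1 hc hl => ?_⟩
  have hG := hF c hc
  have h1 := hI (fun x => x + Fc c x) (dP (Fc c)).symm (Yf s) l D (by linarith)
    (contDiff_id.add hG.1.sm) (sym_sm hG) (fun x => sym_eq hG) (fun x => ?_) ?_
    (hY s l hs hs1 hl)
  · refine (h1.cmul c).mono_a (le_of_eq (by ring)) (by linarith)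
  · rw [deriv_id_add hG.1.sm]; have := abs_le.1 (hG.2 x); linarith
  · have e : deriv (fun x => x + Fc c x) = fun x => 1 + deriv (Fc c) x := by
      ext x; exact deriv_id_add hG.1.sm x
    rw [e]
    refine (Bd.add contDiff_const hG.1.sm.deriv (Bd.const 1 l (by linarith) r)
      ((h l hl).cmul c).b1).mono_a ?_ (by linarith)
    rw [abs_one]; nlinarith

lemma eD_zero {s c : ℝ} (hs : 0 ≤ s) (hs1 : s ≤ 1 / 10) (hc : |c| ≤ 1 / 2) (hF : Gd (Fc c))
    {x : ℝ} (hx : x ∉ Icc (2:ℝ) 10) : eD s c x = 0 := by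
  have h1 := sym_eq hF (x := x)
  have h2 := abs_le.1 (Fc_abs c ((dP (Fc c)).symm x))
  rw [eD, Yf_zero hs hs1, mul_zero]
  rw [mem_Icc, not_and_or] at hx
  rcases hx with hx | hx
  · apply le_abs.2; right; linarith
  · apply le_abs.2; left; linarith

lemma eD_pos {s c : ℝ} (hs : 0 ≤ s) (hc : 0 ≤ c) (x : ℝ) : 0 ≤ eD s c x :=
  mul_nonneg hc ((mul_nonneg hs (bt_nonneg _)).trans (Yf_ge hs _))

lemma eD_neg {s c : ℝ} (hs : 0 ≤ s) (hc : c ≤ 0) (x : ℝ) : eD s c x ≤ 0 :=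
  mul_nonpos_of_nonpos_of_nonneg hc ((mul_nonneg hs (bt_nonneg _)).trans (Yf_ge hs _))

lemma Yf_plateau {s c : ℝ} (hs : 0 ≤ s) (hc : |c| ≤ 1 / 2) (hF : Gd (Fc c)) {x : ℝ}
    (hx : x ∈ Icc (9/2:ℝ) (15/2)) : s ≤ Yf s ((dP (Fc c)).symm x) := by
  have h1 := sym_eq hF (x := x)
  have h2 := abs_le.1 (Fc_abs c ((dP (Fc c)).symm x))
  have h3 := Yf_ge hs ((dP (Fc c)).symm x)
  have : bs ((dP (Fc c)).symm x) = 1 := bt_one (abs_le.2 ⟨by linarith [hx.1], by linarith [hx.2]⟩)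
  rw [this] at h3; linarith

lemma eD_cont {s c1 : ℝ} (hF : ∀ c, |c| ≤ c1 → Gd (Fc c)) (hs : 0 ≤ s) (hs1 : s ≤ 1) {y : ℝ → ℝ}
    (hy : ContinuousOn y (Icc (-c1) c1)) : ContinuousOn (fun c => eD s c (y c)) (Icc (-c1) c1) := by
  have hY : Continuous (Yf s) := by
    obtain ⟨C, -, h⟩ := Yf_BD 0
    exact (h s 1 hs hs1 le_rfl).sm.continuous
  refine continuousOn_id.mul (hY.comp_continuousOn ?_)
  intro c hc
  have hFc := hF c (abs_le.2 hc)
  have bound : ∀ d ∈ Icc (-c1) c1, |(dP (Fc d)).symm (y d) - (dP (Fc c)).symm (y c)| ≤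
      2 * (|y d - y c| + |d - c|) := by
    intro d hd
    have hFd := hF d (abs_le.2 hd)
    set p := (dP (Fc d)).symm (y d)
    set q := (dP (Fc c)).symm (y c)
    have h1 : p + Fc d p = y d := sym_eq hFd
    have h2 : q + Fc c q = y c := sym_eq hFc
    have h3 : |Fc d p - Fc d q| ≤ 1 / 2 * |p - q| := by
      have := Convex.norm_image_sub_le_of_norm_deriv_le (f := Fc d) (s := univ) (x := q) (y := p)
        (C := 1/2) (fun x _ => hFd.1.sm.da x) (fun x _ => by simpa using hFd.2 x) convex_univ
        (mem_univ _) (mem_univ _)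
      simpa using this
    have h4 : |Fc c q - Fc d q| ≤ |d - c| := by
      simp only [Fc]
      rw [← sub_mul, abs_mul, abs_sub_comm]
      exact mul_le_of_le_one_right (abs_nonneg _) (bt_abs _)
    have h5 : p - q = (y d - y c) - (Fc d p - Fc d q) + (Fc c q - Fc d q) := by linarith
    have h6 : |p - q| ≤ |y d - y c| + |Fc d p - Fc d q| + |Fc c q - Fc d q| := by
      rw [h5]
      refine (abs_add_le _ _).trans ?_
      gcongr
      exact abs_sub _ _
    linarith
  rw [ContinuousWithinAt, tendsto_iff_norm_sub_tendsto_zero]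
  have hlim : Tendsto (fun d => 2 * (|y d - y c| + |d - c|)) (𝓝[Icc (-c1) c1] c) (𝓝 0) := by
    have : ContinuousWithinAt (fun d => 2 * (|y d - y c| + |d - c|)) (Icc (-c1) c1) c := by
      have := hy c hc
      exact continuousWithinAt_const.mul (((this.sub continuousWithinAt_const).abs).add
        ((continuousWithinAt_id.sub continuousWithinAt_const).abs))
    simpa [ContinuousWithinAt] using this
  refine squeeze_zero' (Eventually.of_forall fun _ => norm_nonneg _) ?_ hlim
  filter_upwards [self_mem_nhdsWithin] with d hd using bound d hd


def cl (x : ℝ) : ℝ := max 0 (min 2 x)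

lemma cl_spec {x y : ℝ} (h : x ≤ y) : cl x ≤ cl y ∧ cl y - cl x ≤ y - x := by
  unfold cl
  refine ⟨max_le_max le_rfl (min_le_min le_rfl h), ?_⟩
  rw [sub_le_iff_le_add]
  refine max_le ?_ ?_
  · have := le_max_left 0 (min 2 x); linarith
  · have h1 := le_max_right 0 (min 2 x)
    have h2 := le_min (show min 2 y - (y - x) ≤ 2 by have := min_le_left 2 y; linarith)
      (show min 2 y - (y - x) ≤ x by have := min_le_right 2 y; linarith)
    linarith

lemma cl_zero {x : ℝ} (h : x ≤ 0) : cl x = 0 := by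
  unfold cl; rw [max_eq_left]; exact (min_le_right _ _).trans h
lemma cl_mid {x : ℝ} (h : 0 ≤ x) (h2 : x ≤ 2) : cl x = x := by
  unfold cl; rw [min_eq_right h2, max_eq_right h]
lemma cl_two {x : ℝ} (h : 2 ≤ x) : cl x = 2 := by
  unfold cl; rw [min_eq_left h, max_eq_right]; norm_num

def kap (x : ℝ) : ℝ := cl (x + 1/2) - cl (x - 5)

lemma kap_lip {x y : ℝ} (h : x ≤ y) : x - y ≤ kap y - kap x := by
  unfold kap
  have h1 := cl_spec (show x + 1/2 ≤ y + 1/2 by linarith)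
  have h2 := cl_spec (show x - 5 ≤ y - 5 by linarith)
  linarith [h1.1, h2.2]

lemma pot {t σ a K x U e : ℝ} (ht : 0 < t) (ht1 : t ≤ 1 / 10) (hσ : |σ| = 1) (ha : 0 ≤ a)
    (hK : K * t = 2 * a) (hK0 : 0 ≤ K) (hK1 : K ≤ 1 / 2) (hu : |U| ≤ a) (hu0 : x ∉ Ioo (0:ℝ) 1 → U = 0)
    (he : 0 ≤ σ * e) (he0 : x ∉ Icc (2:ℝ) 10 → e = 0) (hep : x ∈ Icc (9/2:ℝ) (15/2) → 4 * a ≤ σ * e)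
    (hs : |U| ≤ t / 2) (hs' : |e| ≤ t / 2) :
    σ * (x - t) + K * kap (x - t) + σ * t ≤ σ * (x + U + e) + K * kap (x + U + e) := by
  have h1 := abs_le.1 hs
  have h2 := abs_le.1 hs'
  have hσe : |e| = σ * e := by
    rw [← abs_of_nonneg he, abs_mul, hσ, one_mul]
  have hle : x - t ≤ x + U + e := by
    by_cases hx : x ∈ Ioo (0:ℝ) 1
    · rw [he0 (fun h => by linarith [hx.2, h.1])]; linarith
    · rw [hu0 hx]; linarith
  by_cases hx : x ∈ Ioo (0:ℝ) 1
  · have e0 := he0 (fun h => by linarith [hx.2, h.1])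
    have h3 : kap (x + U + e) - kap (x - t) = U + t := by
      unfold kap
      have q1 := hx.1
      have q2 := hx.2
      rw [cl_mid (x := x + U + e + 1/2), cl_mid (x := x - t + 1/2), cl_zero (x := x + U + e - 5),
        cl_zero (x := x - t - 5)] <;> linarith
    have h4 : -a ≤ σ * U := by
      have := (abs_le.1 (show |σ * U| ≤ a by rw [abs_mul, hσ]; linarith)).1
      linarith
    have h5 : kap (x + U + e) = kap (x - t) + (U + t) := by linarith
    rw [h5, e0]
    nlinarith
  · have U0 := hu0 hx
    subst U0
    by_cases hx2 : x ∈ Icc (9/2:ℝ) (15/2)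
    · have h3 := kap_lip hle
      have h4 := hep hx2
      have h6 : K * ((x - t) - (x + 0 + e)) ≤ K * (kap (x + 0 + e) - kap (x - t)) := by gcongr
      have h7 : K * e ≤ K * (σ * e) := by rw [← hσe]; gcongr; exact le_abs_self e
      nlinarith
    · have h8 : kap (x - t) ≤ kap (x + 0 + e) := by
        unfold kap
        have h1 := cl_spec (show (x - t) + 1/2 ≤ (x + 0 + e) + 1/2 by linarith)
        by_cases h9 : x < 9/2
        · rw [cl_zero (x := x - t - 5), cl_zero (x := x + 0 + e - 5)] <;> linarith [h1.1]
        · have : 15/2 < x := by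
            by_contra hc; exact hx2 ⟨by linarith, by linarith⟩
          rw [cl_two, cl_two, cl_two, cl_two] <;> linarith
      nlinarith [mul_le_mul_of_nonneg_left h8 hK0]

lemma orbit {t σ a K : ℝ} {u e : ℝ → ℝ} (ht : 0 < t) (ht1 : t ≤ 1 / 10) (hσ : |σ| = 1) (ha : 0 ≤ a)
    (hK : K * t = 2 * a) (hK0 : 0 ≤ K) (hK1 : K ≤ 1 / 2) (hu : ∀ x, |u x| ≤ a)
    (hu0 : ∀ x, x ∉ Ioo (0:ℝ) 1 → u x = 0)
    (he : ∀ x, 0 ≤ σ * e x) (he0 : ∀ x, x ∉ Icc (2:ℝ) 10 → e x = 0)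
    (hep : ∀ x, x ∈ Icc (9/2:ℝ) (15/2) → 4 * a ≤ σ * e x)
    (hs : ∀ x, |u x| ≤ t / 2) (hs' : ∀ x, |e x| ≤ t / 2) (n : ℕ) (hn : 30 ≤ n * t)
    (hb : |phiW t (fun x => u x + e x) n 12| ≤ 1 / 4) :
    0 ≤ σ * phiW t (fun x => u x + e x) n 12 := by
  have key : ∀ (k : ℕ) (x : ℝ), σ * (x - k * t) + K * kap (x - k * t) + σ * (k * t) ≤
      σ * (x + phiW t (fun x => u x + e x) k x) + K * kap (x + phiW t (fun x => u x + e x) k x) := by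
    intro k
    induction k with
    | zero => intro x; simp [phiW]
    | succ k ih =>
      intro x
      have h1 := ih (x + -t)
      set z := x + phiW t (fun x => u x + e x) k (x + -t) with hz
      have h2 := pot (x := z) ht ht1 hσ ha hK hK0 hK1 (hu z) (hu0 z) (he z) (he0 z) (hep z)
        (hs z) (hs' z)
      have e1 : x + phiW t (fun x => u x + e x) (k+1) x = z + u z + e z := by
        simp only [phiW, ← hz]; rw [hz]; ring
      rw [e1]
      have e2 : x + -t + phiW t (fun x => u x + e x) k (x + -t) = z - t := by rw [hz]; ring
      rw [e2] at h1
      have e3 : x + -t - k * t = x - (k + 1 : ℕ) * t := by push_cast; ring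
      rw [e3] at h1
      push_cast at h1 ⊢
      linarith
  have := key n 12
  have hb' := abs_le.1 hb
  have k1 : kap (12 - n * t) = 0 := by
    unfold kap; rw [cl_zero, cl_zero] <;> linarith
  have k2 : kap (12 + phiW t (fun x => u x + e x) n 12) = 0 := by
    unfold kap; rw [cl_two, cl_two] <;> linarith
  rw [k1, k2] at this
  linarith

lemma phiW_cont {t c1 : ℝ} {u : ℝ → ℝ} (hu : Continuous u) (hF : ∀ c, |c| ≤ c1 → Gd (Fc c))
    (ht : 0 ≤ t) (ht1 : t ≤ 1) (n : ℕ) (x : ℝ) :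
    ContinuousOn (fun c => phiW t (fun x => u x + eD t c x) n x) (Icc (-c1) c1) := by
  induction n generalizing x with
  | zero => exact continuousOn_const
  | succ n ih =>
    have h1 : ContinuousOn (fun c => x + phiW t (fun x => u x + eD t c x) n (x + -t))
      (Icc (-c1) c1) := continuousOn_const.add (ih _)
    exact (ih _).add ((hu.comp_continuousOn h1).add (eD_cont hF ht ht1 h1))

lemma ivt_c {t c1 a : ℝ} {u : ℝ → ℝ} (hu : Continuous u) (hF : ∀ c, |c| ≤ c1 → Gd (Fc c))
    (hc1 : c1 ≤ 1 / 2) (ht : 0 < t) (ht1 : t ≤ 1 / 10) (ha : 0 ≤ a) (hat : a ≤ t / 4)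
    (hua : ∀ x, |u x| ≤ a) (hu0 : ∀ x, x ∉ Ioo (0:ℝ) 1 → u x = 0) (hc2 : 4 * a / t ≤ c1)
    (he : ∀ c x, |c| ≤ 4 * a / t → |eD t c x| ≤ t / 2) (n : ℕ) (hn : 30 ≤ n * t)
    (hb : ∀ c, |c| ≤ 4 * a / t → |phiW t (fun x => u x + eD t c x) n 12| ≤ 1 / 4) :
    ∃ c, |c| ≤ 4 * a / t ∧ phiW t (fun x => u x + eD t c x) n 12 = 0 := by
  set d := 4 * a / t with hd
  have hd0 : 0 ≤ d := by positivity
  have hdt : d * t = 4 * a := by rw [hd]; field_simp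
  have hK : 2 * a / t * t = 2 * a := by field_simp
  have hK1 : 2 * a / t ≤ 1 / 2 := by rw [div_le_iff₀ ht]; linarith
  have hK0 : 0 ≤ 2 * a / t := by positivity
  have hFd : Gd (Fc d) := hF d (by rw [abs_of_nonneg hd0]; exact hc2)
  have hFd' : Gd (Fc (-d)) := hF (-d) (by rw [abs_neg, abs_of_nonneg hd0]; exact hc2)
  have h1 := orbit (e := eD t d) ht ht1 (σ := 1) abs_one ha hK hK0 hK1 hua hu0
    (fun x => by rw [one_mul]; exact eD_pos ht.le hd0 x)
    (fun x hx => eD_zero ht.le ht1 (by rw [abs_of_nonneg hd0]; linarith) hFd hx)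
    (fun x hx => by
      have := Yf_plateau (s := t) ht.le (by rw [abs_of_nonneg hd0]; linarith) hFd hx
      rw [one_mul, eD]; nlinarith)
    (fun x => (hua x).trans (by linarith)) (fun x => he d x (by rw [abs_of_nonneg hd0])) n hn
    (hb d (by rw [abs_of_nonneg hd0]))
  have h2 := orbit (e := eD t (-d)) ht ht1 (σ := -1) (by simp) ha hK hK0 hK1 hua hu0
    (fun x => by have := eD_neg ht.le (show -d ≤ 0 by linarith) x; linarith)
    (fun x hx => eD_zero ht.le ht1 (by rw [abs_neg, abs_of_nonneg hd0]; linarith) hFd' hx)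
    (fun x hx => by
      have := Yf_plateau (s := t) ht.le (by rw [abs_neg, abs_of_nonneg hd0]; linarith) hFd' hx
      rw [eD]; nlinarith)
    (fun x => (hua x).trans (by linarith)) (fun x => he (-d) x (by rw [abs_neg, abs_of_nonneg hd0]))
    n hn (hb (-d) (by rw [abs_neg, abs_of_nonneg hd0]))
  rw [one_mul] at h1
  have hcont := (phiW_cont (t := t) hu hF ht.le (by linarith) n 12).mono
    (show Icc (-d) d ⊆ Icc (-c1) c1 from Icc_subset_Icc (by linarith) hc2)
  obtain ⟨c, hc, hc0⟩ := intermediate_value_Icc (by linarith) hcont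
    (show (0:ℝ) ∈ Icc _ _ from ⟨by linarith, h1⟩)
  exact ⟨c, abs_le.2 hc, hc0⟩


lemma phiW_neg {t : ℝ} (ht : 0 ≤ t) {U : ℝ → ℝ} (hU : ∀ x ≤ 0, U x = 0) (n : ℕ) {x : ℝ} (hx : x ≤ 0) :
    phiW t U n x = 0 := by
  induction n generalizing x with
  | zero => rfl
  | succ n ih =>
    simp only [phiW]
    rw [ih (show x + -t ≤ 0 by linarith), add_zero, hU x hx, add_zero]

lemma phiW_stab {t : ℝ} {U : ℝ → ℝ} (hU : ∀ x ≤ 0, U x = 0) (n : ℕ) {x : ℝ}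
    (hx : x ≤ n * t) : phiW t U (n+1) x = phiW t U n x := by
  induction n generalizing x with
  | zero => simp only [phiW]; simp at hx; simp [hU x hx]
  | succ n ih =>
    have h : x + -t ≤ n * t := by push_cast at hx; linarith
    have h1 : phiW t U (n+1+1) x = phiW t U (n+1) (x + (-t)) + U (x + phiW t U (n+1) (x + (-t))) := rfl
    rw [h1, ih h]; rfl

lemma phiW_rel {t : ℝ} {U : ℝ → ℝ} (hU : ∀ x ≤ 0, U x = 0) (n : ℕ) {x : ℝ}
    (hx : x + t ≤ n * t) : phiW t U n (x + t) = phiW t U n x + U (x + t + phiW t U n x) := by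
  rw [← phiW_stab hU n hx]; simp only [phiW]; simp

lemma et_zero {x : ℝ} (h : x ≤ 1/4) : et x = 0 := Real.smoothTransition.zero_of_nonpos (by linarith)
lemma et_one {x : ℝ} (h : 3/4 ≤ x) : et x = 1 := Real.smoothTransition.one_of_one_le (by linarith)
lemma th_one {x : ℝ} (h : x ≤ 12) : th x = 1 := Real.smoothTransition.one_of_one_le (by linarith)
lemma th_zero {x : ℝ} (h : 13 ≤ x) : th x = 0 := Real.smoothTransition.zero_of_nonpos (by linarith)

lemma etm_small {m : ℝ → ℝ} (hm : ∀ x, |m x| ≤ 1 / 8) (x : ℝ) : |et x * m x| ≤ 1 / 8 := by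
  rw [abs_mul]; exact (mul_le_of_le_one_left (abs_nonneg _) (st_abs _)).trans (hm x)

lemma rel {t : ℝ} {u e m G : ℝ → ℝ} {n : ℕ} {K : Equiv.Perm ℝ} (ht : 0 < t) (ht1 : t ≤ 1 / 10)
    (hu0 : ∀ x, x ∉ Ioo (0:ℝ) 1 → u x = 0) (he0 : ∀ x, x ∉ Icc (2:ℝ) 10 → e x = 0)
    (hes : ∀ x, |e x| ≤ 1 / 4) (hn : 30 ≤ n * t)
    (hK : ∀ x, K x = x + e x) (w u₁ w₁ : ℝ → ℝ) (hw : w = phiW t (fun x => u x + e x) n)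
    (hws : ∀ x, |w x| ≤ 1 / 8) (hms : ∀ x, |m x| ≤ 1 / 8)
    (hmp : ∀ x, m (x + t) = m x) (hmw : ∀ x ∈ Icc (11:ℝ) 14, m x = w x)
    (hG1 : ∀ x, G x + et (G x) * m (G x) = x) (hG2 : ∀ x, G (x + et x * m x) = x)
    (hu₁ : u₁ = fun z => (et (G (z + -t) + t) - et (G (z + -t))) * m (G (z + -t)))
    (hw₁ : w₁ = fun x => th (G x) * (w (G x) - et (G x) * m (G x)))
    (gu : Gd u) (gu₁ : Gd u₁) (gw₁ : Gd w₁) (gT : Gd (TD t)) :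
    (∀ x, x ∉ Ioo (0:ℝ) 1 → u₁ x = 0) ∧ (∀ x, x ∉ Icc (-1:ℝ) 13 → w₁ x = 0) ∧
    dP u * K * dP (TD t) = dP w₁ * dP u₁ * dP (TD t) * (dP w₁)⁻¹ := by
  have hU : ∀ x ≤ (0:ℝ), u x + e x = 0 := fun x hx => by
    rw [hu0 x (fun h => by linarith [h.1]), he0 x (fun h => by linarith [h.1]), add_zero]
  have hm' := fun x => abs_le.1 (etm_small hms x)
  have hw' := fun x => abs_le.1 (hws x)
  have c1 : ∀ x, x ∉ Ioo (0:ℝ) 1 → u₁ x = 0 := by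
    intro x hx
    have h1 := hG1 (x + -t)
    have h2 := hm' (G (x + -t))
    rw [hu₁]; simp only
    set y := G (x + -t)
    rcases le_or_gt y (1/4 - t) with h | h
    · rw [et_zero (x := y + t), et_zero (x := y), sub_self, zero_mul] <;> linarith
    rcases le_or_gt (3/4) y with h' | h'
    · rw [et_one (x := y + t), et_one (x := y), sub_self, zero_mul] <;> linarith
    exfalso
    apply hx
    rcases le_or_gt y (1/4) with h3 | h3
    · rw [et_zero h3] at h1; constructor <;> linarith
    · constructor <;> linarith
  have c2' : ∀ y, y ∉ Ioo (0:ℝ) 12 → th y * (w y - et y * m y) = 0 := by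
    intro y hy
    rcases le_or_gt y 0 with h | h
    · rw [et_zero (by linarith), hw, phiW_neg ht.le hU n h]; simp
    have : 12 ≤ y := by by_contra hc; exact hy ⟨h, by linarith⟩
    rcases le_or_gt y 13 with h' | h'
    · rw [hmw y ⟨by linarith, by linarith⟩, et_one (by linarith)]; simp
    · rw [th_zero h'.le]; simp
  have c2 : ∀ x, x ∉ Icc (-1:ℝ) 13 → w₁ x = 0 := by
    intro x hx
    rw [hw₁]; simp only
    apply c2'
    intro h
    have h1 := hG1 x
    have h2 := hm' (G x)
    exact hx ⟨by linarith [h.1], by linarith [h.2]⟩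
  refine ⟨c1, c2, ?_⟩
  rw [eq_mul_inv_iff_mul_eq]
  ext x
  simp only [Equiv.Perm.mul_apply]
  have hh : ∀ z, dP u (K z) = z + (u z + e z) := by
    intro z
    rw [hK, dP_apply gu]
    by_cases hz : z ∈ Icc (2:ℝ) 10
    · have := abs_le.1 (hes z)
      rw [hu0 (z + e z) (fun h => by linarith [hz.1, h.2]), hu0 z (fun h => by linarith [hz.1, h.2])]
      ring
    · rw [he0 z hz, add_zero, add_zero]
  rw [hh, dP_apply gT, dP_apply gT, dP_apply gw₁, dP_apply gu₁, dP_apply gw₁]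
  obtain ⟨y, rfl⟩ : ∃ y, y + et y * m y = x := ⟨G x, hG1 x⟩
  have b1 := hm' y
  have b2 := hw' y
  have w1X : ∀ y, w₁ (y + et y * m y) = th y * (w y - et y * m y) := by
    intro y; rw [hw₁]; simp only [hG2]
  rcases le_or_gt |y| 19 with hy | hy
  · have hy' := abs_le.1 hy
    have T1 : TD t (y + et y * m y) = t := by
      rw [TD, zt_one (abs_le.2 ⟨by linarith, by linarith⟩), mul_one]
    have u1X : (y + et y * m y + t) + u₁ (y + et y * m y + t) = (y + t) + et (y + t) * m (y + t) := by
      rw [hu₁]; simp only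
      rw [show y + et y * m y + t + -t = y + et y * m y by ring, hG2, hmp]; ring
    rw [T1, u1X, w1X, w1X]
    rcases le_or_gt y 11 with h11 | h11
    · rw [th_one (show y ≤ 12 by linarith), th_one (show y + t ≤ 12 by linarith)]
      have T2 : TD t (y + et y * m y + 1 * (w y - et y * m y)) = t := by
        rw [TD, zt_one (abs_le.2 ⟨by linarith, by linarith⟩), mul_one]
      rw [T2]
      have h3 := phiW_rel hU n (show y + t ≤ n * t by linarith)
      rw [← hw] at h3
      rw [show y + et y * m y + 1 * (w y - et y * m y) + t = y + t + w y by ring]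
      linarith
    · have hz : ∀ z, 11 ≤ z → th z * (w z - et z * m z) = 0 := by
        intro z hz
        rcases le_or_gt z 13 with h' | h'
        · rw [hmw z ⟨by linarith, by linarith⟩, et_one (by linarith)]; simp
        · rw [th_zero h'.le]; simp
      rw [hz y h11.le, hz (y + t) (by linarith), add_zero, add_zero, T1]
      rw [hu0 _ (fun h => by linarith [h.2]), he0 _ (fun h => by linarith [h.2])]
      rw [et_one (by linarith), et_one (by linarith), hmp]; ring
  · have hz : ∀ z : ℝ, |y + et y * m y - z| ≤ 1/10 → z < -15 ∨ 15 < z := by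
      intro z hz
      have := abs_le.1 hz
      rcases lt_abs.1 hy with h | h
      · right; linarith
      · left; linarith
    have zu : ∀ z : ℝ, z < -15 ∨ 15 < z → u z = 0 ∧ e z = 0 ∧ w₁ z = 0 ∧ u₁ z = 0 := by
      intro z hz
      refine ⟨hu0 z ?_, he0 z ?_, c2 z ?_, c1 z ?_⟩ <;>
      · intro h
        have h1 := h.1
        have h2 := h.2
        rcases hz with h | h <;> linarith
    have z1 := zu (y + et y * m y) (hz _ (by simp))
    rw [z1.2.2.1, add_zero]
    set x := y + et y * m y
    have hTx : |x - (x + TD t x)| ≤ 1 / 10 := by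
      rw [show x - (x + TD t x) = -(t * zt x) by simp [TD], abs_neg, abs_mul, abs_of_pos ht]
      exact (mul_le_of_le_one_right ht.le (st_abs _)).trans ht1
    have z2 := zu (x + TD t x) (hz _ hTx)
    rw [z2.1, z2.2.1, z2.2.2.2]
    simp [z2.2.2.1]

lemma BD.sharpen {f : ℝ → ℝ} {a a' l k : ℝ} {r : ℕ} (h : BD f a l r) (h0 : BD f a' l 0)
    (hk : a ≤ k * a') (hk1 : 1 ≤ k) (hl : 0 ≤ l) : BD f a' (k * l) r := by
  have hnn := h0.nonneg
  refine ⟨h.sm, h0.b0, fun j hj x => ?_⟩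
  rcases j with _ | j
  · have := h0.b1 0 le_rfl x; simpa using this
  · refine (h.b1 _ hj x).trans ?_
    rw [mul_pow, ← mul_assoc]
    gcongr
    refine hk.trans ?_
    rw [mul_comm]
    gcongr
    exact le_self_pow₀ hk1 (by omega)

lemma BD.unsharpen {f : ℝ → ℝ} {a l k : ℝ} {r : ℕ} (h : BD f a (k * l) r) (hk1 : 1 ≤ k) (hl : 0 ≤ l) :
    BD f (k ^ r * a) l r := by
  have hnn := h.nonneg
  have h1 : 1 ≤ k ^ r := one_le_pow₀ hk1
  refine ⟨h.sm, fun x => (h.b0 x).trans (le_mul_of_one_le_left hnn h1), fun j hj x => ?_⟩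
  refine (h.b1 _ hj x).trans ?_
  rw [mul_pow, ← mul_assoc, mul_comm a]
  gcongr


set_option maxHeartbeats 1000000 in
lemma step_est (E P B Θ J : ℕ → ℝ) (hE : ∀ r, 1 ≤ E r) (hP1 : ∀ r, 1 ≤ P r) (hB1 : ∀ r, 1 ≤ B r)
    (hΘ1 : ∀ r, 1 ≤ Θ r) (hJ1 : ∀ r, 1 ≤ J r)
    (hP : ∀ r, ∀ (t : ℝ) (U : ℝ → ℝ) (ε l : ℝ) (n : ℕ), 0 ≤ l →
      BD U ε l r → n * ε ≤ 1 / 4 → BD (phiW t U n) (P r * (n * ε)) l r)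
    (hB : ∀ r l, 1 ≤ l → BD et (B r) l r) (hΘ : ∀ r l, 1 ≤ l → BD th (Θ r) l r)
    (hJ : ∀ r, ∀ (X G g : ℝ → ℝ) (l a : ℝ), 0 ≤ l → Sm X → Sm G → (∀ x, X (G x) = x) →
      (∀ x, 1/2 ≤ deriv X x) → Bd (deriv X) 2 l r → BD g a l r →
      BD (fun x => g (G x)) (J r * a) l r) (r p : ℕ) :
    ∃ C : ℝ, 1 ≤ C ∧ ∀ (t a l c0 : ℝ) (u e : ℝ → ℝ) (n : ℕ), 0 < t → t ≤ 1 / 10 → 1 ≤ l → n * t ≤ 31 →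
    a ≤ c0 * t ^ 2 → 155 * E 0 * P 0 * (4 * B 0) * c0 ≤ 1 / 4 → BD u a l (r + p) →
    (∀ R, BD e (E R * (4 * a / t)) l R) →
    BD (phiW t (fun x => u x + e x) n) (C * (a / t ^ 2)) l (r + p) ∧
    ∀ m : ℝ → ℝ, (∀ x, m (x + t) = m x) → (∃ x, m x = 0) →
    (∀ {a l : ℝ} {r : ℕ}, BD (phiW t (fun x => u x + e x) n) a l r → BD m a l r) →
    ∀ G : ℝ → ℝ, Sm G → (∀ x, G x + et (G x) * m (G x) = x) →
    BD (fun z => (et (G (z + -t) + t) - et (G (z + -t))) * m (G (z + -t)))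
      (C * (a / t ^ 2) * (t * l) ^ p) l r ∧
    BD (fun x => th (G x) * (phiW t (fun x => u x + e x) n (G x) - et (G x) * m (G x)))
      (C * (a / t ^ 2)) l r := by
  set R := r + p with hR
  set W : ℕ → ℝ := fun R => (E R) ^ R * (P R * (155 * E 0)) with hW
  set M : ℕ → ℝ := fun R => 2 ^ (R + 1) * B R * W R with hM
  have W1 : ∀ R, 1 ≤ W R := fun R => by
    have h1 : 1 ≤ E R ^ R := one_le_pow₀ (hE R)
    have h2 : 1 ≤ P R * (155 * E 0) := one_le_mul_of_one_le_of_one_le (hP1 R) (by linarith [hE 0])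
    exact one_le_mul_of_one_le_of_one_le h1 h2
  have M1 : ∀ R, 1 ≤ M R := fun R => by
    have h1 : (1:ℝ) ≤ 2 ^ (R + 1) := one_le_pow₀ (by norm_num)
    exact one_le_mul_of_one_le_of_one_le (one_le_mul_of_one_le_of_one_le h1 (hB1 R)) (W1 R)
  have two1 : (1:ℝ) ≤ 2 ^ (r + 1) := one_le_pow₀ (by norm_num)
  have MR1 : (1:ℝ) ≤ M R ^ r := one_le_pow₀ (M1 R)
  have hB1' := hB1 r
  have hΘ1' := hΘ1 r
  have hJ1' := hJ1 r
  have W1' := W1 R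
  have M1' := M1 R
  set Cu := M R ^ r * (J r * (2 ^ (r + 1) * (2 * B r) * W R)) with hCu
  set Cw := M R ^ r * (J r * (2 ^ (r + 1) * Θ r * (W R + M R))) with hCw
  have Cu0 : 0 ≤ Cu := by positivity
  have Cw0 : 0 ≤ Cw := by positivity
  refine ⟨W R + Cu + Cw, by linarith, ?_⟩
  intro t a l c0 u e n ht ht1 hl hn ha hc0 hu he
  have ha0 := hu.nonneg
  have hl0 : 0 ≤ l := by linarith
  have hat : a / t ^ 2 ≤ c0 := by rw [div_le_iff₀ (by positivity)]; linarith
  have hat0 : 0 ≤ a / t ^ 2 := by positivity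
  have hE0 := hE 0
  have hP0 := hP1 0
  have hB0 := hB1 0
  have hd0 : 0 ≤ a / t := by positivity
  have had : a ≤ a / t := by rw [le_div_iff₀ ht]; nlinarith
  have hU : ∀ R', R' ≤ R → BD (fun x => u x + e x) (E R' * (5 * (a / t))) l R' := by
    intro R' hR'
    refine ((hu.le hR').add (he R')).mono_a ?_ hl0
    have := hE R'
    rw [mul_div_assoc]
    nlinarith
  have nE : ∀ s, n * (s * (5 * (a / t))) ≤ 155 * s * (a / t ^ 2) ∨ s < 0 := by
    intro s
    by_cases hs : s < 0
    · right; exact hs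
    left
    have h1 : n * (s * (5 * (a / t))) = (n * t) * (5 * s * (a / t ^ 2)) := by field_simp
    have h2 : 0 ≤ 5 * s * (a / t ^ 2) := mul_nonneg (by linarith) hat0
    rw [h1]; nlinarith
  have nE0 : n * (E 0 * (5 * (a / t))) ≤ 155 * E 0 * (a / t ^ 2) :=
    (nE (E 0)).resolve_right (by linarith)
  have small : 155 * E 0 * P 0 * (4 * B 0) * (a / t ^ 2) ≤ 1 / 4 :=
    (mul_le_mul_of_nonneg_left hat (by positivity)).trans hc0
  have small1 : 155 * E 0 * (a / t ^ 2) ≤ 1 / 4 := by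
    refine le_trans ?_ small
    refine mul_le_mul_of_nonneg_right ?_ hat0
    have : 1 ≤ P 0 * (4 * B 0) := one_le_mul_of_one_le_of_one_le hP0 (by linarith)
    nlinarith
  have hw : ∀ R', R' ≤ R → BD (phiW t (fun x => u x + e x) n) (W R' * (a / t ^ 2)) l R' := by
    intro R' hR'
    have h1 := (hU R' hR').sharpen (hU 0 (Nat.zero_le _)) (k := E R')
      (by have := hE R'; have : 0 ≤ E R' * (5 * (a / t)) := by positivity
          nlinarith) (hE R') hl0
    have h2 := hP R' t _ _ _ n (by have := hE R'; positivity) h1 (nE0.trans small1)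
    refine (h2.unsharpen (hE R') hl0).mono_a ?_ hl0
    have := hP1 R'
    have := hE R'
    calc E R' ^ R' * (P R' * (n * (E 0 * (5 * (a / t)))))
        ≤ E R' ^ R' * (P R' * (155 * E 0 * (a / t ^ 2))) := by gcongr
      _ = _ := by rw [hW]; ring
  refine ⟨(hw R le_rfl).mono_a (by gcongr; linarith) hl0, ?_⟩
  intro m hmp hm0 hmw G hG hG1
  have hem : ∀ R', R' ≤ R → BD (fun x => et x * m x) (M R' * (a / t ^ 2)) l R' := by
    intro R' hR'
    refine (BD.mul hl (hB R' l hl) (hmw (hw R' hR'))).mono_a (le_of_eq ?_) hl0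
    rw [hM]; ring
  have hM0 : M 0 * (a / t ^ 2) ≤ 1 / 4 := by
    refine le_trans ?_ small
    refine mul_le_mul_of_nonneg_right ?_ hat0
    simp only [hM, hW, pow_zero, zero_add, pow_one, one_mul]
    have : 0 ≤ B 0 * (P 0 * (155 * E 0)) := by positivity
    linarith
  have hsh : BD (fun x => et x * m x) (M 0 * (a / t ^ 2)) (M R * l) R := by
    refine (hem R le_rfl).sharpen (hem 0 (Nat.zero_le _)) ?_ M1' hl0
    have := M1 0
    rw [← mul_assoc]
    refine mul_le_mul_of_nonneg_right ?_ hat0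
    nlinarith
  have hMl : 0 ≤ M R * l := by positivity
  have e1 : deriv (fun x => x + et x * m x) = fun x => 1 + deriv (fun x => et x * m x) x := by
    ext x; exact deriv_id_add hsh.sm x
  have hX : Bd (deriv (fun x => x + et x * m x)) 2 (M R * l) R := by
    rw [e1]
    refine (Bd.add contDiff_const hsh.sm.deriv (Bd.const 1 _ hMl R) hsh.b1).mono_a ?_ hMl
    rw [abs_one]; linarith
  have hX2 : ∀ x, 1/2 ≤ deriv (fun x => x + et x * m x) x := by
    intro x
    rw [e1]
    have := abs_le.1 (hsh.b1.b0 x)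
    simp only; linarith
  have hXs : Sm (fun x => x + et x * m x) := contDiff_id.add hsh.sm
  have hcomp : ∀ {g : ℝ → ℝ} {b : ℝ}, BD g b l r →
      BD (fun x => g (G x)) (M R ^ r * (J r * b)) l r := by
    intro g b hg
    refine BD.unsharpen ?_ M1' hl0
    refine hJ r (fun x => x + et x * m x) G g _ _ hMl hXs hG hG1 hX2 (hX.le (by omega)) ?_
    exact hg.mono le_rfl hl0 (le_mul_of_one_le_left hl0 M1') le_rfl
  constructor
  · have hv : BD (fun x => (et (x + t) + (-1) * et x) * m x)
        (2 ^ (r + 1) * (2 * B r) * (W R * (a / t ^ 2) * (t * l) ^ p)) l r := by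
      refine (BD.mul hl (((hB r l hl).shift t).add ((hB r l hl).cmul (-1)))
        (BD.gain ht (by linarith) hl hmp hm0 r p (hmw (hw R le_rfl)))).mono_a (le_of_eq ?_) hl0
      rw [abs_neg, abs_one]; ring
    have h2 := (hcomp hv).shift (-t)
    have e2 : (fun z => (et (G (z + -t) + t) - et (G (z + -t))) * m (G (z + -t))) =
      fun z => (et (G (z + -t) + t) + (-1) * et (G (z + -t))) * m (G (z + -t)) := by
      ext z; ring
    rw [e2]
    refine h2.mono_a ?_ hl0
    calc _ = Cu * (a / t ^ 2) * (t * l) ^ p := by rw [hCu]; ring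
      _ ≤ _ := by
        have : 0 ≤ t * l := by positivity
        gcongr; linarith
  · have hv : BD (fun x => th x * (phiW t (fun x => u x + e x) n x + (-1) * (et x * m x)))
        (2 ^ (r + 1) * Θ r * ((W R + M R) * (a / t ^ 2))) l r := by
      refine (BD.mul hl (hΘ r l hl) (((hw R le_rfl).le (by omega)).add
        (((hem R le_rfl).le (by omega)).cmul (-1)))).mono_a (le_of_eq ?_) hl0
      rw [abs_neg, abs_one]; ring
    have h2 := hcomp hv
    have e2 : (fun x => th (G x) * (phiW t (fun x => u x + e x) n (G x) - et (G x) * m (G x))) =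
      fun x => th (G x) * (phiW t (fun x => u x + e x) n (G x) + (-1) * (et (G x) * m (G x))) := by
      ext z; ring
    rw [e2]
    refine h2.mono_a ?_ hl0
    calc _ = Cw * (a / t ^ 2) := by rw [hCw]; ring
      _ ≤ _ := by gcongr; linarith


/-- the relation of one step -/
def StepRel (t c : ℝ) (u u₁ w₁ : ℝ → ℝ) : Prop :=
  dP u * (dP (tD t) * dP (Fc c) * (dP (tD t))⁻¹ * (dP (Fc c))⁻¹) * dP (TD t) =
    dP w₁ * dP u₁ * dP (TD t) * (dP w₁)⁻¹

set_option maxHeartbeats 1000000 in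
theorem step : ∃ (t0 c0 : ℝ) (C : ℕ → ℕ → ℝ), 0 < t0 ∧ t0 ≤ 1 / 10 ∧ 0 < c0 ∧ (∀ r p, 1 ≤ C r p) ∧
    (∀ t, |t| ≤ t0 → Gd (TD t) ∧ Gd (tD t)) ∧
    ∀ (t : ℝ) (u : ℝ → ℝ), 0 < t → t ≤ t0 → BD u (c0 * t ^ 2) 1 0 → (∀ x, x ∉ Ioo (0:ℝ) 1 → u x = 0) →
    ∃ (u₁ w₁ : ℝ → ℝ) (c : ℝ), (∀ x, x ∉ Ioo (0:ℝ) 1 → u₁ x = 0) ∧ (∀ x, x ∉ Icc (-1:ℝ) 13 → w₁ x = 0) ∧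
      Gd u ∧ Gd u₁ ∧ Gd w₁ ∧ Gd (Fc c) ∧ StepRel t c u u₁ w₁ ∧
      ∀ (r p : ℕ) (a l : ℝ), 1 ≤ l → a ≤ c0 * t ^ 2 → BD u a l (r + p) →
        BD u₁ (C r p * (a / t ^ 2) * (t * l) ^ p) l r ∧ BD w₁ (C r p * (a / t ^ 2)) l r ∧
        |c| ≤ 4 * a / t := by
  obtain ⟨cT, hcT, hT⟩ := zt_cut.gd
  obtain ⟨ca, hca, hta⟩ := ta_cut.gd
  obtain ⟨cb, hcb, hb⟩ := bs_cut.gd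
  set c1 := min cb (1/2) with hc1
  have hF : ∀ c, |c| ≤ c1 → Gd (Fc c) := fun c hc => hb c (hc.trans (min_le_left _ _))
  have hc10 : 0 < c1 := lt_min hcb (by norm_num)
  have hc12 : c1 ≤ 1/2 := min_le_right _ _
  choose E hE1 hE using fun r => eD_BD (show c1 ≤ 1 by linarith) hF r
  choose P hP1 hP using phiW_BD
  choose B hB1 hB using et_cut.2
  choose Θ hΘ1 hΘ using th_cut.2
  choose J hJ1 hJ using fun r => BD.comp_inv r (1/2) 2 (by norm_num) (by norm_num)
  choose C hC1 hC using step_est E P B Θ J hE1 hP1 hB1 hΘ1 hJ1 hP hB hΘ hJ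
  have hE0 := hE1 0
  have hP0 := hP1 0
  have hB0 := hB1 0
  have hC0 := hC1 0 0
  set c0 := min (c1 / 4) (min (1 / (8 * C 0 0)) (min (1 / (8 * E 0))
    (1 / (4 * (155 * E 0 * P 0 * (4 * B 0)))))) with hc0
  have hc00 : 0 < c0 := by
    refine lt_min (by positivity) (lt_min (by positivity) (lt_min (by positivity) (by positivity)))
  have q1 : c0 ≤ c1 / 4 := min_le_left _ _
  have q2 : C 0 0 * c0 ≤ 1 / 8 := by
    have : c0 ≤ 1 / (8 * C 0 0) := (min_le_right _ _).trans (min_le_left _ _)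
    rw [le_div_iff₀ (by positivity)] at this; linarith
  have q3 : E 0 * c0 ≤ 1 / 8 := by
    have : c0 ≤ 1 / (8 * E 0) := (min_le_right _ _).trans ((min_le_right _ _).trans (min_le_left _ _))
    rw [le_div_iff₀ (by positivity)] at this; linarith
  have q4 : 155 * E 0 * P 0 * (4 * B 0) * c0 ≤ 1 / 4 := by
    have : c0 ≤ 1 / (4 * (155 * E 0 * P 0 * (4 * B 0))) :=
      (min_le_right _ _).trans ((min_le_right _ _).trans (min_le_right _ _))
    rw [le_div_iff₀ (by positivity)] at this; linarith
  have q5 : c0 ≤ 1 / 8 := by nlinarith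
  clear_value c0
  refine ⟨min (min cT ca) (1/10), c0, C, lt_min (lt_min hcT hca) (by norm_num), min_le_right _ _,
    hc00, hC1, fun t ht => ⟨hT t ?_, hta t ?_⟩, ?_⟩
  · exact ht.trans ((min_le_left _ _).trans (min_le_left _ _))
  · exact ht.trans ((min_le_left _ _).trans (min_le_right _ _))
  intro t u ht htt hu hu0
  have ht1 : t ≤ 1/10 := htt.trans (min_le_right _ _)
  have gT : Gd (TD t) := hT t (by
    rw [abs_of_pos ht]; exact htt.trans ((min_le_left _ _).trans (min_le_left _ _)))
  have gt : Gd (tD t) := hta t (by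
    rw [abs_of_pos ht]; exact htt.trans ((min_le_left _ _).trans (min_le_right _ _)))
  have bdd : BddAbove (range fun x => |u x|) := ⟨c0 * t ^ 2, by rintro _ ⟨x, rfl⟩; exact hu.b0 x⟩
  set a0 := ⨆ x, |u x| with ha0
  have hua : ∀ x, |u x| ≤ a0 := fun x => le_ciSup bdd x
  have ha00 : 0 ≤ a0 := (abs_nonneg _).trans (hua 0)
  have a0le : ∀ {a l : ℝ} {r : ℕ}, BD u a l r → a0 ≤ a := fun h => ciSup_le fun x => h.b0 x
  have ha0t : a0 ≤ c0 * t ^ 2 := a0le hu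
  have hd : 4 * a0 / t ≤ 4 * c0 * t := by
    rw [div_le_iff₀ ht]; nlinarith
  have hdc : 4 * a0 / t ≤ c1 := hd.trans (by nlinarith)
  set n := ⌈30 / t⌉₊ with hn
  have hn1 : 30 ≤ n * t := by
    have := Nat.le_ceil (30 / t)
    rwa [div_le_iff₀ ht] at this
  have hn2 : n * t ≤ 31 := by
    have := Nat.ceil_lt_add_one (show 0 ≤ 30 / t by positivity)
    have h2 : (n : ℝ) * t ≤ (30 / t + 1) * t := mul_le_mul_of_nonneg_right this.le ht.le
    have h3 : (30 / t + 1) * t = 30 + t := by field_simp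
    linarith
  have he : ∀ c, |c| ≤ 4 * a0 / t → ∀ a l, a0 ≤ a → 1 ≤ l → ∀ R, BD (eD t c) (E R * (4 * a / t)) l R := by
    intro c hc a l ha hl R
    refine (hE R t c l ht.le (by linarith) (hc.trans hdc) hl).mono_a ?_ (by linarith)
    have := hE1 R
    have : 4 * a0 / t ≤ 4 * a / t := by gcongr
    gcongr; linarith
  have hes : ∀ c x, |c| ≤ 4 * a0 / t → |eD t c x| ≤ t / 2 := by
    intro c x hc
    refine ((he c hc a0 1 le_rfl le_rfl 0).b0 x).trans ?_
    calc E 0 * (4 * a0 / t) ≤ E 0 * (4 * c0 * t) := by gcongr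
      _ = 4 * (E 0 * c0) * t := by ring
      _ ≤ 4 * (1/8) * t := by gcongr
      _ = t / 2 := by ring
  have hws0 : ∀ c, |c| ≤ 4 * a0 / t → ∀ x, |phiW t (fun x => u x + eD t c x) n x| ≤ 1 / 8 := by
    intro c hc x
    have h := (hC 0 0 t (c0 * t ^ 2) 1 c0 u (eD t c) n ht ht1 le_rfl hn2 le_rfl q4 hu
      (he c hc _ 1 ha0t le_rfl)).1
    refine (h.b0 x).trans ?_
    rw [show c0 * t ^ 2 / t ^ 2 = c0 by field_simp]; exact q2
  have hat : a0 ≤ t / 4 := ha0t.trans (by nlinarith)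
  obtain ⟨c, hc, hc12'⟩ := ivt_c hu.sm.continuous hF hc12 ht ht1 ha00 hat hua hu0 hdc hes n hn1
    (fun c hc => (hws0 c hc 12).trans (by norm_num))
  set w := phiW t (fun x => u x + eD t c x) n with hw
  have hws := hws0 c hc
  have gF := hF c (hc.trans hdc)
  have he0 : ∀ x, x ∉ Icc (2:ℝ) 10 → eD t c x = 0 := fun x hx =>
    eD_zero ht.le ht1 (hc.trans (hdc.trans hc12)) gF hx
  have hU : ∀ x ≤ (0:ℝ), u x + eD t c x = 0 := fun x hx => by
    rw [hu0 x (fun h => by linarith [h.1]), he0 x (fun h => by linarith [h.1]), add_zero]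
  have eBD := he c hc
  have wsm : Sm w := (hC 0 0 t (c0 * t ^ 2) 1 c0 u (eD t c) n ht ht1 le_rfl hn2 le_rfl q4 hu
      (eBD _ 1 ha0t le_rfl)).1.sm
  obtain ⟨m, hm, hmp, hmw, hmB⟩ := periodic_ext wsm ht (by linarith) (by
    intro x hx
    have h1 := abs_le.1 (hws x)
    rw [hw, phiW_rel hU n (show x + t ≤ n * t by linarith [hx.2]), ← hw,
      hu0 _ (fun h => by linarith [h.2, hx.1]), he0 _ (fun h => by linarith [h.2, hx.1])]
    ring)
  have hm0 : ∃ x, m x = 0 := ⟨12, by rw [hmw 12 ⟨by norm_num, by norm_num⟩]; exact hc12'⟩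
  have base := hC 0 0 t (c0 * t ^ 2) 1 c0 u (eD t c) n ht ht1 le_rfl hn2 le_rfl q4 hu
      (eBD _ 1 ha0t le_rfl)
  have hcc : c0 * t ^ 2 / t ^ 2 = c0 := by field_simp
  rw [hcc] at base
  have hms : ∀ x, |m x| ≤ 1 / 8 := fun x => ((hmB base.1).b0 x).trans q2
  have gem : Gd (fun x => et x * m x) := by
    refine (BD.mul le_rfl (hB 0 1 le_rfl) (hmB (hP 0 t _ _ 1 n zero_le_one
      (hu.add (eBD _ 1 ha0t le_rfl 0)) ?_))).gd ?_
    all_goals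
      have h1 : n * (c0 * t ^ 2 + E 0 * (4 * (c0 * t ^ 2) / t)) ≤ 155 * E 0 * c0 := by
        have e1 : n * (c0 * t ^ 2 + E 0 * (4 * (c0 * t ^ 2) / t)) =
          (n * t) * (c0 * t + 4 * E 0 * c0) := by field_simp
        rw [e1]
        have h2 : c0 * t + 4 * E 0 * c0 ≤ 5 * (E 0 * c0) := by
          have h3 : c0 * t ≤ c0 * 1 := by gcongr; linarith
          have h4 : 1 * c0 ≤ E 0 * c0 := by gcongr
          linarith
        calc _ ≤ 31 * (5 * (E 0 * c0)) := by gcongr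
          _ = _ := by ring
    · refine h1.trans (le_trans ?_ q4)
      have : 1 ≤ P 0 * (4 * B 0) := one_le_mul_of_one_le_of_one_le hP0 (by linarith)
      have h5 : 0 ≤ 155 * E 0 * c0 := by positivity
      nlinarith
    · have h6 : 2 ^ (0 + 1) * B 0 * (P 0 * (n * (c0 * t ^ 2 + E 0 * (4 * (c0 * t ^ 2) / t)))) ≤
        2 ^ (0 + 1) * B 0 * (P 0 * (155 * E 0 * c0)) := by gcongr
      linarith
  obtain ⟨G, hG, hG1, hG2⟩ := gem.inv
  have est := fun (r p : ℕ) (a l : ℝ) (hl : 1 ≤ l) (ha : a ≤ c0 * t ^ 2) (h : BD u a l (r + p)) =>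
    (hC r p t a l c0 u (eD t c) n ht ht1 hl hn2 ha q4 h (eBD a l (a0le h) hl)).2 m hmp hm0 hmB G hG hG1
  have bs := est 0 0 (c0 * t ^ 2) 1 le_rfl le_rfl hu
  rw [hcc] at bs
  have gu₁ := bs.1.gd (by rw [pow_zero]; linarith)
  have gw₁ := bs.2.gd (by linarith)
  have gu : Gd u := hu.gd (by nlinarith)
  have R := rel (K := dP (tD t) * dP (Fc c) * (dP (tD t))⁻¹ * (dP (Fc c))⁻¹) ht ht1 hu0 he0
    (fun x => (hes c x hc).trans (by linarith)) hn1
    (comm_eq ht.le ht1 (hc.trans (hdc.trans hc12)) gF gt) w _ _ hw hws hms hmp hmw hG1 hG2 rfl rfl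
    gu gu₁ gw₁ gT
  exact ⟨_, _, c, R.1, R.2.1, gu, gu₁, gw₁, gF, R.2.2, fun r p a l hl ha h =>
    ⟨(est r p a l hl ha h).1, (est r p a l hl ha h).2, hc.trans (by gcongr; exact a0le h)⟩⟩


/-- rapidly decaying double family -/
def Rp (v : ℕ → ℕ → ℝ → ℝ) : Prop :=
  ∀ (i : ℕ) (b : ℝ), 0 < b → ∃ A : ℝ, ∀ n j x, |iteratedDeriv i (v n j) x| ≤ A * b ^ (n + j)

lemma sup_exp {q : ℝ} (hq : 0 < q) (hq1 : q < 1) (X b : ℝ) (hX : 0 ≤ X) (hb : 0 < b) :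
    ∃ A : ℝ, 0 ≤ A ∧ ∀ k : ℕ, X ^ k * q ^ (2 ^ k) ≤ A * b ^ k := by
  obtain ⟨s, hs⟩ := pow_unbounded_of_one_lt (X / b) (by norm_num : (1:ℝ) < 2)
  have hlim := tendsto_pow_const_mul_const_pow_of_abs_lt_one s (show |q| < 1 by rwa [abs_of_pos hq])
  obtain ⟨A, hA⟩ := hlim.bddAbove_range
  refine ⟨max A 0, le_max_right _ _, fun k => ?_⟩
  have h1 : ((2 ^ k : ℕ) : ℝ) ^ s * q ^ (2 ^ k) ≤ A := hA ⟨2 ^ k, rfl⟩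
  have h2 : (X / b) ^ k ≤ ((2 ^ k : ℕ) : ℝ) ^ s := by
    calc (X / b) ^ k ≤ (2 ^ s) ^ k := by gcongr
      _ = _ := by push_cast; rw [← pow_mul, ← pow_mul, mul_comm]
  have h3 : X ^ k = (X / b) ^ k * b ^ k := by rw [← mul_pow]; field_simp
  rw [h3]
  calc (X / b) ^ k * b ^ k * q ^ 2 ^ k = ((X / b) ^ k * q ^ 2 ^ k) * b ^ k := by ring
    _ ≤ (((2 ^ k : ℕ) : ℝ) ^ s * q ^ 2 ^ k) * b ^ k := by gcongr
    _ ≤ A * b ^ k := by gcongr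
    _ ≤ max A 0 * b ^ k := by gcongr; exact le_max_left _ _

/-- rapid from bounds -/
lemma Rp.of_bd {v : ℕ → ℕ → ℝ → ℝ} {q : ℝ} (hq : 0 < q) (hq1 : q < 1)
    (h : ∀ r, ∃ C L : ℝ, 0 ≤ C ∧ 1 ≤ L ∧ ∀ n j, BD (v n j) (C * q ^ (2 ^ (n + j))) (L ^ (n + j + 1)) r) :
    Rp v := by
  intro i b hb
  obtain ⟨C, L, hC, hL, h⟩ := h i
  obtain ⟨A, hA0, hA⟩ := sup_exp hq hq1 (L ^ i) b (by positivity) hb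
  refine ⟨C * L ^ i * A, fun n j x => ?_⟩
  have h1 := (h n j).bd (one_le_pow₀ hL) i le_rfl x
  refine h1.trans ?_
  have h2 := hA (n + j)
  calc C * q ^ 2 ^ (n + j) * (L ^ (n + j + 1)) ^ i
      = C * L ^ i * ((L ^ i) ^ (n + j) * q ^ 2 ^ (n + j)) := by
        rw [← pow_mul, ← pow_mul, show (n + j + 1) * i = i * (n + j) + i by ring, pow_add]; ring
    _ ≤ C * L ^ i * (A * b ^ (n + j)) := by gcongr
    _ = _ := by ring

lemma cut_of_supp {u : ℝ → ℝ} (hu : Sm u) (h : ∀ x, x ∉ Ioo (0:ℝ) 1 → u x = 0) : Cut u :=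
  cut_of_const hu 1 0 0 (fun x hx => h x (fun h => by linarith [h.2]))
    (fun x hx => h x (fun h => by linarith [h.1]))

lemma BD.of_iter {u : ℝ → ℝ} {a : ℝ} {r : ℕ} (hu : Sm u)
    (h : ∀ i ≤ r + 1, ∀ x, |iteratedDeriv i u x| ≤ a) : BD u a 1 r :=
  ⟨hu, fun x => by simpa using h 0 (by omega) x, fun j hj x => by
    rw [← iteratedDeriv_succ', one_pow, mul_one]; exact h _ (by omega) x⟩

/-- uniform base bound -/
lemma base_bd {u : ℕ → ℝ → ℝ} {a : ℕ → ℝ} (ha : ∀ n, 0 < a n) (hu : ∀ n, Sm (u n))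
    (hs : ∀ n x, x ∉ Ioo (0:ℝ) 1 → u n x = 0)
    (h : ∀ n, ∀ i ≤ n + 25, ∀ x, |iteratedDeriv i (u n) x| ≤ a n) (r : ℕ) :
    ∃ A : ℝ, 1 ≤ A ∧ ∀ n, BD (u n) (a n) A r := by
  have h0 : ∀ n, BD (u n) (a n) 1 (n + 24) := fun n => BD.of_iter (hu n) (h n)
  have h1 : ∀ n, ∃ A : ℝ, 1 ≤ A ∧ BD (u n) (a n) A r := by
    intro n
    obtain ⟨B, hB, hb⟩ := (cut_of_supp (hu n) (hs n)).2 r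
    refine ⟨max 1 (B / a n) * 1, by simp, (hb 1 le_rfl).sharpen ((h0 n).le (by omega)) ?_
      (le_max_left _ _) zero_le_one⟩
    calc B = B / a n * a n := by have := ha n; field_simp
      _ ≤ _ := by gcongr; exacts [(ha n).le, le_max_right _ _]
  choose A hA1 hA using h1
  refine ⟨1 + ∑ n ∈ Finset.range r, A n, ?_, fun n => ?_⟩
  · have : 0 ≤ ∑ n ∈ Finset.range r, A n := Finset.sum_nonneg fun n _ => by linarith [hA1 n]
    linarith
  · by_cases hn : n < r
    · have : A n ≤ ∑ n ∈ Finset.range r, A n := Finset.single_le_sum (f := A)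
        (fun n _ => by linarith [hA1 n]) (Finset.mem_range.2 hn)
      exact (hA n).mono le_rfl (by linarith [hA1 n]) (by linarith) le_rfl
    · have : 0 ≤ ∑ n ∈ Finset.range r, A n := Finset.sum_nonneg fun n _ => by linarith [hA1 n]
      exact (h0 n).mono le_rfl zero_le_one (by linarith) (by omega)

/-- claim 0 arithmetic -/
lemma claim0 {q C1 C2 : ℝ} {u : ℝ → ℝ} (hq : 0 < q) (hq1 : q ≤ 1) (hC1 : 1 ≤ C1) (hC2 : 1 ≤ C2)
    (h1 : C1 * q ≤ 1) (h2 : C2 * q ≤ 1)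
    (b1 : BD u (C1 * q ^ 2) (1 / q) 24) (b2 : BD u (C2 * q ^ 2 * q ^ 14) (1 / q) 10) :
    BD u ((q ^ 2) ^ 6) (1 / q ^ 2) 24 := by
  have e2 : C2 * q ^ 2 * q ^ 14 ≤ (q ^ 2) ^ 6 := by
    calc C2 * q ^ 2 * q ^ 14 = (C2 * q) * q ^ 3 * (q ^ 2) ^ 6 := by ring
      _ ≤ 1 * 1 * (q ^ 2) ^ 6 := by gcongr; exact pow_le_one₀ hq.le hq1
      _ = _ := by ring
  refine ⟨b1.sm, fun x => (b2.b0 x).trans e2, fun j hj x => ?_⟩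
  rcases le_or_gt j 10 with hj' | hj'
  · refine (b2.b1 j hj' x).trans ?_
    gcongr ?_ * ?_ ^ j
    rw [div_le_div_iff₀ hq (by positivity)]; nlinarith
  · refine (b1.b1 j hj x).trans ?_
    obtain ⟨i, rfl⟩ := Nat.exists_eq_add_of_lt hj'
    have : 1 / q ^ 2 = (1 / q) * (1 / q) := by field_simp
    rw [this, mul_pow]
    have e : (q ^ 2) ^ 6 * ((1 / q) ^ (10 + i + 1) * (1 / q) ^ (10 + i + 1)) =
      (q ^ 2 * (1/q) ^ (10 + i + 1)) * ((1/q) * (1 / q) ^ i)  := by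
      rw [show 10 + i + 1 = i + 11 by omega, pow_add]; field_simp
    rw [e]
    have e3 : C1 ≤ (1 / q) * (1 / q) ^ i := by
      have : 1 ≤ (1 / q) ^ i := one_le_pow₀ (by rw [le_div_iff₀ hq]; linarith)
      have h4 : C1 ≤ 1 / q := by rw [le_div_iff₀ hq]; exact h1
      have : 0 ≤ 1 / q := by positivity
      nlinarith
    have : 0 ≤ q ^ 2 * (1/q) ^ (10 + i + 1) := by positivity
    nlinarith

/-- claim r arithmetic -/
lemma claimr {q C L : ℝ} {u : ℝ → ℝ} {r : ℕ} (hq : 0 < q) (hq1 : q ≤ 1) (hC : 1 ≤ C) (hL : 1 ≤ L)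
    (b0 : BD u ((q ^ 2) ^ 6) (1 / q ^ 2) 24) (b1 : BD u (C * q ^ 2) (L / q) r) :
    BD u ((q ^ 2) ^ 6) (L * C / q ^ 2) r := by
  refine ⟨b0.sm, b0.b0, fun j hj x => ?_⟩
  rcases le_or_gt j 24 with hj' | hj'
  · refine (b0.b1 j hj' x).trans ?_
    have : 1 ≤ L * C := one_le_mul_of_one_le_of_one_le hL hC
    gcongr
  · refine (b1.b1 j hj x).trans ?_
    obtain ⟨i, rfl⟩ := Nat.exists_eq_add_of_lt hj'
    have hi : 1 ≤ 1 / q := by rw [le_div_iff₀ hq]; linarith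
    have e : L * C / q ^ 2 = (L / q) * (C * (1 / q)) := by field_simp
    rw [e, mul_pow (L / q)]
    have h1 : (C * (1 / q)) ^ (24 + i + 1) = C * (1/q) ^ 10 * (C * (1/q)) ^ i * (C ^ 24 * (1/q) ^ 15)  := by
      rw [mul_pow, mul_pow]; ring
    have h2 : 1 ≤ (C * (1/q)) ^ i * (C ^ 24 * (1/q) ^ 15) := by
      refine one_le_mul_of_one_le_of_one_le (one_le_pow₀ ?_) ?_
      · exact one_le_mul_of_one_le_of_one_le hC hi
      · exact one_le_mul_of_one_le_of_one_le (one_le_pow₀ hC) (one_le_pow₀ hi)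
    have h3 : q ^ 10 * (1/q) ^ 10 = 1 := by rw [← mul_pow]; field_simp
    have h4 : C * q ^ 2 ≤ (q ^ 2) ^ 6 * (C * (1/q)) ^ (24 + i + 1) := by
      rw [h1]
      calc C * q ^ 2 = C * q ^ 2 * (q ^ 10 * (1/q) ^ 10) * 1 := by rw [h3]; ring
        _ ≤ C * q ^ 2 * (q ^ 10 * (1/q) ^ 10) * ((C * (1/q)) ^ i * (C ^ 24 * (1/q) ^ 15)) := by gcongr
        _ = _ := by ring
    calc C * q ^ 2 * (L / q) ^ (24 + i + 1) ≤ ((q ^ 2) ^ 6 * (C * (1/q)) ^ (24 + i + 1)) * (L / q) ^ (24 + i + 1) := by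
          gcongr
      _ = _ := by ring


lemma BD.zero_l {u : ℝ → ℝ} {a l : ℝ} {r : ℕ} (h : BD u a l r) (l' : ℝ) : BD u a l' 0 :=
  ⟨h.sm, h.b0, fun j hj x => by
    obtain rfl : j = 0 := by omega
    simpa using h.b1 0 (by omega) x⟩

lemma rp_cut {f : ℝ → ℝ} (hf : Cut f) {q A : ℝ} (hq : 0 < q) (hq1 : q < 1) (hA : 0 ≤ A) {c : ℕ → ℕ → ℝ}
    (hc : ∀ n j, |c n j| ≤ A * q ^ (2 ^ (n + j))) : Rp (fun n j x => c n j * f x) := by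
  refine Rp.of_bd hq hq1 fun r => ?_
  obtain ⟨B, hB, hb⟩ := hf.2 r
  refine ⟨A * B, 1, by positivity, le_rfl, fun n j => ?_⟩
  rw [one_pow]
  refine ((hb 1 le_rfl).cmul (c n j)).mono ?_ zero_le_one le_rfl le_rfl
  calc |c n j| * B ≤ (A * q ^ (2 ^ (n + j))) * B := by gcongr; exact hc n j
    _ = _ := by ring

/-- the full iteration -/
theorem iter : ∃ (t ε : ℕ → ℝ), (∀ n, 0 < ε n) ∧ (∀ k, Gd (TD (t k)) ∧ Gd (tD (t k))) ∧
    Rp (fun n j => TD (t (n + j))) ∧ Rp (fun n j => tD (t (n + j))) ∧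
    ∀ u : ℕ → ℝ → ℝ, (∀ n, Sm (u n)) → (∀ n x, x ∉ Ioo (0:ℝ) 1 → u n x = 0) →
      (∀ n, ∀ i ≤ n + 25, ∀ x, |iteratedDeriv i (u n) x| ≤ ε n) →
    ∃ (U W : ℕ → ℕ → ℝ → ℝ) (c : ℕ → ℕ → ℝ), (∀ n, U n 0 = u n) ∧
      (∀ n j, StepRel (t (n + j)) (c n j) (U n j) (U n (j + 1)) (W n j)) ∧
      (∀ n j x, x ∉ Ioo (0:ℝ) 1 → U n j x = 0) ∧ (∀ n j x, x ∉ Icc (-1:ℝ) 13 → W n j x = 0) ∧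
      (∀ n j, Gd (U n j) ∧ Gd (W n j) ∧ Gd (Fc (c n j))) ∧ Rp U ∧ Rp W ∧ Rp (fun n j => Fc (c n j)) := by
  obtain ⟨t0, c0, C, ht0, ht01, hc0, hC, hT, hst⟩ := step
  obtain ⟨q0, hq0, hq1, e1, e2, e3, e4⟩ : ∃ q0 : ℝ, 0 < q0 ∧ q0 < 1 ∧ q0 ^ 2 ≤ t0 ∧ q0 ^ 2 ≤ c0 ∧
      C 24 0 * q0 ≤ 1 ∧ C 10 14 * q0 ≤ 1 := by
    have a1 := hC 24 0
    have a2 := hC 10 14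
    set m := min (1/2) (min t0 (min c0 (min (1 / C 24 0) (1 / C 10 14)))) with hm
    have h1 : m ≤ 1 / 2 := min_le_left _ _
    have hp : 0 < m := by rw [hm]; positivity
    have h2 : m ≤ t0 := (min_le_right _ _).trans (min_le_left _ _)
    have h3 : m ≤ c0 := (min_le_right _ _).trans ((min_le_right _ _).trans (min_le_left _ _))
    have h4 : m ≤ 1 / C 24 0 := (min_le_right _ _).trans ((min_le_right _ _).trans ((min_le_right _ _).trans (min_le_left _ _)))
    have h5 : m ≤ 1 / C 10 14 := (min_le_right _ _).trans ((min_le_right _ _).trans ((min_le_right _ _).trans (min_le_right _ _)))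
    rw [le_div_iff₀ (by linarith)] at h4 h5
    exact ⟨m, hp, by linarith, by nlinarith, by nlinarith, by linarith, by linarith⟩
  set q : ℕ → ℝ := fun k => q0 ^ 2 ^ k with hq
  have qs : ∀ k, q (k + 1) = q k ^ 2 := fun k => by simp only [hq]; rw [pow_succ 2 k, pow_mul]
  have qp : ∀ k, 0 < q k := fun k => by positivity
  have qle : ∀ k, q k ≤ q0 := fun k => pow_le_of_le_one hq0.le hq1.le (by positivity)
  have q1 : ∀ k, q k ≤ 1 := fun k => (qle k).trans hq1.le
  have qi : ∀ k, 1 ≤ 1 / q k := fun k => by rw [le_div_iff₀ (qp k)]; linarith [q1 k]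
  have q2 : ∀ k, q k ^ 2 ≤ q0 ^ 2 := fun k => by have := qp k; have := qle k; gcongr
  have st : ∀ k u, ∃ u₁ w₁ c, (∀ x, x ∉ Ioo (0:ℝ) 1 → u x = 0) ∧ BD u (q k ^ 6) (1 / q k) 24 →
      (∀ x, x ∉ Ioo (0:ℝ) 1 → u₁ x = 0) ∧ (∀ x, x ∉ Icc (-1:ℝ) 13 → w₁ x = 0) ∧
      Gd u ∧ Gd w₁ ∧ Gd (Fc c) ∧ StepRel (q k ^ 2) c u u₁ w₁ ∧
      ∀ (r p : ℕ) (l : ℝ), 1 ≤ l → BD u (q k ^ 6) l (r + p) →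
        BD u₁ (C r p * q k ^ 2 * (q k ^ 2 * l) ^ p) l r ∧ BD w₁ (C r p * q k ^ 2) l r ∧
        |c| ≤ 4 * q k ^ 4 := by
    intro k u
    by_cases h : (∀ x, x ∉ Ioo (0:ℝ) 1 → u x = 0) ∧ BD u (q k ^ 6) (1 / q k) 24
    swap
    · exact ⟨u, u, 0, fun h' => absurd h' h⟩
    have hk := qp k
    have ha : q k ^ 6 ≤ c0 * (q k ^ 2) ^ 2 := by
      calc q k ^ 6 = q k ^ 2 * (q k ^ 2) ^ 2 := by ring
        _ ≤ _ := by gcongr; exact (q2 k).trans e2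
    obtain ⟨u₁, w₁, c, h1, h2, h3, h4, h5, h6, h7, h8⟩ := hst (q k ^ 2) u (by positivity) ((q2 k).trans e1)
      ((h.2.zero_l 1).mono ha zero_le_one le_rfl le_rfl) h.1
    refine ⟨u₁, w₁, c, fun _ => ⟨h1, h2, h3, h5, h6, h7, fun r p l hl hb => ?_⟩⟩
    have := h8 r p _ l hl ha hb
    rw [show q k ^ 6 / (q k ^ 2) ^ 2 = q k ^ 2 by field_simp,
      show 4 * q k ^ 6 / q k ^ 2 = 4 * q k ^ 4 by field_simp] at this
    exact this
  choose N Wn cn hN using st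
  refine ⟨fun k => q k ^ 2, fun n => q n ^ 6, fun n => by have := qp n; positivity, fun k => hT _ ?_, ?_, ?_, ?_⟩
  · rw [abs_of_pos (by have := qp k; positivity)]; exact (q2 k).trans e1
  · refine rp_cut (f := zt) zt_cut hq0 hq1 zero_le_one (c := fun n j => q (n + j) ^ 2) fun n j => ?_
    have := qp (n + j); have := q1 (n + j)
    rw [abs_of_pos (by positivity)]; change _ ≤ 1 * q (n + j); nlinarith
  · refine rp_cut (f := ta) ta_cut hq0 hq1 zero_le_one (c := fun n j => q (n + j) ^ 2) fun n j => ?_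
    have := qp (n + j); have := q1 (n + j)
    rw [abs_of_pos (by positivity)]; change _ ≤ 1 * q (n + j); nlinarith
  intro u hu hs hb
  set U : ℕ → ℕ → ℝ → ℝ := fun n j => Nat.rec (u n) (fun j v => N (n + j) v) j with hU
  have U0 : ∀ n, U n 0 = u n := fun n => rfl
  have US : ∀ n j, U n (j + 1) = N (n + j) (U n j) := fun n j => rfl
  have good : ∀ n j, (∀ x, x ∉ Ioo (0:ℝ) 1 → U n j x = 0) ∧ BD (U n j) (q (n + j) ^ 6) (1 / q (n + j)) 24 := by
    intro n j
    induction j with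
    | zero => exact ⟨hs n, (BD.of_iter (r := n + 24) (hu n) (hb n)).mono le_rfl zero_le_one (qi _) (by omega)⟩
    | succ j ih =>
      obtain ⟨h1, -, -, -, -, -, h⟩ := hN _ _ ih
      have a1 := (h 24 0 _ (qi _) ih.2).1
      have a2 := (h 10 14 _ (qi _) ih.2).1
      have hk := qp (n + j)
      rw [pow_zero, mul_one] at a1
      rw [show q (n + j) ^ 2 * (1 / q (n + j)) = q (n + j) by field_simp] at a2
      refine ⟨h1, ?_⟩
      rw [← add_assoc, qs]
      refine claim0 hk (q1 _) (hC 24 0) (hC 10 14) ?_ ?_ a1 a2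
      · refine le_trans ?_ e3; have := hC 24 0; gcongr; exact qle _
      · refine le_trans ?_ e4; have := hC 10 14; gcongr; exact qle _
  have hstep := fun n j => hN _ _ (good n j)
  have base := base_bd (a := fun n => q n ^ 6) (fun n => by have := qp n; positivity) hu hs hb
  have clR : ∀ r, ∃ A, 1 ≤ A ∧ ∀ n j, BD (U n j) (q (n + j) ^ 6) (A * C r 0 ^ (n + j) / q (n + j)) r := by
    intro r
    obtain ⟨A, hA, hb⟩ := base r
    have hB := hC r 0
    refine ⟨A, hA, fun n j => ?_⟩
    induction j with
    | zero =>
      refine (hb n).mono le_rfl (by linarith) ?_ le_rfl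
      have := one_le_pow₀ hB (n := n)
      have := qi n
      calc A = A * 1 * 1 := by ring
        _ ≤ A * C r 0 ^ n * (1 / q n) := by gcongr
        _ = _ := by simp [div_eq_mul_inv]
    | succ j ih =>
      have hL : 1 ≤ A * C r 0 ^ (n + j) := one_le_mul_of_one_le_of_one_le hA (one_le_pow₀ hB)
      have hk := qp (n + j)
      have a1 := ((hstep n j).2.2.2.2.2.2 r 0 _ ?_ ih).1
      · rw [pow_zero, mul_one] at a1
        have g := (good n (j + 1)).2
        rw [← add_assoc, qs] at g ⊢
        have := claimr hk (q1 _) hB hL g a1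
        rwa [mul_assoc, ← pow_succ] at this
      · rw [le_div_iff₀ hk]; linarith [q1 (n + j)]
  have clS : ∀ r, ∃ Λ, 1 ≤ Λ ∧ ∀ n j, BD (U n j) (q (n + j) ^ 6) (Λ ^ (n + j + 1)) r := by
    intro r
    obtain ⟨A0, hA0, hb⟩ := base r
    obtain ⟨A, hA, hR⟩ := clR (r + (r + 10))
    have hB := hC (r + (r + 10)) 0
    have hC' := hC r (r + 10)
    set B := C (r + (r + 10)) 0
    set s := r + (r + 10) with hs'
    have hAs : 1 ≤ A ^ s := one_le_pow₀ hA
    have hBs : 1 ≤ B ^ s := one_le_pow₀ hB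
    set Λ := A0 * (C r (r + 10) * A ^ s * B ^ s) with hΛ
    have h1 : 1 ≤ C r (r + 10) * A ^ s := one_le_mul_of_one_le_of_one_le hC' hAs
    have h2 : 1 ≤ C r (r + 10) * A ^ s * B ^ s := one_le_mul_of_one_le_of_one_le h1 hBs
    have hΛ1 : 1 ≤ Λ := one_le_mul_of_one_le_of_one_le hA0 h2
    refine ⟨Λ, hΛ1, fun n j => ?_⟩
    cases j with
    | zero =>
      refine (hb n).mono le_rfl (by linarith) ?_ le_rfl
      calc A0 ≤ Λ := le_mul_of_one_le_right (by linarith) h2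
        _ ≤ _ := le_self_pow₀ hΛ1 (by omega)
    | succ j =>
      have hk := qp (n + j)
      have hk1 := q1 (n + j)
      set lm := A * B ^ (n + j) with hlm
      have hL : 1 ≤ lm := one_le_mul_of_one_le_of_one_le hA (one_le_pow₀ hB)
      have a1 := ((hstep n j).2.2.2.2.2.2 r (r + 10) _ (by rw [le_div_iff₀ hk]; linarith) (hR n j)).1
      have g := (good n (j + 1)).2
      rw [← add_assoc, qs] at g ⊢
      rw [← US] at a1
      have key : BD (U n (j + 1)) (C r (r + 10) * lm ^ s * (q (n + j) ^ 2) ^ 6) 1 r := by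
        refine ⟨g.sm, fun x => (g.b0 x).trans ?_, fun i hi x => (a1.b1 i hi x).trans ?_⟩
        · refine le_mul_of_one_le_left (by positivity) (one_le_mul_of_one_le_of_one_le hC' (one_le_pow₀ hL))
        · obtain ⟨d, rfl⟩ := Nat.exists_eq_add_of_le hi
          rw [one_pow, mul_one]
          have : q (n + j) ^ 2 * (lm / q (n + j)) = q (n + j) * lm := by field_simp
          rw [this]
          have e : C (i + d) (i + d + 10) * q (n + j) ^ 2 * (q (n + j) * lm) ^ (i + d + 10) * (lm / q (n + j)) ^ i
            = C (i + d) (i + d + 10) * lm ^ (i + d + 10 + i) * (q (n + j) ^ 2) ^ 6 * q (n + j) ^ d := by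
            rw [mul_pow, div_pow]; field_simp; ring
          rw [e]
          calc _ ≤ C (i + d) (i + d + 10) * lm ^ (i + d + 10 + i) * (q (n + j) ^ 2) ^ 6 * 1 := by
                gcongr; exact pow_le_one₀ hk.le hk1
            _ ≤ _ := by
              rw [mul_one]; gcongr; omega
      have := key.sharpen (g.zero_l 1) le_rfl (one_le_mul_of_one_le_of_one_le hC' (one_le_pow₀ hL)) zero_le_one
      refine this.mono le_rfl (by positivity) ?_ le_rfl
      rw [mul_one, hlm, mul_pow, ← pow_mul, mul_comm (n + j) s, pow_mul]
      have i1 : C r (r + 10) * A ^ s ≤ Λ := by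
        calc _ ≤ C r (r + 10) * A ^ s * B ^ s := le_mul_of_one_le_right (by positivity) hBs
          _ ≤ _ := le_mul_of_one_le_left (by positivity) hA0
      have i2 : B ^ s ≤ Λ := by
        calc _ ≤ C r (r + 10) * A ^ s * B ^ s := le_mul_of_one_le_left (by positivity) h1
          _ ≤ _ := le_mul_of_one_le_left (by positivity) hA0
      calc _ = C r (r + 10) * A ^ s * (B ^ s) ^ (n + j) := by ring
        _ ≤ Λ * Λ ^ (n + j) := by gcongr
        _ = Λ ^ (n + j + 1) := by ring
        _ ≤ _ := pow_le_pow_right₀ hΛ1 (by omega)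
  refine ⟨U, fun n j => Wn (n + j) (U n j), fun n j => cn (n + j) (U n j), U0, fun n j => (hstep n j).2.2.2.2.2.1,
    fun n j => (good n j).1, fun n j => (hstep n j).2.1, fun n j => ⟨(hstep n j).2.2.1, (hstep n j).2.2.2.1,
    (hstep n j).2.2.2.2.1⟩, ?_, ?_, ?_⟩
  · refine Rp.of_bd hq0 hq1 fun r => ?_
    obtain ⟨Λ, h1, h⟩ := clS r
    refine ⟨1, Λ, zero_le_one, h1, fun n j => (h n j).mono ?_ (by positivity) le_rfl le_rfl⟩
    rw [one_mul]; exact pow_le_of_le_one (qp _).le (q1 _) (by norm_num)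
  · refine Rp.of_bd hq0 hq1 fun r => ?_
    obtain ⟨Λ, h1, h⟩ := clS r
    have hC' := hC r 0
    refine ⟨C r 0, Λ, by linarith, h1, fun n j =>
      ((hstep n j).2.2.2.2.2.2 r 0 _ (one_le_pow₀ h1) (h n j)).2.1.mono ?_ (by positivity) le_rfl le_rfl⟩
    gcongr
    exact pow_le_of_le_one (qp _).le (q1 _) (by norm_num)
  · refine rp_cut (f := bs) bs_cut hq0 hq1 (A := 4) (by norm_num) fun n j => ?_
    obtain ⟨Λ, h1, h⟩ := clS (0 + 0)
    refine ((hstep n j).2.2.2.2.2.2 0 0 _ (one_le_pow₀ h1) (h n j)).2.2.trans ?_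
    gcongr
    exact pow_le_of_le_one (qp _).le (q1 _) (by norm_num)


/-- compactly supported diffeo of the line -/
def Dc (P : Equiv.Perm ℝ) : Prop := ∃ V : ℝ → ℝ, Sm V ∧ (∀ y, 2/5 ≤ |y| → V y = 0) ∧
  (∀ y, 0 < 1 + deriv V y) ∧ ∀ y, P y = y + V y

lemma exists_dc {V : ℝ → ℝ} (hV : Sm V) (hs : ∀ y, 2/5 ≤ |y| → V y = 0) (hp : ∀ y, 0 < 1 + deriv V y) :
    ∃ P : Equiv.Perm ℝ, Dc P ∧ ∀ y, P y = y + V y := by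
  have hc : Cut V := cut_of_const hV (2/5) 0 0 (fun x hx => hs x (le_abs.2 (Or.inl hx)))
    (fun x hx => hs x (le_abs.2 (Or.inr (by linarith))))
  obtain ⟨B, -, hb⟩ := hc.2 0
  obtain ⟨G, -, h1, h2⟩ := exists_inv (X := fun x => x + V x) (contDiff_id.add hV)
    (fun x => by rw [deriv_id_add hV]; exact hp x) (surj_of_bdd hV.continuous B (hb 1 le_rfl).b0)
  exact ⟨⟨fun x => x + V x, G, h2, h1⟩, ⟨V, hV, hs, hp, fun _ => rfl⟩, fun _ => rfl⟩

/-- the contraction displacement -/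
def VD (y : ℝ) : ℝ := -(1/2) * (y * Real.smoothTransition ((4/25 - y ^ 2) * (25 / 3)))

lemma VD_sm : Sm VD := by
  refine ContDiff.mul (by fun_prop) (ContDiff.mul (by fun_prop) (Sm.st (show ContDiff ℝ (⊤ : ℕ∞) _ by fun_prop)))

lemma VD_in {y : ℝ} (hy : |y| ≤ 1/5) : y + VD y = y / 2 := by
  have : y ^ 2 ≤ (1/5) ^ 2 := by rw [← sq_abs]; gcongr
  rw [VD, Real.smoothTransition.one_of_one_le (by linarith)]; ring

lemma VD_out {y : ℝ} (hy : 2/5 ≤ |y|) : VD y = 0 := by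
  have : (2/5) ^ 2 ≤ y ^ 2 := by rw [← sq_abs y]; gcongr
  rw [VD, Real.smoothTransition.zero_of_nonpos (by linarith)]; ring

lemma VD_pos (y : ℝ) : 0 < 1 + deriv VD y := by
  set s := deriv Real.smoothTransition ((4/25 - y ^ 2) * (25 / 3))
  have hs : 0 ≤ s := Real.smoothTransition.monotone.deriv_nonneg
  have h1 : HasDerivAt (fun y : ℝ => (4/25 - y ^ 2) * (25 / 3)) (-(2 * y) * (25/3)) y := by
    have := ((hasDerivAt_pow 2 y).const_sub (4/25)).mul_const (25/3)
    simpa using this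
  have hd : DifferentiableAt ℝ Real.smoothTransition ((4/25 - y ^ 2) * (25 / 3)) :=
    (Real.smoothTransition.contDiff (n := 1)).differentiable (by simp) _
  have h2 := (HasDerivAt.comp y hd.hasDerivAt h1)
  have h3 := ((hasDerivAt_id y).mul h2).const_mul (-(1/2))
  have h4 : deriv VD y = _ := HasDerivAt.deriv h3
  rw [h4]
  have := Real.smoothTransition.le_one ((4/25 - y ^ 2) * (25 / 3))
  simp only [Function.comp, id, one_mul]
  change 0 < 1 + -(1/2) * (Real.smoothTransition ((4/25 - y ^ 2) * (25 / 3)) + y * (s * (-(2 * y) * (25/3))))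
  have : 0 ≤ y ^ 2 * s := by positivity
  nlinarith

lemma VD_sign {y : ℝ} (hy : 0 < y + VD y) : y + VD y ≤ y := by
  have h0 := Real.smoothTransition.nonneg ((4/25 - y ^ 2) * (25 / 3))
  have h1 := Real.smoothTransition.le_one ((4/25 - y ^ 2) * (25 / 3))
  have e : y + VD y = y * (1 - Real.smoothTransition ((4/25 - y ^ 2) * (25 / 3)) / 2) := by rw [VD]; ring
  have : 0 < y := by
    rw [e] at hy; exact (pos_iff_pos_of_mul_pos hy).2 (by linarith)
  rw [e]; nlinarith

def Es (n j : ℕ) (x : ℝ) : ℝ := (1/2) ^ n * (3/20 + (1/10) * ((1/2) ^ j * (3/20 + x / 1000)))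

lemma half_le (n : ℕ) : ((1:ℝ)/2) ^ n ≤ 1 := pow_le_one₀ (by norm_num) (by norm_num)
lemma half_pos' (n : ℕ) : 0 < ((1:ℝ)/2) ^ n := by positivity

lemma half_disj {n m : ℕ} {a b : ℝ} (ha : a ∈ Icc (3/25:ℝ) (9/50)) (hb : b ∈ Icc (3/25:ℝ) (9/50))
    (h : (1/2) ^ n * a = (1/2) ^ m * b) : n = m := by
  have key : ∀ {n m : ℕ} {a b : ℝ}, a ∈ Icc (3/25:ℝ) (9/50) → b ∈ Icc (3/25:ℝ) (9/50) →
      (1/2) ^ n * a = (1/2) ^ m * b → ¬ n < m := by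
    intro n m a b ha hb h hnm
    obtain ⟨d, rfl⟩ := Nat.exists_eq_add_of_lt hnm
    rw [pow_add, pow_add, mul_assoc, mul_assoc] at h
    have := mul_left_cancel₀ (half_pos' n).ne' h
    have h1 := half_le d
    have h2 := half_pos' d
    nlinarith [ha.1, hb.2, hb.1]
  exact le_antisymm (not_lt.1 (key hb ha h.symm)) (not_lt.1 (key ha hb h))

lemma Es_in {x : ℝ} (hx : |x| ≤ 30) : 3/20 + x / 1000 ∈ Icc (3/25:ℝ) (9/50) := by
  have := abs_le.1 hx; constructor <;> linarith

lemma Es_in2 (j : ℕ) {x : ℝ} (hx : |x| ≤ 30) :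
    3/20 + (1/10) * ((1/2) ^ j * (3/20 + x / 1000)) ∈ Icc (3/20:ℝ) (21/125) := by
  have := Es_in hx; have := half_le j; have := half_pos' j
  constructor <;> nlinarith [(Es_in hx).1, (Es_in hx).2]

lemma Es_disj {n m j k : ℕ} {x y : ℝ} (hx : |x| ≤ 30) (hy : |y| ≤ 30) (h : Es n j x = Es m k y) :
    n = m ∧ j = k ∧ x = y := by
  have h1 : n = m := half_disj (Icc_subset_Icc (by norm_num) (by norm_num) (Es_in2 j hx))
    (Icc_subset_Icc (by norm_num) (by norm_num) (Es_in2 k hy)) h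
  subst h1
  have h2 := mul_left_cancel₀ (half_pos' n).ne' h
  have h3 : (1/2:ℝ) ^ j * (3/20 + x / 1000) = (1/2) ^ k * (3/20 + y / 1000) := by linarith
  have h4 := half_disj (Es_in hx) (Es_in hy) h3
  subst h4
  have h5 := mul_left_cancel₀ (half_pos' j).ne' h3
  exact ⟨rfl, rfl, by linarith⟩

lemma Es_bd (n j : ℕ) {x : ℝ} (hx : |x| ≤ 30) : 0 < Es n j x ∧ Es n j x ≤ 21/125 := by
  have := Es_in2 j hx; have := half_le n; have := half_pos' n
  constructor
  · exact mul_pos this (by linarith [(Es_in2 j hx).1])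
  · rw [Es]; nlinarith [(Es_in2 j hx).1, (Es_in2 j hx).2]

/-- the shift maps -/
theorem shifts : ∃ σ M : Equiv.Perm ℝ, Dc σ ∧ Dc M ∧ (∀ n j x, |x| ≤ 30 → σ (Es n j x) = Es (n + 1) j x) ∧
    ∀ n m j x, |x| ≤ 30 → (σ ^ n * M * (σ ^ n)⁻¹) (Es m j x) = Es m (if m = n then j + 1 else j) x := by
  obtain ⟨σ, h1, h2⟩ := exists_dc VD_sm (fun y => VD_out) VD_pos
  have hM : Sm (fun y => (1/10) * VD (10 * y - 3/2)) :=
    ContDiff.mul contDiff_const (VD_sm.cmp (show ContDiff ℝ (⊤ : ℕ∞) _ by fun_prop))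
  have hMd : ∀ y, deriv (fun y => (1/10) * VD (10 * y - 3/2)) y = deriv VD (10 * y - 3/2) := by
    intro y
    have e : HasDerivAt (fun y : ℝ => 10 * y - 3/2) 10 y := by
      simpa using ((hasDerivAt_id y).const_mul 10).sub_const (3/2)
    have := ((HasDerivAt.comp y (VD_sm.da (10 * y - 3/2)).hasDerivAt e).const_mul (1/10)).deriv
    refine this.trans ?_
    ring
  have hMo : ∀ y : ℝ, y ∉ Ioo (11/100) (19/100) → VD (10 * y - 3/2) = 0 := by
    intro y hy
    apply VD_out
    by_contra h
    rw [not_le, abs_lt] at h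
    exact hy ⟨by linarith, by linarith⟩
  obtain ⟨M, h3, h4⟩ := exists_dc hM (fun y hy => by
    have := hMo y (fun h => by rw [le_abs] at hy; rcases hy with hy | hy <;> linarith [h.1, h.2])
    simp [this]) (fun y => by rw [hMd]; exact VD_pos _)
  have hσ : ∀ n j x, |x| ≤ 30 → σ (Es n j x) = Es (n + 1) j x := by
    intro n j x hx
    have := Es_bd n j hx
    rw [h2, VD_in (by rw [abs_of_pos this.1]; linarith)]
    rw [Es, Es, pow_succ]; ring
  have hσn : ∀ k n j x, |x| ≤ 30 → (σ ^ k) (Es n j x) = Es (n + k) j x := by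
    intro k
    induction k with
    | zero => intros; simp
    | succ k ih => intro n j x hx; rw [pow_succ', Equiv.Perm.mul_apply, ih n j x hx, hσ _ _ _ hx]; rfl
  have hM0 : ∀ j x, |x| ≤ 30 → M (Es 0 j x) = Es 0 (j + 1) x := by
    intro j x hx
    have e : 10 * Es 0 j x - 3/2 = (1/2) ^ j * (3/20 + x / 1000) := by rw [Es]; ring
    have hb : |10 * Es 0 j x - 3/2| ≤ 1 / 5 := by
      rw [e]
      have := Es_in hx; have := half_le j; have := half_pos' j
      rw [abs_le]
      constructor <;> nlinarith [(Es_in hx).1, (Es_in hx).2]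
    have := VD_in hb
    rw [h4, show VD (10 * Es 0 j x - 3/2) = -(10 * Es 0 j x - 3/2)/2 by linarith, Es, Es, pow_succ]
    ring
  have hMf : ∀ y : ℝ, y ∉ Ioo (11/100) (19/100) → M y = y := fun y hy => by rw [h4, hMo y hy]; ring
  have hMs : ∀ m j x, |x| ≤ 30 → M (Es (m + 1) j x) = Es (m + 1) j x := by
    intro m j x hx
    apply hMf
    have e : Es (m + 1) j x = Es m j x / 2 := by rw [Es, Es, pow_succ]; ring
    rw [e]
    intro h
    linarith [h.1, (Es_bd m j hx).2]
  have hback : ∀ k y, 1/10 < y → 1/10 < (σ ^ k).symm y := by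
    intro k
    induction k with
    | zero => intro y hy; exact hy
    | succ k ih =>
      intro y hy
      have : (σ ^ (k + 1)).symm y = (σ ^ k).symm (σ.symm y) := by
        rw [pow_succ']; rfl
      rw [this]
      apply ih
      have h := h2 (σ.symm y)
      rw [Equiv.apply_symm_apply] at h
      have := VD_sign (y := σ.symm y) (by linarith)
      linarith
  refine ⟨σ, M, h1, h3, hσ, fun n m j x hx => ?_⟩
  rw [Equiv.Perm.mul_apply, Equiv.Perm.mul_apply]
  rcases le_or_gt n m with hnm | hnm
  · obtain ⟨d, rfl⟩ := Nat.exists_eq_add_of_le' hnm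
    have : (σ ^ n)⁻¹ (Es (d + n) j x) = Es d j x := by
      rw [← hσn n d j x hx, Equiv.Perm.inv_def, Equiv.symm_apply_apply]
    rw [this]
    cases d with
    | zero => rw [hM0 _ _ hx, hσn _ _ _ _ hx]; simp
    | succ d => rw [hMs _ _ _ hx, hσn _ _ _ _ hx, if_neg (by omega)]
  · rw [if_neg (by omega)]
    rw [hMf, Equiv.Perm.inv_def, Equiv.apply_symm_apply]
    obtain ⟨d, rfl⟩ := Nat.exists_eq_add_of_lt hnm
    have e : (σ ^ (m + d + 1))⁻¹ (Es m j x) = σ.symm ((σ ^ d).symm (Es 0 j x)) := by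
      rw [Equiv.Perm.inv_eq_iff_eq]
      have : σ ^ (m + d + 1) = σ ^ m * (σ ^ d * σ) := by rw [← pow_succ, ← pow_add]; congr 1
      rw [this]
      simp only [Equiv.Perm.mul_apply, Equiv.apply_symm_apply]
      rw [hσn _ _ _ _ hx, zero_add]
    rw [e]
    have e0 : 1/10 < Es 0 j x := by
      rw [Es]; have := (Es_in2 j hx).1; linarith
    intro h
    have h5 := hback d _ e0
    have h6 := h2 (σ.symm ((σ ^ d).symm (Es 0 j x)))
    rw [Equiv.apply_symm_apply, VD_in (by rw [abs_le]; constructor <;> linarith [h.1, h.2])] at h6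
    linarith [h.2]


def IsPhi (a : ℕ → ℕ → Equiv.Perm ℝ) (g : Equiv.Perm ℝ) : Prop :=
  (∀ n j x, 30 ≤ |x| → a n j x = x) ∧ (∀ n j x, |x| ≤ 30 → g (Es n j x) = Es n j (a n j x)) ∧
    ∀ y, (∀ n j x, |x| ≤ 30 → y ≠ Es n j x) → g y = y

def Kp (p : ℕ × ℕ) : ℝ := 10000 * 2 ^ (p.1 + p.2)

lemma Kp_one (p : ℕ × ℕ) : 1 ≤ Kp p := by
  have : (1:ℝ) ≤ 2 ^ (p.1 + p.2) := one_le_pow₀ (by norm_num)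
  rw [Kp]; linarith

lemma Es_eq (p : ℕ × ℕ) (x : ℝ) : Es p.1 p.2 x = Es p.1 p.2 0 + (Kp p)⁻¹ * x := by
  have : (Kp p)⁻¹ = 1/10000 * ((1/2) ^ p.1 * (1/2) ^ p.2) := by
    rw [Kp, mul_inv, pow_add, mul_inv]; simp
  rw [this, Es, Es]; ring

def tm (v : ℕ → ℕ → ℝ → ℝ) (p : ℕ × ℕ) (y : ℝ) : ℝ :=
  (Kp p)⁻¹ * v p.1 p.2 (Kp p * y - Kp p * Es p.1 p.2 0)

lemma Es_Kp (p : ℕ × ℕ) (y : ℝ) : y = Es p.1 p.2 (Kp p * y - Kp p * Es p.1 p.2 0) := by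
  have := Kp_one p
  rw [Es_eq]; field_simp; ring

lemma Kp_Es (p : ℕ × ℕ) (x : ℝ) : Kp p * Es p.1 p.2 x - Kp p * Es p.1 p.2 0 = x := by
  have := Kp_one p
  rw [Es_eq]; field_simp; ring

lemma tm_iter {v : ℕ → ℕ → ℝ → ℝ} (hS : ∀ n j, Sm (v n j)) (p : ℕ × ℕ) (i : ℕ) (y : ℝ) :
    iteratedDeriv i (tm v p) y = (Kp p)⁻¹ * (Kp p ^ i *
      iteratedDeriv i (v p.1 p.2) (Kp p * y - Kp p * Es p.1 p.2 0)) := by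
  have h1 : Sm (fun x => v p.1 p.2 (x - Kp p * Es p.1 p.2 0)) :=
    (hS _ _).cmp (show ContDiff ℝ (⊤ : ℕ∞) _ by fun_prop)
  have h2 : iteratedDeriv i (fun y => v p.1 p.2 (Kp p * y - Kp p * Es p.1 p.2 0)) y = _ :=
    congrFun (iteratedDeriv_comp_const_mul (n := i) (h1.of_le (by exact_mod_cast le_top)) (Kp p)) y
  rw [iteratedDeriv_comp_sub_const] at h2
  unfold tm
  rw [iteratedDeriv_const_mul_field, h2]

/-- existence of infinite products -/
theorem exists_phi {v : ℕ → ℕ → ℝ → ℝ} (hG : ∀ n j, Gd (v n j)) (hs : ∀ n j x, 30 ≤ |x| → v n j x = 0)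
    (hR : Rp v) : ∃ g, Dc g ∧ IsPhi (fun n j => dP (v n j)) g := by
  have hS : ∀ n j, Sm (v n j) := fun n j => (hG n j).1.sm
  have hT : ∀ p, Sm (tm v p) := fun p =>
    contDiff_const.mul ((hS _ _).cmp (show ContDiff ℝ (⊤ : ℕ∞) _ by fun_prop))
  have hsum : Summable (fun p : ℕ × ℕ => ((1/2:ℝ)) ^ p.1 * (1/2) ^ p.2) :=
    summable_geometric_two.mul_of_nonneg summable_geometric_two (fun n => by positivity) (fun n => by positivity)
  have hbd : ∀ i, ∃ A : ℝ, ∀ p y, |iteratedDeriv i (tm v p) y| ≤ A * ((1/2) ^ p.1 * (1/2) ^ p.2) := by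
    intro i
    obtain ⟨A, hA⟩ := hR i ((1/2) ^ (i + 1)) (by positivity)
    refine ⟨10000 ^ i * A, fun p y => ?_⟩
    have hK := Kp_one p
    rw [tm_iter hS, abs_mul, abs_mul, abs_of_pos (by positivity), abs_of_pos (by positivity)]
    have hA' := hA p.1 p.2 (Kp p * y - Kp p * Es p.1 p.2 0)
    calc _ ≤ 1 * (Kp p ^ i * |iteratedDeriv i (v p.1 p.2) (Kp p * y - Kp p * Es p.1 p.2 0)|) := by
          gcongr; exact inv_le_one_of_one_le₀ hK
      _ ≤ 1 * (Kp p ^ i * (A * ((1/2) ^ (i + 1)) ^ (p.1 + p.2))) := by gcongr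
      _ = 10000 ^ i * A * ((2 ^ i) ^ (p.1 + p.2) * ((1/2) ^ i) ^ (p.1 + p.2)) * ((1/2) ^ p.1 * (1/2) ^ p.2) := by
        rw [Kp, pow_succ (1/2:ℝ) i, mul_pow, mul_pow, ← pow_add, ← pow_mul 2, ← pow_mul 2]; ring
      _ = _ := by rw [← mul_pow, ← mul_pow]; norm_num
  choose A hA using hbd
  set V : ℝ → ℝ := fun y => ∑' p, tm v p y with hV
  have hVs : Sm V := by
    refine contDiff_tsum (N := ⊤) (v := fun i (p : ℕ × ℕ) => A i * ((1/2:ℝ) ^ p.1 * (1/2) ^ p.2)) hT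
      (fun i _ => hsum.mul_left (A i)) (fun i p y _ => ?_)
    rw [norm_iteratedFDeriv_eq_norm_iteratedDeriv, Real.norm_eq_abs]
    exact hA i p y
  have hnear : ∀ p y, 30 < |Kp p * y - Kp p * Es p.1 p.2 0| → tm v p y = 0 ∧ deriv (tm v p) y = 0 := by
    intro p y h
    have hc : Continuous fun y => |Kp p * y - Kp p * Es p.1 p.2 0| := by fun_prop
    have : tm v p =ᶠ[𝓝 y] fun _ => 0 := by
      filter_upwards [(isOpen_lt continuous_const hc).mem_nhds h] with z hz
      rw [tm, hs _ _ _ (le_of_lt hz), mul_zero]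
    exact ⟨this.eq_of_nhds, by rw [this.deriv_eq]; simp⟩
  have hder : ∀ y, deriv V y = ∑' p, deriv (tm v p) y := by
    intro y
    refine deriv_tsum_apply (y₀ := y) (hsum.mul_left (A 1)) (fun p => (hT p).diff) (fun p y => ?_) ?_ y
    · rw [Real.norm_eq_abs, ← iteratedDeriv_one]; exact hA 1 p y
    · refine Summable.of_norm_bounded (hsum.mul_left (A 0)) fun p => ?_
      simpa using hA 0 p y
  have hoff : ∀ y, (∀ n j x, |x| ≤ 30 → y ≠ Es n j x) → V y = 0 ∧ deriv V y = 0 := by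
    intro y hy
    have : ∀ p, tm v p y = 0 ∧ deriv (tm v p) y = 0 := fun p => hnear p y (by
      by_contra h; exact hy p.1 p.2 _ (not_lt.1 h) (Es_Kp p y))
    exact ⟨by rw [hV]; simp [this], by rw [hder]; simp [this]⟩
  have hon : ∀ n j x, |x| ≤ 30 → V (Es n j x) = (Kp (n, j))⁻¹ * v n j x ∧ deriv V (Es n j x) = deriv (v n j) x := by
    intro n j x hx
    have h0 : ∀ p, p ≠ (n, j) → tm v p (Es n j x) = 0 ∧ deriv (tm v p) (Es n j x) = 0 := by
      intro p hp
      apply hnear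
      by_contra h
      obtain ⟨h1, h2, -⟩ := Es_disj hx (not_lt.1 h) (Es_Kp p (Es n j x))
      exact hp (Prod.ext h1.symm h2.symm)
    refine ⟨?_, ?_⟩
    · change ∑' p, tm v p (Es n j x) = _
      rw [tsum_eq_single (n, j) (fun p hp => (h0 p hp).1), tm, Kp_Es (n, j)]
    · rw [hder, tsum_eq_single (n, j) (fun p hp => (h0 p hp).2), ← iteratedDeriv_one, tm_iter hS, Kp_Es (n, j)]
      have := Kp_one (n, j)
      rw [iteratedDeriv_one]; field_simp
  have hcase : ∀ y, (∃ n j x, |x| ≤ 30 ∧ y = Es n j x) ∨ ∀ n j x, |x| ≤ 30 → y ≠ Es n j x := by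
    intro y; by_contra! h
    obtain ⟨h1, n, j, x, h2, h3⟩ := h
    exact h1 n j x h2 h3
  have hd : ∀ y, |deriv V y| ≤ 1 / 2 := by
    intro y
    rcases hcase y with ⟨n, j, x, hx, rfl⟩ | h
    · rw [(hon n j x hx).2]; exact (hG n j).2 x
    · rw [(hoff y h).2]; norm_num
  have hb : ∀ y, |V y| ≤ 1 := by
    intro y
    rcases hcase y with ⟨n, j, x, hx, rfl⟩ | h
    · rw [(hon n j x hx).1, abs_mul]
      have := Kp_one (n, j)
      rw [abs_of_pos (by positivity)]
      exact mul_le_one₀ (inv_le_one_of_one_le₀ this) (abs_nonneg _) ((hG n j).1.b0 x)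
    · rw [(hoff y h).1]; norm_num
  have hGV : Gd V := ⟨⟨hVs, hb, fun i hi y => by
    obtain rfl : i = 0 := by omega
    simpa using (hd y).trans (by norm_num)⟩, hd⟩
  have hap := dP_apply hGV
  refine ⟨dP V, ⟨V, hVs, fun y hy => (hoff y ?_).1, fun y => ?_, hap⟩, fun n j x hx => ?_, fun n j x hx => ?_, fun y hy => ?_⟩
  · rintro n j x hx rfl
    have := Es_bd n j hx
    rw [abs_of_pos this.1] at hy; linarith
  · have := abs_le.1 (hd y); linarith
  · rw [dP_apply (hG n j), hs n j x hx, add_zero]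
  · rw [hap, (hon n j x hx).1, dP_apply (hG n j), Es_eq (n, j), Es_eq (n, j) (x + _)]; ring
  · rw [hap, (hoff y hy).1, add_zero]

lemma perm_fix {a : Equiv.Perm ℝ} {c : ℝ} (h : ∀ x, c ≤ |x| → a x = x) {x : ℝ} (hx : |x| ≤ c) : |a x| ≤ c := by
  by_contra hc
  have := a.injective (h (a x) (not_le.1 hc).le)
  rw [this] at hc; exact hc hx

namespace IsPhi
variable {a b : ℕ → ℕ → Equiv.Perm ℝ} {g h : Equiv.Perm ℝ}

lemma mul (hg : IsPhi a g) (hh : IsPhi b h) : IsPhi (fun n j => a n j * b n j) (g * h) :=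
  ⟨fun n j x hx => by simp [hh.1 n j x hx, hg.1 n j x hx], fun n j x hx => by
    simp only [Equiv.Perm.mul_apply]
    rw [hh.2.1 n j x hx, hg.2.1 n j _ (perm_fix (hh.1 n j) hx)], fun y hy => by
    simp only [Equiv.Perm.mul_apply]
    rw [hh.2.2 y hy, hg.2.2 y hy]⟩

lemma inv (hg : IsPhi a g) : IsPhi (fun n j => (a n j)⁻¹) g⁻¹ := by
  have h1 : ∀ n j x, 30 ≤ |x| → (a n j)⁻¹ x = x := fun n j x hx => by
    rw [Equiv.Perm.inv_eq_iff_eq, hg.1 n j x hx]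
  refine ⟨h1, fun n j x hx => ?_, fun y hy => ?_⟩
  · rw [Equiv.Perm.inv_eq_iff_eq, hg.2.1 n j _ (perm_fix (h1 n j) hx)]
    rw [Equiv.Perm.inv_def, Equiv.apply_symm_apply]
  · rw [Equiv.Perm.inv_eq_iff_eq, hg.2.2 y hy]

lemma unique (hg : IsPhi a g) (hh : IsPhi a h) : g = h := by
  ext y
  by_cases hy : ∀ n j x, |x| ≤ 30 → y ≠ Es n j x
  · rw [hg.2.2 y hy, hh.2.2 y hy]
  · push Not at hy
    obtain ⟨n, j, x, hx, rfl⟩ := hy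
    rw [hg.2.1 n j x hx, hh.2.1 n j x hx]

/-- conjugation, forward -/
lemma conj (hg : IsPhi a g) (c : Equiv.Perm ℝ) (s : ℕ → ℕ → ℕ × ℕ)
    (hc : ∀ n j x, |x| ≤ 30 → c (Es n j x) = Es (s n j).1 (s n j).2 x)
    (ha : ∀ m k, (∀ n j, (m, k) ≠ s n j) → a m k = 1) :
    IsPhi (fun n j => a (s n j).1 (s n j).2) (c⁻¹ * g * c) := by
  refine ⟨fun n j x hx => hg.1 _ _ _ hx, fun n j x hx => ?_, fun y hy => ?_⟩
  · simp only [Equiv.Perm.mul_apply]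
    rw [hc n j x hx, hg.2.1 _ _ _ hx, Equiv.Perm.inv_eq_iff_eq, hc _ _ _ (perm_fix (hg.1 _ _) hx)]
  · simp only [Equiv.Perm.mul_apply]
    rw [Equiv.Perm.inv_eq_iff_eq]
    by_cases h : ∀ n j x, |x| ≤ 30 → c y ≠ Es n j x
    · exact hg.2.2 _ h
    · push Not at h
      obtain ⟨m, k, x, hx, h⟩ := h
      rw [h, hg.2.1 m k x hx, ha m k]
      · rfl
      · intro n j e
        have e1 : m = (s n j).1 := by rw [← e]
        have e2 : k = (s n j).2 := by rw [← e]
        refine hy n j x hx (c.injective ?_)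
        rw [h, hc n j x hx, e1, e2]

/-- conjugation, backward -/
lemma conj' (hg : IsPhi a g) (c : Equiv.Perm ℝ) (s : ℕ → ℕ → ℕ × ℕ)
    (hc : ∀ n j x, |x| ≤ 30 → c (Es n j x) = Es (s n j).1 (s n j).2 x)
    (hb1 : ∀ n j, b (s n j).1 (s n j).2 = a n j)
    (hb : ∀ m k, (∀ n j, (m, k) ≠ s n j) → b m k = 1) : IsPhi b (c * g * c⁻¹) := by
  have key : ∀ m k, b m k = 1 ∨ ∃ n j, (m, k) = s n j := by
    intro m k
    by_cases h : ∀ n j, (m, k) ≠ s n j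
    · exact Or.inl (hb m k h)
    · push Not at h; exact Or.inr h
  refine ⟨fun m k x hx => ?_, fun m k x hx => ?_, fun y hy => ?_⟩
  · rcases key m k with h | ⟨n, j, h⟩
    · rw [h]; rfl
    · have := hb1 n j; rw [← h] at this; simp only at this; rw [this]; exact hg.1 n j x hx
  · simp only [Equiv.Perm.mul_apply]
    by_cases h : ∀ n j, (m, k) ≠ s n j
    · rw [hb m k h, hg.2.2, Equiv.Perm.inv_def, Equiv.apply_symm_apply]
      · rfl
      · intro n j x' hx' e
        rw [Equiv.Perm.inv_eq_iff_eq, hc n j x' hx'] at e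
        obtain ⟨e1, e2, -⟩ := Es_disj hx hx' e
        exact h n j (Prod.ext e1 e2)
    · push Not at h
      obtain ⟨n, j, h⟩ := h
      have := hb1 n j; have hc' := hc n j; rw [← h] at this hc'; simp only at this hc'
      rw [this, ← hc' x hx, Equiv.Perm.inv_def, Equiv.symm_apply_apply, hg.2.1 n j x hx, hc' _ (perm_fix (hg.1 _ _) hx)]
  · simp only [Equiv.Perm.mul_apply]
    rw [hg.2.2, Equiv.Perm.inv_def, Equiv.apply_symm_apply]
    intro n j x hx e
    rw [Equiv.Perm.inv_eq_iff_eq, hc n j x hx] at e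
    exact hy _ _ _ hx e

end IsPhi

/-- words -/
inductive Wd {G : Type} [Group G] (S : Set G) : ℕ → G → Prop
  | one (n : ℕ) : Wd S n 1
  | mul {n : ℕ} {s g : G} : s ∈ S → Wd S n g → Wd S (n + 1) (s * g)
  | inv {n : ℕ} {s g : G} : s ∈ S → Wd S n g → Wd S (n + 1) (s⁻¹ * g)

namespace Wd
variable {G : Type} [Group G] {S S' : Set G} {n m : ℕ} {g h : G}

lemma mono (H : Wd S n g) (hS : S ⊆ S') (hm : n ≤ m) : Wd S' m g := by
  induction H generalizing m with
  | one n => exact .one _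
  | mul hs _ ih =>
    obtain ⟨d, rfl⟩ := Nat.exists_eq_add_of_le' hm
    exact .mul (hS hs) (ih (m := d + _) (by omega))
  | inv hs _ ih =>
    obtain ⟨d, rfl⟩ := Nat.exists_eq_add_of_le' hm
    exact .inv (hS hs) (ih (m := d + _) (by omega))

lemma mul' (H : Wd S n g) (H' : Wd S m h) : Wd S (n + m) (g * h) := by
  induction H with
  | one n => rw [one_mul]; exact H'.mono le_rfl (by omega)
  | mul hs _ ih => rw [mul_assoc, add_right_comm]; exact .mul hs ih
  | inv hs _ ih => rw [mul_assoc, add_right_comm]; exact .inv hs ih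

lemma of_mem (hg : g ∈ S) : Wd S 1 g := by simpa using Wd.mul hg (Wd.one (S := S) 0)

lemma inv' (H : Wd S n g) : Wd S n g⁻¹ := by
  induction H with
  | one n => rw [inv_one]; exact .one _
  | mul hs _ ih => rw [mul_inv_rev]; exact ih.mul' (by simpa using Wd.inv hs (Wd.one (S := S) 0))
  | inv hs _ ih => rw [mul_inv_rev, inv_inv]; exact ih.mul' (.of_mem hs)

lemma pow (H : Wd S n g) (k : ℕ) : Wd S (k * n) (g ^ k) := by
  induction k with
  | zero => rw [pow_zero]; exact .one _
  | succ k ih => rw [pow_succ, add_mul, one_mul]; exact ih.mul' H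

lemma conj' (H : Wd S n g) (H' : Wd S m h) : Wd S (m + n + m) (h⁻¹ * g * h) := (H'.inv'.mul' H).mul' H'
lemma conj (H : Wd S n g) (H' : Wd S m h) : Wd S (m + n + m) (h * g * h⁻¹) := (H'.mul' H).mul' H'.inv'
end Wd

def hW {G : Type} [Group G] (Mn H P F T t : G) : G :=
  (((Mn ^ 2)⁻¹ * P * Mn ^ 2))⁻¹ * (Mn⁻¹ * H * Mn) * (t * ((Mn ^ 3)⁻¹ * F * Mn ^ 3) * t⁻¹ * ((Mn ^ 3)⁻¹ * F * Mn ^ 3)⁻¹) *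
    (T * ((Mn ^ 2)⁻¹ * P * Mn ^ 2) * T⁻¹)

def bigW {G : Type} [Group G] (n : ℕ) (σ Mn H P F T t : G) : G :=
  (Mn ^ (4 * n) * σ ^ n)⁻¹ * ((Mn⁻¹ * H * Mn) * (Mn ^ 4 * (hW Mn H P F T t)⁻¹ * (Mn ^ 4)⁻¹)) * (Mn ^ (4 * n) * σ ^ n)

lemma bigW_len (n : ℕ) : ∃ L : ℕ, ∀ {G : Type} [Group G] (S : Set G) (σ M H P F T t : G), σ ∈ S → M ∈ S →
    H ∈ S → P ∈ S → F ∈ S → T ∈ S → t ∈ S → Wd S L (bigW n σ (σ ^ n * M * (σ ^ n)⁻¹) H P F T t) := by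
  refine ⟨?L, ?_⟩
  rotate_left
  · intro G _ S σ M H P F T t h1 h2 h3 h4 h5 h6 h7
    have hs := (Wd.of_mem h1).pow n
    have hM := (Wd.of_mem h2).conj hs
    have hX := (Wd.of_mem h3).conj' hM
    have hY := (Wd.of_mem h4).conj' (hM.pow 2)
    have hZ := (Wd.of_mem h5).conj' (hM.pow 3)
    have hh := ((hY.inv'.mul' hX).mul' ((hZ.conj (.of_mem h7)).mul' hZ.inv')).mul' (hY.conj (.of_mem h6))
    exact (hX.mul' (hh.inv'.conj (hM.pow 4))).conj' ((hM.pow (4 * n)).mul' hs)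

/-- placing a family on the track of residue `r` -/
def tr {α : Type} (z : α) (r : ℕ) (v : ℕ → ℕ → α) (m j : ℕ) : α :=
  if j % 4 = r ∧ m ≤ j / 4 then v m (j / 4 - m) else z

lemma Rp.tr {v : ℕ → ℕ → ℝ → ℝ} (hR : Rp v) (r : ℕ) : Rp (tr (fun _ => 0) r v) := by
  intro i b hb
  set c := min b 1 with hc
  have hc0 : 0 < c := lt_min hb one_pos
  obtain ⟨A, hA⟩ := hR i (c ^ 5) (by positivity)
  refine ⟨|A| * (c ^ 3)⁻¹, fun m j x => ?_⟩
  have hcb : c ^ (m + j) ≤ b ^ (m + j) := by gcongr; exact min_le_left _ _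
  rw [_root_.tr]
  split_ifs with h
  · have h1 : (c ^ 5) ^ (m + (j / 4 - m)) * c ^ 3 ≤ c ^ (m + j) := by
      rw [← pow_mul, ← pow_add]
      exact pow_le_pow_of_le_one hc0.le (min_le_right _ _) (by omega)
    calc _ ≤ A * (c ^ 5) ^ (m + (j / 4 - m)) := hA _ _ x
      _ ≤ |A| * (c ^ 5) ^ (m + (j / 4 - m)) := by gcongr; exact le_abs_self _
      _ = |A| * (c ^ 3)⁻¹ * ((c ^ 5) ^ (m + (j / 4 - m)) * c ^ 3) := by field_simp
      _ ≤ |A| * (c ^ 3)⁻¹ * b ^ (m + j) := by gcongr; exact h1.trans hcb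
  · have : iteratedDeriv i (fun _ : ℝ => (0:ℝ)) x = 0 := by simp [iteratedDeriv_const]
    rw [this, abs_zero]; positivity

lemma gd_zero : Gd (fun _ => 0) := ⟨⟨contDiff_const, fun x => by simp, fun j hj x => by
  have : deriv (fun _ : ℝ => (0:ℝ)) = fun _ => 0 := by ext; simp
  rw [this]; simp [iteratedDeriv_const]⟩, fun x => by simp⟩

lemma dP_zero : dP (fun _ => 0) = 1 := by ext x; rw [dP_apply gd_zero]; simp

lemma exists_track {v : ℕ → ℕ → ℝ → ℝ} (hG : ∀ n j, Gd (v n j)) (hs : ∀ n j x, 30 ≤ |x| → v n j x = 0)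
    (hR : Rp v) (r : ℕ) : ∃ g, Dc g ∧ IsPhi (tr 1 r (fun n j => dP (v n j))) g := by
  obtain ⟨g, h1, h2⟩ := exists_phi (v := tr (fun _ => 0) r v) (fun n j => by rw [tr]; split_ifs; exacts [hG _ _, gd_zero])
    (fun n j x hx => by rw [tr]; split_ifs; exacts [hs _ _ x hx, rfl]) (hR.tr r)
  refine ⟨g, h1, ?_⟩
  convert h2 using 3 with n j
  rw [tr, tr]; split_ifs; exacts [rfl, dP_zero.symm]

section
variable {σ Mn H P F T t : Equiv.Perm ℝ} {u w f Tf tf : ℕ → ℕ → Equiv.Perm ℝ} {n : ℕ}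

lemma Mn_pow (hM : ∀ m j x, |x| ≤ 30 → Mn (Es m j x) = Es m (if m = n then j + 1 else j) x) (p : ℕ) :
    ∀ m j x, |x| ≤ 30 → (Mn ^ p) (Es m j x) = Es m (if m = n then j + p else j) x := by
  induction p with
  | zero => intro m j x hx; simp
  | succ p ih =>
    intro m j x hx
    rw [pow_succ', Equiv.Perm.mul_apply, ih m j x hx, hM _ _ _ hx]
    split_ifs <;> rfl

lemma track_conj {r p : ℕ} (hpr : p ≤ r) (hr : r < 4) {a : ℕ → ℕ → Equiv.Perm ℝ} (hH : IsPhi (tr 1 r a) H)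
    (hM : ∀ m j x, |x| ≤ 30 → Mn (Es m j x) = Es m (if m = n then j + 1 else j) x) :
    IsPhi (fun m j => tr 1 r a m (if m = n then j + p else j)) ((Mn ^ p)⁻¹ * H * Mn ^ p) := by
  refine hH.conj (Mn ^ p) (fun m j => (m, if m = n then j + p else j)) (Mn_pow hM p) fun m k h => ?_
  rw [tr, if_neg]
  rintro ⟨h1, h2⟩
  by_cases hm : m = n
  · refine h m (k - p) ?_
    rw [if_pos hm, Nat.sub_add_cancel]
    have := Nat.mod_le k 4
    omega
  · exact h m k (by rw [if_neg hm])

theorem swindle_alg (hσ : ∀ m j x, |x| ≤ 30 → σ (Es m j x) = Es (m + 1) j x)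
    (hM : ∀ m j x, |x| ≤ 30 → Mn (Es m j x) = Es m (if m = n then j + 1 else j) x)
    (hH : IsPhi (tr 1 1 u) H) (hP : IsPhi (tr 1 2 w) P) (hF : IsPhi (tr 1 3 f) F) (hT : IsPhi (tr 1 0 Tf) T)
    (ht : IsPhi (tr 1 0 tf) t)
    (hrel : ∀ m j, u m j * (tf m j * f m j * (tf m j)⁻¹ * (f m j)⁻¹) * Tf m j = w m j * u m (j + 1) * Tf m j * (w m j)⁻¹) :
    IsPhi (fun m j => if m = 0 ∧ j = 0 then u n 0 else 1) (bigW n σ Mn H P F T t) := by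
  have hX := track_conj (p := 1) le_rfl (by norm_num) hH hM
  have hY := track_conj (p := 2) le_rfl (by norm_num) hP hM
  have hZ := track_conj (p := 3) le_rfl (by norm_num) hF hM
  rw [pow_one] at hX
  have hh := ((hY.inv.mul hX).mul ((ht.mul hZ).mul ht.inv |>.mul hZ.inv)).mul ((hT.mul hY).mul hT.inv)
  have hh' : IsPhi (fun m j => if m = n then (if j % 4 = 0 ∧ n ≤ j / 4 then u n (j / 4 - n + 1) else 1) else tr 1 1 u m j)
      (hW Mn H P F T t) := by
    convert hh using 3 with m j
    by_cases hm : m = n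
    · subst hm
      simp only [if_true]
      by_cases hj : j % 4 = 0 ∧ m ≤ j / 4
      · rw [if_pos hj]
        obtain ⟨hj1, hj2⟩ := hj
        rw [tr, tr, tr, tr, tr, if_pos (by omega), if_pos (by omega), if_pos (by omega), if_pos (by omega), if_pos (by omega)]
        rw [show (j + 2) / 4 = j / 4 by omega, show (j + 1) / 4 = j / 4 by omega, show (j + 3) / 4 = j / 4 by omega]
        have := hrel m (j / 4 - m)
        set k := j / 4 - m
        have e : u m (k + 1) = (w m k)⁻¹ * (w m k * u m (k + 1) * Tf m k * (w m k)⁻¹) * (w m k) * (Tf m k)⁻¹ := by group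
        rw [e, ← this]; group
      · rw [if_neg hj, tr, tr, tr, tr, tr, if_neg (by omega), if_neg (by omega), if_neg (by omega), if_neg (by omega), if_neg (by omega)]
        simp
    · simp only [if_neg hm]
      have h4 : j % 4 < 4 := Nat.mod_lt _ (by norm_num)
      unfold tr
      by_cases hmj : m ≤ j / 4 <;> interval_cases h : j % 4 <;> simp [hmj]
    rfl
  have hb := hh'.inv.conj' (Mn ^ 4) (fun m j => (m, if m = n then j + 4 else j)) (Mn_pow hM 4)
    (b := fun m j => if m = n then (if j < 4 then 1 else if (j - 4) % 4 = 0 ∧ n ≤ (j - 4) / 4 then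
      (u n ((j - 4) / 4 - n + 1))⁻¹ else 1) else (tr 1 1 u m j)⁻¹) (by
      intro m j
      by_cases hm : m = n
      · simp only [if_pos hm]
        rw [if_neg (by omega), show j + 4 - 4 = j by omega]
        split_ifs <;> simp
      · simp only [if_neg hm]) (by
      intro m k h
      by_cases hm : m = n
      · simp only [if_pos hm]
        rw [if_pos]
        by_contra hk
        exact h m (k - 4) (by rw [if_pos hm, Nat.sub_add_cancel (by omega)])
      · exact absurd rfl (h m k |> fun h => by rwa [if_neg hm] at h))
  have hd : IsPhi (fun m j => if m = n ∧ j = 4 * n then u n 0 else 1)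
      ((Mn⁻¹ * H * Mn) * (Mn ^ 4 * (hW Mn H P F T t)⁻¹ * (Mn ^ 4)⁻¹)) := by
    convert hX.mul hb using 3 with m j
    by_cases hm : m = n
    · subst hm
      simp only [if_true, true_and]
      rw [tr]
      rcases eq_or_ne (j % 4) 0 with hj | hj
      · obtain ⟨k, rfl⟩ := Nat.dvd_of_mod_eq_zero hj
        rw [show (4 * k + 1) / 4 = k by omega, show (4 * k - 4) / 4 = k - 1 by omega]
        rcases lt_trichotomy k m with h | h | h
        · rw [if_neg (by omega), if_neg (by omega)]
          split_ifs
          · simp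
          · omega
          · simp
        · subst h
          rw [if_pos rfl, if_pos (by omega), Nat.sub_self]
          split_ifs
          · simp
          · omega
          · simp
        · rw [if_neg (by omega), if_pos (by omega), if_neg (by omega), if_pos (by omega),
            show k - 1 - m + 1 = k - m by omega]
          simp
      · rw [if_neg (by omega), if_neg (by omega)]
        split_ifs
        · simp
        · omega
        · simp
    · simp [hm]
  have hσn : ∀ k m j x, |x| ≤ 30 → (σ ^ k) (Es m j x) = Es (m + k) j x := by
    intro k
    induction k with
    | zero => intros; simp
    | succ k ih => intro n j x hx; rw [pow_succ', Equiv.Perm.mul_apply, ih n j x hx, hσ _ _ _ hx]; rfl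
  have hfin := hd.conj (Mn ^ (4 * n) * σ ^ n) (fun m j => (m + n, if m + n = n then j + 4 * n else j))
    (fun m j x hx => by rw [Equiv.Perm.mul_apply, hσn _ _ _ _ hx, Mn_pow hM _ _ _ _ hx]) (fun m k h => by
      rw [if_neg]
      rintro ⟨rfl, rfl⟩
      exact h 0 0 (by simp))
  convert hfin using 3 with m j
  by_cases hm : m = 0 <;> simp [hm]
  rfl
end

/-- the swindle on the line -/
theorem swindle : ∃ (ε : ℕ → ℝ), (∀ n, 0 < ε n) ∧
    ∀ u : ℕ → ℝ → ℝ, (∀ n, Sm (u n)) → (∀ n x, x ∉ Ioo (0:ℝ) 1 → u n x = 0) →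
      (∀ n, ∀ i ≤ n + 25, ∀ x, |iteratedDeriv i (u n) x| ≤ ε n) →
    ∃ σ M H P F T t : Equiv.Perm ℝ, Dc σ ∧ Dc M ∧ Dc H ∧ Dc P ∧ Dc F ∧ Dc T ∧ Dc t ∧ ∀ n, Gd (u n) ∧
      IsPhi (fun m j => if m = 0 ∧ j = 0 then dP (u n) else 1) (bigW n σ (σ ^ n * M * (σ ^ n)⁻¹) H P F T t) := by
  obtain ⟨t, ε, hε, hTt, hR1, hR2, hu⟩ := iter
  obtain ⟨σ, M, hσd, hMd, hσ, hM⟩ := shifts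
  refine ⟨ε, hε, fun u h1 h2 h3 => ?_⟩
  obtain ⟨U, W, c, hU0, hrel, hUs, hWs, hGd, rU, rW, rc⟩ := hu u h1 h2 h3
  obtain ⟨H, hHd, hH⟩ := exists_track (fun n j => (hGd n j).1) (fun n j x hx => hUs n j x (fun h => by
    rw [le_abs] at hx; rcases hx with hx | hx <;> linarith [h.1, h.2])) rU 1
  obtain ⟨P, hPd, hP⟩ := exists_track (fun n j => (hGd n j).2.1) (fun n j x hx => hWs n j x (fun h => by
    rw [le_abs] at hx; rcases hx with hx | hx <;> linarith [h.1, h.2])) rW 2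
  obtain ⟨F, hFd, hF⟩ := exists_track (fun n j => (hGd n j).2.2) (fun n j x hx => by
    rw [Fc, bs, bt_zero, mul_zero]
    rw [le_abs] at hx ⊢; rcases hx with hx | hx
    · left; linarith
    · right; linarith) rc 3
  obtain ⟨T, hTd, hT⟩ := exists_track (v := fun n j => TD (t (n + j))) (fun n j => (hTt _).1)
    (fun n j x hx => by rw [TD, zt_zero hx, mul_zero]) hR1 0
  obtain ⟨τ, htd, ht⟩ := exists_track (v := fun n j => tD (t (n + j))) (fun n j => (hTt _).2)
    (fun n j x hx => by rw [tD, ta, zt_zero hx]; ring) hR2 0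
  refine ⟨σ, M, H, P, F, T, τ, hσd, hMd, hHd, hPd, hFd, hTd, htd, fun n => ⟨?_, ?_⟩⟩
  · rw [← hU0]; exact (hGd n 0).1
  have := swindle_alg (n := n) hσ (hM n) hH hP hF hT ht (fun m j => hrel m j)
  rwa [hU0] at this


lemma per_bdd {p : ℝ → ℝ} (hp : Continuous p) (h : ∀ x, p (x + 1) = p x) : ∃ C, ∀ x, |p x| ≤ C := by
  obtain ⟨C, hC⟩ := (isCompact_Icc (a := (0:ℝ)) (b := 1)).exists_bound_of_continuousOn hp.continuousOn
  refine ⟨C, fun x => ?_⟩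
  obtain ⟨y, hy, e⟩ := (show Function.Periodic p 1 from h).exists_mem_Ico₀ one_pos x
  rw [e]; exact hC y ⟨hy.1, hy.2.le⟩

lemma per_iter {p : ℝ → ℝ} (h : ∀ x, p (x + 1) = p x) (j : ℕ) (x : ℝ) :
    iteratedDeriv j p (x + 1) = iteratedDeriv j p x := by
  have := congrFun (iteratedDeriv_comp_add_const j p 1) x
  rw [← this]; congr 1; ext y; exact h y

lemma per_BD {p : ℝ → ℝ} (hp : Sm p) (h : ∀ x, p (x + 1) = p x) (r : ℕ) : ∃ C, 0 ≤ C ∧ BD p C 1 r := by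
  choose C hC using fun j => per_bdd (hp.iter j).continuous (per_iter h j)
  refine ⟨∑ j ∈ Finset.range (r + 2), |C j|, by positivity, BD.of_iter hp fun i hi x => ?_⟩
  refine ((hC i x).trans (le_abs_self _)).trans ?_
  exact Finset.single_le_sum (f := fun j => |C j|) (fun _ _ => abs_nonneg _) (by simp; omega)

lemma per_deriv_ge {F : ℝ → ℝ} (hF : Sm F) (h : ∀ x, F (x + 1) = F x + 1) (hp : ∀ x, 0 < deriv F x) :
    ∃ c, 0 < c ∧ ∀ x, c ≤ deriv F x := by
  obtain ⟨z, -, hz⟩ := (isCompact_Icc (a := (0:ℝ)) (b := 1)).exists_isMinOn ⟨0, by simp⟩ hF.deriv.continuous.continuousOn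
  refine ⟨deriv F z, hp z, fun x => ?_⟩
  have : Function.Periodic (deriv F) 1 := fun x => by
    rw [← deriv_comp_add_const, show (fun y => F (y + 1)) = fun y => F y + 1 from funext h, deriv_add_const]
  obtain ⟨y, hy, e⟩ := this.exists_mem_Ico₀ one_pos x
  rw [e]; exact hz ⟨hy.1, hy.2.le⟩

lemma lift_surj {F : ℝ → ℝ} (hF : Continuous F) (h : ∀ x, F (x + 1) = F x + 1) : Function.Surjective F := by
  obtain ⟨C, hC⟩ := per_bdd (p := fun x => F x - x) (by fun_prop) (fun x => by rw [h]; ring)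
  have := surj_of_bdd (u := fun x => F x - x) (by fun_prop) C hC
  convert this using 2; ring

lemma lift_inv {F : ℝ → ℝ} (hF : Sm F) (h : ∀ x, F (x + 1) = F x + 1) (hp : ∀ x, 0 < deriv F x) :
    ∃ G, Sm G ∧ (∀ x, F (G x) = x) ∧ (∀ x, G (F x) = x) ∧ (∀ x, G (x + 1) = G x + 1) ∧ ∀ x, 0 < deriv G x := by
  obtain ⟨G, hG, h1, h2⟩ := exists_inv hF hp (lift_surj hF.continuous h)
  refine ⟨G, hG, h1, h2, fun x => ?_, fun x => ?_⟩
  · rw [← h2 (G x + 1), h, h1]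
  · rw [deriv_inv_fun hF hG h1]; exact inv_pos.2 (hp _)

lemma exists_lift {F : ℝ → ℝ} (hF : Sm F) (h : ∀ x, F (x + 1) = F x + 1) (hp : ∀ x, 0 < deriv F x) :
    ∃ g : Equiv.Perm S1, IsLift g F := by
  obtain ⟨G, hG, h1, h2, h3, -⟩ := lift_inv hF h hp
  have e : ∀ x : ℝ, ((x + 1 : ℝ) : S1) = (x : S1) := fun x => AddCircle.coe_add_period 1 x
  have pF : Function.Periodic (fun x => ((F x : ℝ) : S1)) 1 := fun x => by simp only [h, e]
  have pG : Function.Periodic (fun x => ((G x : ℝ) : S1)) 1 := fun x => by simp only [h3, e]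
  refine ⟨⟨pF.lift, pG.lift, fun z => ?_, fun z => ?_⟩, hF, h, hp, fun x => rfl⟩
  · obtain ⟨x, rfl⟩ := QuotientAddGroup.mk_surjective z
    change ((G (F x) : ℝ) : S1) = _
    rw [h2]
  · obtain ⟨x, rfl⟩ := QuotientAddGroup.mk_surjective z
    change ((F (G x) : ℝ) : S1) = _
    rw [h1]

lemma IsLift.inj {f g : Equiv.Perm S1} {F : ℝ → ℝ} (hf : IsLift f F) (hg : IsLift g F) : f = g := by
  ext z
  obtain ⟨x, rfl⟩ := QuotientAddGroup.mk_surjective z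
  exact (hf.2.2.2 x).trans (hg.2.2.2 x).symm

lemma IsLift.mul {f g : Equiv.Perm S1} {F G : ℝ → ℝ} (hf : IsLift f F) (hg : IsLift g G) :
    IsLift (f * g) (fun x => F (G x)) := by
  refine ⟨Sm.cmp hf.1 hg.1, fun x => by simp only [hg.2.1, hf.2.1], fun x => ?_, fun x => ?_⟩
  · rw [deriv_comp' hf.1 hg.1]; exact mul_pos (hf.2.2.1 _) (hg.2.2.1 _)
  · rw [Equiv.Perm.mul_apply, hg.2.2.2, hf.2.2.2]

lemma IsLift.inv {f : Equiv.Perm S1} {F : ℝ → ℝ} (hf : IsLift f F) :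
    ∃ G, IsLift f⁻¹ G ∧ (∀ x, F (G x) = x) ∧ (∀ x, G (F x) = x) := by
  obtain ⟨G, hG, h1, h2, h3, h4⟩ := lift_inv hf.1 hf.2.1 hf.2.2.1
  refine ⟨G, ⟨hG, h3, h4, fun x => ?_⟩, h1, h2⟩
  rw [Equiv.Perm.inv_eq_iff_eq, hf.2.2.2, h1]

lemma isLift_rot (s : ℝ) : IsLift (rot (s : S1)) (fun x => x + s) := by
  refine ⟨by fun_prop, fun x => by ring, fun x => ?_, fun x => ?_⟩
  · rw [deriv_add_const]; simp
  · rfl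

lemma isLift_one : IsLift 1 (fun x => x) := ⟨contDiff_id, fun x => rfl, fun x => by simp, fun x => rfl⟩

/-- the group of smooth circle diffeomorphisms -/
def Df : Subgroup (Equiv.Perm S1) where
  carrier := {f | HasLift f}
  mul_mem' := fun ⟨F, hF⟩ ⟨G, hG⟩ => ⟨_, hF.mul hG⟩
  one_mem' := ⟨_, isLift_one⟩
  inv_mem' := fun ⟨F, hF⟩ => let ⟨G, hG, _⟩ := hF.inv; ⟨G, hG⟩

lemma rot_mem (s : ℝ) : rot (s : S1) ∈ Df := ⟨_, isLift_rot s⟩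

def per (V : ℝ → ℝ) (x : ℝ) : ℝ := V (x - round x)

lemma per_add_one (V : ℝ → ℝ) (x : ℝ) : per V (x + 1) = per V x := by
  rw [per, per, round_add_one]; push_cast; congr 1; ring

section
variable {V : ℝ → ℝ}
lemma per_loc (hs : ∀ y, 2/5 ≤ |y| → V y = 0) {x : ℝ} {k : ℤ} (h : |x - k| ≤ 3/5) : per V x = V (x - k) := by
  rw [per]
  have h1 := abs_sub_round x
  generalize round x = m at *
  rcases eq_or_ne m k with rfl | hk
  · rfl
  · have h2 : (1:ℝ) ≤ |(m:ℝ) - k| := by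
      exact_mod_cast Int.one_le_abs (sub_ne_zero.2 hk)
    have h3 : |(m:ℝ) - k| ≤ |x - k| + |x - m| := by
      rw [show (m:ℝ) - k = (x - k) - (x - m) by ring]; exact abs_sub _ _
    rw [hs _ (by linarith), hs _ (by linarith)]

lemma per_ev (hs : ∀ y, 2/5 ≤ |y| → V y = 0) (x : ℝ) : per V =ᶠ[𝓝 x] fun y => V (y - round x) := by
  have : ∀ᶠ y : ℝ in 𝓝 x, |y - (round x : ℝ)| < 3/5 := by
    refine ContinuousAt.eventually_lt (by fun_prop) (by fun_prop) ?_
    linarith [abs_sub_round x]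
  filter_upwards [this] with y hy
  exact per_loc hs hy.le

lemma per_sm (hs : ∀ y, 2/5 ≤ |y| → V y = 0) (hV : Sm V) : Sm (per V) := Sm.of_at fun x =>
  (ContDiffAt.congr_of_eventuallyEq ((hV.cmp (show ContDiff ℝ (⊤ : ℕ∞) _ by fun_prop)).contDiffAt) (per_ev hs x))

lemma per_deriv (hs : ∀ y, 2/5 ≤ |y| → V y = 0) (x : ℝ) : deriv (per V) x = deriv V (x - round x) := by
  rw [(per_ev hs x).deriv_eq, deriv_comp_sub_const]
end

/-- transfer relation -/
def Tr (P : Equiv.Perm ℝ) (g : Equiv.Perm S1) : Prop :=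
  (∀ x, 2/5 ≤ |x| → P x = x) ∧ ∀ x : ℝ, |x| ≤ 2 → g ((x / 4 : ℝ) : S1) = ((P x / 4 : ℝ) : S1)

lemma Tr.le {P : Equiv.Perm ℝ} {g : Equiv.Perm S1} (h : Tr P g) {x : ℝ} (hx : |x| ≤ 2) : |P x| ≤ 2 := by
  by_cases h2 : 2/5 ≤ |P x|
  · rwa [P.injective (h.1 _ h2)]
  · linarith

lemma exists_rep (z : S1) : ∃ x : ℝ, |x| ≤ 2 ∧ ((x / 4 : ℝ) : S1) = z := by
  obtain ⟨x, rfl⟩ := QuotientAddGroup.mk_surjective z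
  refine ⟨4 * (x - round x), ?_, ?_⟩
  · rw [abs_mul, abs_of_pos (by norm_num : (0:ℝ) < 4)]; linarith [abs_sub_round x]
  · rw [mul_div_cancel_left₀ _ (by norm_num : (4:ℝ) ≠ 0), sub_eq_add_neg, AddCircle.coe_add]
    have : ((-(round x : ℝ) : ℝ) : S1) = 0 := (AddCircle.coe_eq_zero_iff 1).2 ⟨-round x, by simp⟩
    rw [this, add_zero]

/-- the transfer group -/
def TrG : Subgroup (Equiv.Perm ℝ × Equiv.Perm S1) where
  carrier := {p | Tr p.1 p.2}
  mul_mem' := by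
    rintro ⟨P, g⟩ ⟨Q, h⟩ h1 h2
    refine ⟨fun x hx => ?_, fun x hx => ?_⟩
    · simp [h2.1 x hx, h1.1 x hx]
    · simp only [Prod.mk_mul_mk, Equiv.Perm.mul_apply]
      rw [h2.2 x hx, h1.2 _ (h2.le hx)]
  one_mem' := ⟨fun x hx => rfl, fun x hx => rfl⟩
  inv_mem' := by
    rintro ⟨P, g⟩ h
    refine ⟨fun x hx => ?_, fun x hx => ?_⟩
    · simp only [Prod.inv_mk]; rw [Equiv.Perm.inv_eq_iff_eq, h.1 x hx]
    · simp only [Prod.inv_mk]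
      obtain ⟨y, rfl⟩ := P.surjective x
      rw [Equiv.Perm.inv_eq_iff_eq, Equiv.Perm.inv_def, Equiv.symm_apply_apply, h.2]
      by_cases h2 : 2/5 ≤ |y|
      · rwa [h.1 _ h2] at hx
      · linarith

lemma Tr.unique {P : Equiv.Perm ℝ} {g h : Equiv.Perm S1} (hg : Tr P g) (hh : Tr P h) : g = h := by
  ext z
  obtain ⟨x, hx, rfl⟩ := exists_rep z
  rw [hg.2 x hx, hh.2 x hx]

lemma Dc.tr {P : Equiv.Perm ℝ} (h : Dc P) : ∃ g ∈ Df, Tr P g := by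
  obtain ⟨V, hV, hs, hp, hP⟩ := h
  set W : ℝ → ℝ := fun y => 1/4 * V (4 * y) with hW
  have hWs : ∀ y, 2/5 ≤ |y| → W y = 0 := fun y hy => by
    rw [hW]; simp only; rw [hs, mul_zero]
    rw [abs_mul, abs_of_pos (by norm_num : (0:ℝ) < 4)]; linarith
  have hWm : Sm W := contDiff_const.mul (hV.cmp (show ContDiff ℝ (⊤ : ℕ∞) _ by fun_prop))
  have hd : ∀ y, deriv W y = deriv V (4 * y) := fun y => by
    rw [hW, deriv_const_mul _ ((hV.cmp (show ContDiff ℝ (⊤ : ℕ∞) _ by fun_prop)).da y),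
      deriv_comp_mul_left]; simp
  obtain ⟨g, hg⟩ := exists_lift (F := fun x => x + per W x) (contDiff_id.add (per_sm hWs hWm))
    (fun x => by rw [per_add_one]; ring) (fun x => by
      rw [deriv_id_add (per_sm hWs hWm), per_deriv hWs, hd]; exact hp _)
  refine ⟨g, ⟨_, hg⟩, fun x hx => by rw [hP, hs x hx, add_zero], fun x hx => ?_⟩
  rw [hg.2.2.2, hP]; simp only; rw [per_loc hWs (k := 0) (by
    rw [abs_le] at *; simp; constructor <;> linarith [hx.1, hx.2])]
  simp only [hW]; congr 1; simp; ring_nf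


lemma map_bigW {G G' : Type} [Group G] [Group G'] (φ : G →* G') (n : ℕ) (σ M H P F T t : G) :
    φ (bigW n σ M H P F T t) = bigW n (φ σ) (φ M) (φ H) (φ P) (φ F) (φ T) (φ t) := by
  simp [bigW, hW]

lemma bigW_mem {G : Type} [Group G] (K : Subgroup G) {n : ℕ} {σ M H P F T t : G} (h1 : σ ∈ K) (h2 : M ∈ K) (h3 : H ∈ K)
    (h4 : P ∈ K) (h5 : F ∈ K) (h6 : T ∈ K) (h7 : t ∈ K) : bigW n σ M H P F T t ∈ K := by
  have e : bigW n σ M H P F T t = K.subtype (bigW n ⟨σ, h1⟩ ⟨M, h2⟩ ⟨H, h3⟩ ⟨P, h4⟩ ⟨F, h5⟩ ⟨T, h6⟩ ⟨t, h7⟩) := by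
    rw [map_bigW]; rfl
  rw [e]; exact Subtype.property _

lemma bigW_comm {G : Type} [Group G] {n : ℕ} {σ M H P F T t : G} (h1 : Commute M H) (h2 : Commute M P)
    (h3 : Commute M F) (h4 : Commute t F) (h5 : Commute T P) (h6 : Commute P H) : bigW n σ M H P F T t = 1 := by
  have c : ∀ {x y : G}, Commute x y → x⁻¹ * y * x = y := fun h => by rw [mul_assoc, ← h.eq]; group
  have c' : ∀ {x y : G}, Commute x y → x * y * x⁻¹ = y := fun h => by rw [h.eq]; group
  have e : hW M H P F T t = H := by
    rw [hW, c h1, c (h2.pow_left 2), c (h3.pow_left 3), c' h4, c' h5, mul_inv_cancel, mul_one, c h6]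
  rw [bigW, e, c h1, c' (h1.inv_right.pow_left 4)]; group

def rh : Df := ⟨rot ((1/2 : ℝ) : S1), rot_mem _⟩
abbrev NN : Subgroup Df := Subgroup.normalClosure {rh}

lemma tr_comm {P Q : Equiv.Perm ℝ} {a b : Df} (ha : Tr P a) (hb : Tr Q b) :
    Commute (QuotientGroup.mk' NN a) (QuotientGroup.mk' NN b) := by
  have hr : QuotientGroup.mk' NN rh = 1 := (QuotientGroup.eq_one_iff _).2 (Subgroup.subset_normalClosure rfl)
  have e : QuotientGroup.mk' NN a = QuotientGroup.mk' NN (rh * a * rh⁻¹) := by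
    rw [map_mul, map_mul, map_inv, hr]; simp
  rw [e]
  refine Commute.map ?_ _
  have hd : Equiv.Perm.Disjoint ((rh * a * rh⁻¹ : Df) : Equiv.Perm S1) b := by
    intro z
    obtain ⟨x, hx, rfl⟩ := exists_rep z
    by_cases h : 2/5 ≤ |x|
    · right; rw [hb.2 x hx, hb.1 x h]
    · left
      rw [not_le, abs_lt] at h
      have : ∃ w : ℝ, |w| ≤ 2 ∧ 2/5 ≤ |w| ∧ (rh : Equiv.Perm S1) ((w / 4 : ℝ) : S1) = ((x / 4 : ℝ) : S1) := by
        rcases le_total 0 x with h0 | h0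
        · refine ⟨x - 2, by rw [abs_le]; constructor <;> linarith, by rw [le_abs]; right; linarith, ?_⟩
          exact ((isLift_rot (1/2)).2.2.2 _).trans (by congr 1; ring)
        · refine ⟨x + 2, by rw [abs_le]; constructor <;> linarith, by rw [le_abs]; left; linarith, ?_⟩
          exact ((isLift_rot (1/2)).2.2.2 _).trans (by
            simp only; rw [show (x + 2) / 4 + 1 / 2 = x / 4 + 1 by ring]; exact AddCircle.coe_add_period 1 _)
      obtain ⟨w, w1, w2, w3⟩ := this
      simp only [Subgroup.coe_mul, Subgroup.coe_inv, Equiv.Perm.mul_apply]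
      rw [← w3, Equiv.Perm.inv_def, Equiv.symm_apply_apply, ha.2 w w1, ha.1 w w2]
  exact Subtype.ext hd.commute.eq

theorem swindleC : ∃ (ε : ℕ → ℝ) (L : ℕ → ℕ), (∀ n, 0 < ε n) ∧
    ∀ u : ℕ → ℝ → ℝ, (∀ n, Sm (u n)) → (∀ n x, x ∉ Ioo (0:ℝ) 1 → u n x = 0) →
      (∀ n, ∀ i ≤ n + 25, ∀ x, |iteratedDeriv i (u n) x| ≤ ε n) →
    ∃ S : Set Df, S.Finite ∧ ∀ n, Gd (u n) ∧ ∃ g, Wd S (L n) g ∧ g ∈ NN ∧ ∃ P, Tr P g ∧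
      IsPhi (fun m j => if m = 0 ∧ j = 0 then dP (u n) else 1) P := by
  obtain ⟨ε, hε, H⟩ := swindle
  choose L hL using bigW_len
  refine ⟨ε, L, hε, fun u h1 h2 h3 => ?_⟩
  obtain ⟨σ, M, H, P, F, T, t, d1, d2, d3, d4, d5, d6, d7, hu⟩ := H u h1 h2 h3
  obtain ⟨σ', m1, t1⟩ := d1.tr
  obtain ⟨M', m2, t2⟩ := d2.tr
  obtain ⟨H', m3, t3⟩ := d3.tr
  obtain ⟨P', m4, t4⟩ := d4.tr
  obtain ⟨F', m5, t5⟩ := d5.tr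
  obtain ⟨T', m6, t6⟩ := d6.tr
  obtain ⟨t', m7, t7⟩ := d7.tr
  refine ⟨{⟨σ', m1⟩, ⟨M', m2⟩, ⟨H', m3⟩, ⟨P', m4⟩, ⟨F', m5⟩, ⟨T', m6⟩, ⟨t', m7⟩}, by simp, fun n => ⟨(hu n).1, _,
    hL n _ ⟨σ', m1⟩ ⟨M', m2⟩ ⟨H', m3⟩ ⟨P', m4⟩ ⟨F', m5⟩ ⟨T', m6⟩ ⟨t', m7⟩ (by simp) (by simp) (by simp) (by simp)
      (by simp) (by simp) (by simp), ?_, _, ?_, (hu n).2⟩⟩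
  · rw [← QuotientGroup.eq_one_iff]
    change QuotientGroup.mk' NN _ = 1
    have tM : (σ ^ n * M * (σ ^ n)⁻¹, σ' ^ n * M' * (σ' ^ n)⁻¹) ∈ TrG := by
      have := mul_mem (mul_mem (pow_mem (show (σ, σ') ∈ TrG from t1) n) (show (M, M') ∈ TrG from t2))
        (inv_mem (pow_mem (show (σ, σ') ∈ TrG from t1) n))
      exact this
    rw [map_bigW]
    exact bigW_comm (tr_comm tM t3) (tr_comm tM t4) (tr_comm tM t5) (tr_comm t7 t5) (tr_comm t6 t4) (tr_comm t4 t3)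
  · rw [← Subgroup.subtype_apply, map_bigW]
    have t1' : (σ, σ') ∈ TrG := t1
    have := bigW_mem TrG (n := n) t1' (mul_mem (mul_mem (pow_mem t1' n) (show (M, M') ∈ TrG from t2))
        (inv_mem (pow_mem t1' n))) (show (H, H') ∈ TrG from t3) (show (P, P') ∈ TrG from t4)
        (show (F, F') ∈ TrG from t5) (show (T, T') ∈ TrG from t6) (show (t, t') ∈ TrG from t7)
    have h : ∀ p ∈ TrG, Tr (MonoidHom.fst (Equiv.Perm ℝ) (Equiv.Perm S1) p) (MonoidHom.snd (Equiv.Perm ℝ) (Equiv.Perm S1) p) :=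
      fun p hp => hp
    have h := h _ this
    rw [map_bigW, map_bigW] at h
    exact h


def bb (y : ℝ) : ℝ := bt (480000 * y)

lemma bb_zero {y : ℝ} (h : 1/160000 ≤ |y|) : bb y = 0 :=
  bt_zero (by rw [abs_mul, abs_of_pos (by norm_num : (0:ℝ) < 480000)]; linarith)

lemma bb_pos {y : ℝ} (h : |y| ≤ 1/320000) : 0 < bb y := by
  apply Real.smoothTransition.pos_of_pos
  have : y ^ 2 ≤ (1/320000) ^ 2 := by rw [← sq_abs y]; gcongr
  rw [mul_pow]; linarith

lemma exists_pou : ∃ (K : ℕ) (ρ : ℕ → ℝ → ℝ) (c : ℕ → ℝ), (∀ k, Sm (ρ k)) ∧ (∀ k x, ρ k (x + 1) = ρ k x) ∧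
    (∀ x, ∑ k ∈ Finset.range K, ρ k x = 1) ∧ ∀ k x, ρ k x ≠ 0 → ∃ m : ℤ, |x - c k - m| < 1/160000 := by
  obtain ⟨K, hK⟩ : ∃ K : ℕ, K = 160000 := ⟨_, rfl⟩
  have hK' : (K : ℝ) = 160000 := by exact_mod_cast hK
  have hs : ∀ y, 2/5 ≤ |y| → bb y = 0 := fun y hy => bb_zero (by linarith)
  have hbs : Sm bb := bt_cut.1.cmp (show ContDiff ℝ (⊤ : ℕ∞) _ by fun_prop)
  have hb := per_sm hs hbs
  have hb0 : ∀ x, 0 ≤ per bb x := fun x => Real.smoothTransition.nonneg _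
  set D : ℝ → ℝ := fun x => ∑ k ∈ Finset.range K, per bb (x - k / K) with hD
  have hpi : ∀ (x : ℝ) (q : ℤ), per bb (x + q) = per bb x := fun x q => by
    have : Function.Periodic (per bb) 1 := per_add_one bb
    simpa using this.int_mul q x
  have hDpos : ∀ x, 0 < D x := fun x => by
    refine Finset.sum_pos' (fun _ _ => hb0 _) ?_
    set m := round (K * x) with hm
    have hKz : (0:ℤ) < K := by rw [hK]; norm_num
    have e1 := Int.emod_nonneg m hKz.ne'
    have e2 := Int.emod_lt_of_pos m hKz
    have e3 := Int.emod_add_mul_ediv m K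
    have e4 := abs_sub_round (K * x)
    rw [← hm] at e4
    generalize m / (K:ℤ) = q at *
    generalize m % (K:ℤ) = k at *
    lift k to ℕ using e1
    refine ⟨k, by simpa using e2, ?_⟩
    have e5 : x - k / K = x - m / K + q := by
      rw [← e3]; push_cast; rw [hK']; ring
    have e6 : |x - m / K| ≤ 1/320000 := by
      rw [hK', abs_le] at *
      constructor <;> linarith [e4.1, e4.2]
    rw [e5, hpi, per_loc hs (k := 0) (by simp only [Int.cast_zero, sub_zero]; linarith)]
    simpa using bb_pos e6
  have hDs : Sm D := ContDiff.sum fun k _ => hb.cmp (show ContDiff ℝ (⊤ : ℕ∞) _ by fun_prop)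
  have hpp : ∀ (k : ℕ) x, per bb (x + 1 - k / K) = per bb (x - k / K) := fun k x => by
    rw [add_sub_right_comm, per_add_one]
  refine ⟨K, fun k x => per bb (x - k / K) / D x, fun k => k / K, fun k => ?_, fun k x => ?_, fun x => ?_, fun k x h => ?_⟩
  · exact ContDiff.div (hb.cmp (show ContDiff ℝ (⊤ : ℕ∞) _ by fun_prop)) hDs (fun x => (hDpos x).ne')
  · simp only [hD, hpp]
  · rw [← Finset.sum_div, div_self (hDpos x).ne']
  · refine ⟨round (x - k / K), ?_⟩
    by_contra hc
    exact h (by simp only; rw [per, bb_zero (not_lt.1 hc), zero_div])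

/-- chart function of a displacement `w` around `c` -/
def cu (w : ℝ → ℝ) (c x : ℝ) : ℝ := zt x * (40000 * w (c + (x - 1/2) / 40000))

/-- support condition -/
def Sc (w : ℝ → ℝ) (c : ℝ) : Prop := ∀ t : ℝ, |t| ≤ 9/10 → w (c + t) ≠ 0 → |t| < 1/80000

lemma frag1 {ρ χ : ℝ → ℝ} (hρ : Sm ρ) (pρ : ∀ x, ρ (x + 1) = ρ x) (hχ : Sm χ) (pχ : ∀ x, χ (x + 1) = χ x) (c : ℝ)
    (hsupp : ∀ x, ρ x ≠ 0 → ∃ m : ℤ, |x - c - m| < 1/160000) (r : ℕ) {ε : ℝ} (hε : 0 < ε) :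
    ∃ δ > 0, ∀ v : ℝ → ℝ, Sm v → Bd v δ 1 (r + 1) → (∀ x, 0 < 1 + deriv (fun x => χ x * v x) x) ∧
      ∀ G : ℝ → ℝ, Sm G → (∀ x, G x + χ (G x) * v (G x) = x) → ∀ w, (∀ x, w x = ρ (G x) * v (G x)) →
        Sc w c ∧ Sm (cu w c) ∧ (∀ x, x ∉ Ioo (0:ℝ) 1 → cu w c x = 0) ∧ Bd (cu w c) ε 1 r := by
  obtain ⟨A, hA, hA'⟩ := per_BD hρ pρ (r + 1)
  obtain ⟨B, hB, hB'⟩ := per_BD hχ pχ (r + 1)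
  obtain ⟨C, hC, hC'⟩ := Bd.comp_inv r (1/2) 2 (by norm_num) (by norm_num)
  obtain ⟨Z, hZ, hZ'⟩ := zt_cut.2 r
  have hZ' := (hZ' 1 le_rfl).bd le_rfl
  have hA' := hA'.bd le_rfl
  have hB' := hB'.bd le_rfl
  set E : ℝ := 2 ^ r * Z * (40000 * ((2 ^ r * 1) ^ r * (C * (2 ^ (r + 1) * A)))) with hE
  have hE0 : 0 ≤ E := by positivity
  refine ⟨min (1/160000/(2 ^ (r+1) * (B + 1))) (ε / (E + 1)), by positivity, fun v hv hb => ?_⟩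
  set δ := min (1/160000/(2 ^ (r+1) * (B + 1))) (ε / (E + 1)) with hδ
  have hδ0 : 0 < δ := by positivity
  have d1 : 2 ^ (r + 1) * B * δ ≤ 1/160000 := by
    calc _ ≤ 2 ^ (r + 1) * (B + 1) * (1/160000/(2 ^ (r+1) * (B + 1))) := by gcongr; linarith; exact min_le_left _ _
      _ = _ := by field_simp
  have d2 : E * δ ≤ ε := by
    calc E * δ ≤ (E + 1) * (ε / (E + 1)) := by gcongr; linarith; exact min_le_right _ _
      _ = ε := by field_simp
  have hcv := (Bd.mul zero_le_one hχ hv hB' hb).mono_a d1 zero_le_one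
  have hcs : Sm (fun x => χ x * v x) := hχ.mul hv
  have hcd : ∀ x, |deriv (fun x => χ x * v x) x| ≤ 1/160000 := fun x => by
    have := hcv 1 (by omega) x; rwa [iteratedDeriv_one, one_pow, mul_one] at this
  refine ⟨fun x => by linarith [(abs_le.1 (hcd x)).1], fun G hG hGi w hw => ?_⟩
  have hXs : Sm (fun x => x + χ x * v x) := contDiff_id.add hcs
  have hXd : deriv (fun x => x + χ x * v x) = fun x => 1 + deriv (fun x => χ x * v x) x :=
    funext fun x => deriv_id_add hcs x
  have hwe : w = fun x => (fun y => ρ y * v y) (G x) := funext hw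
  have hws : Sm w := by rw [hwe]; exact Sm.cmp (hρ.mul hv) hG
  have hwb : Bd w (C * (2 ^ (r + 1) * A * δ)) 1 r := by
    rw [hwe]
    refine hC' _ G _ 1 _ zero_le_one hXs hG hGi (fun x => ?_) ?_ (hρ.mul hv) ((Bd.mul zero_le_one hρ hv hA' hb).le (by omega))
    · rw [hXd]; linarith [(abs_le.1 (hcd x)).1]
    · rw [hXd]
      have := (Bd.const 1 1 zero_le_one r).add contDiff_const hcs.deriv (Bd.succ_iff.1 (hcv.mono_a le_rfl zero_le_one)).2
      exact this.mono_a (by norm_num) zero_le_one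
  have hsc : Sc w c := by
    intro t ht h
    rw [hw] at h
    obtain ⟨m, hm⟩ := hsupp _ (left_ne_zero_of_mul h)
    have h1 := hGi (c + t)
    have h2 := abs_le.1 (hcv.b0 (G (c + t)))
    rw [abs_lt] at hm
    rw [abs_le] at ht
    have m0 : m = 0 := by
      have a1 : (m:ℝ) < 1 := by linarith [hm.1, h2.2, ht.2, h2.1, hm.2]
      have a2 : (-1:ℝ) < m := by linarith [hm.1, h2.2, ht.2, h2.1, hm.2]
      have a1 : m < 1 := by exact_mod_cast a1
      have a2 : -1 < m := by exact_mod_cast a2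
      omega
    subst m0
    rw [abs_lt]; push_cast at hm
    constructor <;> linarith [hm.1, hm.2, h2.1, h2.2]
  have haff : Sm (fun x : ℝ => c + (x - 1/2) / 40000) := show ContDiff ℝ (⊤ : ℕ∞) _ by fun_prop
  refine ⟨hsc, zt_cut.1.mul (contDiff_const.mul (hws.cmp haff)), fun x hx => ?_, ?_⟩
  · rw [cu]
    by_cases h30 : 30 ≤ |x|
    · rw [zt_zero h30, zero_mul]
    · by_cases hw0 : w (c + (x - 1/2) / 40000) = 0
      · rw [hw0]; ring
      · exfalso
        rw [not_le, abs_lt] at h30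
        have := abs_lt.1 (hsc _ (by rw [abs_le]; constructor <;> linarith [h30.1, h30.2]) hw0)
        exact hx ⟨by linarith [this.1], by linarith [this.2]⟩
  · have hdF : Bd (deriv (fun x : ℝ => c + (x - 1/2) / 40000)) 1 1 r := by
      have : deriv (fun x : ℝ => c + (x - 1/2) / 40000) = fun _ => 1/40000 := by
        ext x; rw [deriv_const_add, deriv_div_const, deriv_sub_const]; simp
      rw [this]
      exact (Bd.const _ 1 zero_le_one r).mono_a (by rw [abs_of_pos] <;> norm_num) zero_le_one
    have := (Bd.mul zero_le_one zt_cut.1 (contDiff_const.mul (hws.cmp haff)) hZ'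
      ((Bd.comp le_rfl zero_le_one haff hdF hws hwb).cmul (hws.cmp haff) 40000))
    refine this.mono_a (le_trans (le_of_eq ?_) d2) zero_le_one
    rw [hE, abs_of_pos (by norm_num)]; ring

lemma chart {f g : Equiv.Perm S1} {w : ℝ → ℝ} {c : ℝ} {P : Equiv.Perm ℝ} (hf : IsLift f (fun y => y + w y)) (hw : Sc w c)
    (hG : Gd (cu w c)) (ht : Tr P g) (hP : IsPhi (fun m j => if m = 0 ∧ j = 0 then dP (cu w c) else 1) P) :
    f = (rot ((33/800 + 1/80000 - c : ℝ) : S1))⁻¹ * g * rot ((33/800 + 1/80000 - c : ℝ) : S1) := by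
  set s : ℝ := 33/800 + 1/80000 - c with hs
  have hE : ∀ x, Es 0 0 x = 33/200 + x / 10000 := fun x => by rw [Es]; ring
  rw [mul_assoc, eq_inv_mul_iff_mul_eq]
  ext z
  obtain ⟨z, rfl⟩ := (rot (s : S1)).symm.surjective z
  obtain ⟨y, hy, rfl⟩ := exists_rep z
  have e1 : (rot (s : S1)).symm ((y / 4 : ℝ) : S1) = ((y / 4 - s : ℝ) : S1) := by
    rw [Equiv.symm_apply_eq, (isLift_rot s).2.2.2]; congr 1; ring
  rw [Equiv.Perm.mul_apply, Equiv.Perm.mul_apply, Equiv.apply_symm_apply, e1, hf.2.2.2, (isLift_rot s).2.2.2, ht.2 y hy]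
  congr 1
  obtain ⟨x, rfl⟩ : ∃ x, y = Es 0 0 x := ⟨10000 * y - 1650, by rw [hE]; ring⟩
  have e2 : Es 0 0 x / 4 - s = c + (x - 1/2) / 40000 := by rw [hE, hs]; ring
  simp only
  rw [e2]
  rw [abs_le] at hy
  have ht9 : |(x - 1/2) / 40000| ≤ 9/10 := by
    rw [hE] at hy; rw [abs_le]; constructor <;> linarith [hy.1, hy.2]
  by_cases hx : |x| ≤ 30
  · rw [hP.2.1 _ _ _ hx]; simp only [and_self, if_true]; rw [dP_apply hG, hE, cu]
    by_cases h0 : w (c + (x - 1/2) / 40000) = 0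
    · rw [h0, hs]; ring
    · have := abs_lt.1 (hw _ ht9 h0)
      rw [zt_one (by rw [abs_le]; constructor <;> linarith [this.1, this.2]), hs]; ring
  · have h0 : w (c + (x - 1/2) / 40000) = 0 := by
      by_contra h0
      have := abs_lt.1 (hw _ ht9 h0)
      exact hx (by rw [abs_le]; constructor <;> linarith [this.1, this.2])
    have : P (Es 0 0 x) = Es 0 0 x := by
      by_cases hh : ∀ n j x', |x'| ≤ 30 → Es 0 0 x ≠ Es n j x'
      · exact hP.2.2 _ hh
      · push Not at hh
        obtain ⟨n, j, x', hx', e⟩ := hh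
        rw [e, hP.2.1 _ _ _ hx']; simp only; rw [if_neg]
        · rfl
        · rintro ⟨rfl, rfl⟩
          rw [hE, hE] at e
          exact hx (by rwa [show x = x' by linarith])
    rw [this, h0, hE, hs]; ring


lemma exists_min (f : ℕ → ℝ) (hf : ∀ n, 0 < f n) (K : ℕ) : ∃ e, 0 < e ∧ ∀ k < K, e ≤ f k := by
  induction K with
  | zero => exact ⟨1, one_pos, by simp⟩
  | succ K ih =>
    obtain ⟨e, he, h⟩ := ih
    refine ⟨min e (f K), lt_min he (hf K), fun k hk => ?_⟩
    rcases Nat.lt_succ_iff_lt_or_eq.1 hk with h' | rfl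
    · exact (min_le_left _ _).trans (h k h')
    · exact min_le_right _ _

lemma IsLift.congr {f : Equiv.Perm S1} {F G : ℝ → ℝ} (h : IsLift f F) (e : ∀ x, G x = F x) : IsLift f G :=
  (funext e : G = F) ▸ h

theorem thmA : ∃ (R : ℕ → ℕ) (ε : ℕ → ℝ) (L : ℕ → ℕ), (∀ N, 0 < ε N) ∧ ∀ (h : ℕ → Df) (v : ℕ → ℝ → ℝ),
    (∀ N, IsLift (h N) (fun x => x + v N x)) → (∀ N, Bd (v N) (ε N) 1 (R N)) →
    ∃ S : Set Df, S.Finite ∧ ∀ N, Wd S (L N) (h N) ∧ h N ∈ NN := by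
  obtain ⟨K, ρ, c, hρ, pρ, hsum, hsupp⟩ := exists_pou
  have hK : 0 < K := by
    rcases Nat.eq_zero_or_pos K with rfl | h
    · simpa using hsum 0
    · exact h
  obtain ⟨ε₀, L₀, hε₀, H⟩ := swindleC
  set χ : ℕ → ℝ → ℝ := fun k x => ∑ l ∈ Finset.range k, ρ l x with hχ
  have sχ : ∀ k, Sm (χ k) := fun k => ContDiff.sum fun l _ => hρ l
  have pχ : ∀ k x, χ k (x + 1) = χ k x := fun k x => by simp only [hχ, pρ]
  choose δ hδ hfr using fun N k => frag1 (hρ k) (pρ k) (sχ k) (pχ k) (c k) (hsupp k) (N * K + k + 25) (hε₀ (N * K + k))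
  choose ε hε hεδ using fun N => exists_min (δ N) (hδ N) K
  set s : ℕ → Df := fun k => ⟨rot ((33/800 + 1/80000 - c k : ℝ) : S1), rot_mem _⟩ with hs
  refine ⟨fun N => N * K + K + 26, ε, fun N => ∑ k ∈ Finset.range K, (1 + L₀ (N * K + k) + 1), hε, fun h v hh hv => ?_⟩
  have sv : ∀ N, Sm (v N) := fun N => by
    have := (hh N).1.sub contDiff_id
    simpa using this
  have hfr' := fun N k (hk : k < K) => hfr N k (v N) (sv N) ((hv N).mono (hεδ N k hk) zero_le_one le_rfl (by simp only; omega))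
  have pv : ∀ N x, v N (x + 1) = v N x := fun N x => by
    have := (hh N).2.1 x; simp only at this; linarith
  have hf : ∀ N k, ∃ f : Df, k ≤ K → IsLift f (fun x => x + χ k x * v N x) := fun N k => by
    rcases lt_trichotomy k K with hk | rfl | hk
    · have sm : Sm (fun x => χ k x * v N x) := (sχ k).mul (sv N)
      obtain ⟨f, hf⟩ := exists_lift (F := fun x => x + χ k x * v N x) (contDiff_id.add sm)
        (fun x => by rw [pv, pχ]; ring) (fun x => by rw [deriv_id_add sm]; exact (hfr' N k hk).1 x)
      exact ⟨⟨f, _, hf⟩, fun _ => hf⟩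
    · refine ⟨h N, fun _ => ?_⟩
      simp only [hχ, hsum, one_mul]; exact hh N
    · exact ⟨1, fun h => by omega⟩
  choose f hf using hf
  have hw : ∀ N k, ∃ w : ℝ → ℝ, k < K → IsLift (f N (k + 1) * (f N k)⁻¹ : Df) (fun y => y + w y) ∧ Sc w (c k) ∧
      Sm (cu w (c k)) ∧ (∀ x, x ∉ Ioo (0:ℝ) 1 → cu w (c k) x = 0) ∧ Bd (cu w (c k)) (ε₀ (N * K + k)) 1 (N * K + k + 25) := by
    intro N k
    by_cases hk : k < K
    · obtain ⟨G, hG, h1, h2⟩ := (hf N k hk.le).inv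
      refine ⟨fun x => ρ k (G x) * v N (G x), fun _ => ⟨?_, (hfr' N k hk).2 G hG.1 h1 _ fun x => rfl⟩⟩
      refine ((hf N (k + 1) hk).mul hG).congr fun y => ?_
      have := h1 y
      simp only [hχ, Finset.sum_range_succ] at this ⊢
      linarith
    · exact ⟨fun _ => 0, fun h => absurd h hk⟩
  choose w hw using hw
  have hm : ∀ n, n % K < K := fun n => Nat.mod_lt _ hK
  obtain ⟨S, hS, hSn⟩ := H (fun n => cu (w (n / K) (n % K)) (c (n % K))) (fun n => (hw _ _ (hm n)).2.2.1)
    (fun n => (hw _ _ (hm n)).2.2.2.1) (fun n i hi x => by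
      have := (hw (n / K) (n % K) (hm n)).2.2.2.2
      rw [Nat.div_add_mod' n K] at this
      have := this i hi x
      rwa [one_pow, mul_one] at this)
  refine ⟨S ∪ s '' (Finset.range K : Set ℕ), hS.union ((Finset.finite_toSet _).image _), fun N => ?_⟩
  have key : ∀ k ≤ K, Wd (S ∪ s '' (Finset.range K : Set ℕ)) (∑ k ∈ Finset.range k, (1 + L₀ (N * K + k) + 1)) (f N k) ∧
      f N k ∈ NN := by
    intro k
    induction k with
    | zero =>
      intro _
      have : f N 0 = 1 := Subtype.ext ((hf N 0 (Nat.zero_le _)).inj (by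
        simp only [hχ, Finset.range_zero, Finset.sum_empty, zero_mul, add_zero]; exact isLift_one))
      rw [this]; exact ⟨.one _, one_mem _⟩
    | succ k ih =>
      intro hk
      obtain ⟨i1, i2⟩ := ih (by omega)
      obtain ⟨hG, g, g1, g2, P, g3, g4⟩ := hSn (N * K + k)
      have e1 : (N * K + k) / K = N := by
        rw [mul_comm, Nat.mul_add_div hK, Nat.div_eq_of_lt hk, add_zero]
      have e2 : (N * K + k) % K = k := by rw [mul_comm, Nat.mul_add_mod, Nat.mod_eq_of_lt hk]
      simp only [e1, e2] at hG g4
      have e3 : f N (k + 1) * (f N k)⁻¹ = (s k)⁻¹ * g * s k :=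
        Subtype.ext (chart (hw N k hk).1 (hw N k hk).2.1 hG g3 g4)
      have e4 : f N (k + 1) = (s k)⁻¹ * g * s k * f N k := by rw [← e3]; group
      rw [e4, Finset.sum_range_succ, add_comm]
      refine ⟨Wd.mul' (Wd.conj' (g1.mono subset_union_left le_rfl) (.of_mem (Or.inr ⟨k, by simpa using hk, rfl⟩))) i1, mul_mem ?_ i2⟩
      simpa using (inferInstance : NN.Normal).conj_mem _ g2 (s k)⁻¹
  have : h N = f N K := Subtype.ext ((hh N).inj (by
    have := hf N K le_rfl
    simpa only [hχ, hsum, one_mul] using this))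
  rw [this]; exact key K le_rfl

/-- normal generation -/
theorem thmB (f : Df) : f ∈ NN := by
  obtain ⟨R, ε, L, hε, H⟩ := thmA
  have H0 : ∀ (h : Df) (v : ℝ → ℝ), IsLift h (fun x => x + v x) → Bd v (ε 0) 1 (R 0) → h ∈ NN := by
    intro h v h1 h2
    obtain ⟨S, -, hS⟩ := H (fun n => if n = 0 then h else 1) (fun n => if n = 0 then v else fun _ => 0) (fun N => by
      split_ifs
      · exact h1
      · simp only [add_zero]; exact isLift_one) (fun N => by
      split_ifs with h
      · subst h; exact h2
      · exact (Bd.const 0 1 zero_le_one _).mono_a (by simpa using (hε N).le) zero_le_one)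
    exact (hS 0).2
  obtain ⟨f, F, hF⟩ := f
  set v : ℝ → ℝ := fun x => F x - x with hv
  have sv : Sm v := hF.1.sub contDiff_id
  have pv : ∀ x, v (x + 1) = v x := fun x => by simp only [hv]; rw [hF.2.1]; ring
  have dv : ∀ x, 0 < 1 + deriv v x := fun x => by
    rw [← deriv_id_add sv]
    simp only [hv, add_sub_cancel]; exact hF.2.2.1 x
  have hft : ∀ t : Icc (0:ℝ) 1, ∃ g : Df, IsLift g (fun x => x + t * v x) := fun t => by
    have sm : Sm (fun x => t * v x) := contDiff_const.mul sv
    obtain ⟨g, hg⟩ := exists_lift (F := fun x => x + t * v x) (contDiff_id.add sm) (fun x => by rw [pv]; ring) (fun x => by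
      rw [deriv_id_add sm, deriv_const_mul _ (sv.da x)]
      have e : 1 + t * deriv v x = (1 - t) + t * (1 + deriv v x) := by ring
      rw [e]
      rcases t.2.1.eq_or_lt with h | h
      · rw [← h]; norm_num
      · linarith [mul_pos h (dv x), t.2.2])
    exact ⟨⟨g, _, hg⟩, hg⟩
  choose g hg using hft
  have hloc : ∀ t, ∀ᶠ s in 𝓝 t, (g s ∈ NN ↔ g t ∈ NN) := fun t => by
    obtain ⟨G, hG, h1, h2⟩ := (hg t).inv
    obtain ⟨C, hC, hb⟩ := per_BD (p := fun x => v (G x)) (sv.cmp hG.1) (fun x => by rw [hG.2.1, pv]) (R 0)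
    have : ∀ᶠ s : Icc (0:ℝ) 1 in 𝓝 t, |(s:ℝ) - t| * C < ε 0 := by
      refine ContinuousAt.eventually_lt (by fun_prop) (by fun_prop) ?_
      simpa using hε 0
    filter_upwards [this] with s hs
    have h3 : g s * (g t)⁻¹ ∈ NN := H0 _ (fun x => (s - t) * v (G x)) (by
      refine ((hg s).mul hG).congr fun y => ?_
      have := h1 y
      linarith) (((hb.bd le_rfl).cmul (sv.cmp hG.1) _).mono_a hs.le zero_le_one)
    constructor
    · intro h; simpa using mul_mem (inv_mem h3) h
    · intro h; simpa using mul_mem h3 h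
  have hcl : IsClopen {t | g t ∈ NN} := by
    constructor
    · rw [← isOpen_compl_iff, isOpen_iff_mem_nhds]
      intro t ht
      filter_upwards [hloc t] with s hs h
      exact ht (hs.1 h)
    · rw [isOpen_iff_mem_nhds]
      intro t ht
      filter_upwards [hloc t] with s hs
      exact hs.2 ht
  rcases isClopen_iff.1 hcl with h | h
  · exfalso
    have h0 : (⟨0, by simp⟩ : Icc (0:ℝ) 1) ∈ {t | g t ∈ NN} := by
      have : g ⟨0, by simp⟩ = 1 := Subtype.ext ((hg _).inj (by simp only [zero_mul, add_zero]; exact isLift_one))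
      change g _ ∈ NN
      rw [this]; exact one_mem _
    rw [h] at h0; exact h0
  · have h1 : (⟨1, by simp⟩ : Icc (0:ℝ) 1) ∈ {t | g t ∈ NN} := by rw [h]; trivial
    have : g ⟨1, by simp⟩ = ⟨f, F, hF⟩ := Subtype.ext ((hg _).inj (by
      simp only [one_mul, hv, add_sub_cancel]; exact hF))
    rw [← this]; exact h1


lemma rot_pow (s : ℝ) (k : ℕ) : (rot (s : S1)) ^ k = rot ((k * s : ℝ) : S1) := by
  induction k with
  | zero =>
    simp only [pow_zero, Nat.cast_zero, zero_mul]
    refine isLift_one.inj ((isLift_rot 0).congr fun x => by simp)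
  | succ k ih =>
    rw [pow_succ, ih]
    refine ((isLift_rot _).mul (isLift_rot s)).inj ((isLift_rot _).congr fun x => by push_cast; ring)

lemma conj_small (x : Df) (r : ℕ) {ε : ℝ} (hε : 0 < ε) : ∃ (k : ℕ) (h : Df) (w : ℝ → ℝ),
    IsLift h (fun y => y + w y) ∧ Bd w ε 1 r ∧ h ^ k = x * rh * x⁻¹ := by
  obtain ⟨X, hX⟩ : HasLift x := x.2
  obtain ⟨G, hG, h1, h2⟩ := hX.inv
  obtain ⟨c, hc, hcX⟩ := per_deriv_ge hX.1 hX.2.1 hX.2.2.1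
  have sX : Sm X := hX.1
  have pX : ∀ y, deriv X (y + 1) = deriv X y := fun y => by
    rw [← deriv_comp_add_const, show (fun y => X (y + 1)) = fun y => X y + 1 from funext hX.2.1, deriv_add_const]
  obtain ⟨A, hA, hAb⟩ := per_BD sX.deriv pX r
  have hAb := hAb.bd le_rfl
  obtain ⟨C, hC, H⟩ := Bd.comp_inv r c A hc hA
  obtain ⟨k, hk⟩ := exists_nat_gt (C * A / ε)
  have hk0 : (0:ℝ) < k := lt_of_le_of_lt (by positivity) hk
  set s : ℝ := 1 / (2 * k) with hs
  have hs0 : 0 < s := by positivity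
  have hsε : C * (s * A) ≤ ε := by
    rw [div_lt_iff₀ hε] at hk
    have e : C * (s * A) = C * A / (2 * k) := by rw [hs]; ring
    rw [e, div_le_iff₀ (by positivity)]
    nlinarith [mul_pos hε hk0]
  have sXs : Sm (fun z => X (z + s)) := sX.cmp (show ContDiff ℝ (⊤ : ℕ∞) _ by fun_prop)
  have hg : Bd (fun z => X (z + s) - X z) (s * A) 1 r := by
    intro j hj z
    have e : iteratedDeriv j (fun z => X (z + s) - X z) z = iteratedDeriv j X (z + s) - iteratedDeriv j X z := by
      rw [iteratedDeriv_fun_sub (sXs.of_le (by exact_mod_cast le_top)).contDiffAt (sX.of_le (by exact_mod_cast le_top)).contDiffAt,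
        iteratedDeriv_comp_add_const]
    rw [e]
    have hd : ∀ y ∈ (univ : Set ℝ), DifferentiableAt ℝ (iteratedDeriv j X) y := fun y _ => (sX.iter j).da y
    have := Convex.norm_image_sub_le_of_norm_deriv_le (C := A) hd (fun y _ => by
      rw [← iteratedDeriv_succ, iteratedDeriv_succ', Real.norm_eq_abs]
      simpa using hAb j hj y) convex_univ (mem_univ z) (mem_univ (z + s))
    rw [Real.norm_eq_abs, Real.norm_eq_abs, add_sub_cancel_left, abs_of_pos hs0] at this
    rw [one_pow, mul_one]; linarith
  refine ⟨k, x * ⟨rot (s : S1), rot_mem s⟩ * x⁻¹, fun y => X (G y + s) - X (G y), ?_, ?_, ?_⟩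
  · refine ((hX.mul (isLift_rot s)).mul hG).congr fun y => ?_
    simp only; rw [h1]; ring
  · exact (H X G _ 1 _ zero_le_one sX hG.1 h1 hcX hAb (sXs.sub sX) hg).mono_a hsε zero_le_one
  · rw [conj_pow]
    congr 2
    refine Subtype.ext ?_
    change (rot (s : S1)) ^ k = rot _
    rw [rot_pow]
    congr 2
    rw [hs]; field_simp

lemma rh_inv : rh⁻¹ = rh := by
  rw [inv_eq_iff_mul_eq_one]
  refine Subtype.ext ?_
  change rot _ * rot _ = 1
  rw [← pow_two, rot_pow]
  ext z
  change z + _ = z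
  norm_num

lemma NN_list {f : Df} (hf : f ∈ NN) : ∃ l : List Df, f = (l.map fun x => x * rh * x⁻¹).prod := by
  refine Subgroup.closure_induction'' (G := Df) (s := Group.conjugatesOfSet {rh}) (p := fun f _ => ∃ l : List Df, f = (l.map fun x => x * rh * x⁻¹).prod)
    ?_ ?_ ?_ ?_ hf
  · intro f hf
    rw [Group.mem_conjugatesOfSet_iff] at hf
    obtain ⟨a, ha, hc⟩ := hf
    rw [mem_singleton_iff.1 ha, isConj_iff] at hc
    obtain ⟨c, hc⟩ := hc
    exact ⟨[c], by simp [hc]⟩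
  · intro f hf
    rw [Group.mem_conjugatesOfSet_iff] at hf
    obtain ⟨a, ha, hc⟩ := hf
    rw [mem_singleton_iff.1 ha, isConj_iff] at hc
    obtain ⟨c, hc⟩ := hc
    refine ⟨[c], ?_⟩
    rw [← hc, conj_inv, rh_inv]; simp
  · exact ⟨[], by simp⟩
  · rintro f g _ _ ⟨l, rfl⟩ ⟨m, rfl⟩
    exact ⟨l ++ m, by simp⟩

lemma lift_one_int {G : ℝ → ℝ} (h : IsLift 1 G) : ∃ m : ℤ, ∀ x, G x = x + m := by
  have h1 : ∀ x, ∃ m : ℤ, G x = x + m := fun x => by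
    have := h.2.2.2 x
    rw [Equiv.Perm.one_apply, eq_comm, ← sub_eq_zero, ← AddCircle.coe_sub, AddCircle.coe_eq_zero_iff] at this
    obtain ⟨m, hm⟩ := this
    exact ⟨m, by simp at hm; linarith⟩
  choose m hm using h1
  have hc : Continuous m := by
    have : Continuous fun x => ((m x : ℤ) : ℝ) := by
      have e : (fun x => ((m x : ℤ) : ℝ)) = fun x => G x - x := by ext x; rw [hm]; ring
      rw [e]; exact h.1.continuous.sub continuous_id
    exact Int.isClosedEmbedding_coe_real.isEmbedding.continuous_iff.2 this
  refine ⟨m 0, fun x => ?_⟩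
  rw [hm x, PreconnectedSpace.constant (Y := ℤ) inferInstance hc (x := x) (y := 0)]

lemma rec_small {f : Equiv.Perm S1} (hl : HasLift f) (hf : Recurrent f) (r : ℕ) {ε : ℝ} (hε : 0 < ε) (Q : ℕ) :
    ∃ (q : ℕ) (v : ℝ → ℝ), Q ≤ q ∧ IsLift (f ^ q) (fun x => x + v x) ∧ Bd v ε 1 r := by
  obtain ⟨q, hq, -, hd⟩ := hf r ε hε Q
  have hne : {d | ∃ F G, IsLift (f ^ q) F ∧ IsLift 1 G ∧ d = liftDist r F G}.Nonempty := by
    obtain ⟨F, hF⟩ : HasLift (f ^ q) := Df.pow_mem hl q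
    exact ⟨_, F, _, hF, isLift_one, rfl⟩
  obtain ⟨d, ⟨F, G, hF, hG, rfl⟩, hd⟩ := exists_lt_of_csInf_lt hne hd
  obtain ⟨m, hm⟩ := lift_one_int hG
  have sF : Sm F := hF.1
  have sG : Sm G := hG.1
  refine ⟨q, fun x => F x - G x, hq, ?_, fun j hj x => ?_⟩
  · have e : (fun x => x + (F x - G x)) = fun x => F x - m := by ext x; rw [hm]; ring
    rw [e]
    refine ⟨sF.sub contDiff_const, fun x => by simp only; rw [hF.2.1]; ring, fun x => by rw [deriv_sub_const]; exact hF.2.2.1 x, fun x => ?_⟩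
    have e0 : (((m : ℝ)) : S1) = 0 := (AddCircle.coe_eq_zero_iff 1).2 ⟨m, by simp⟩
    rw [hF.2.2.2, AddCircle.coe_sub, e0, sub_zero]
  · have e : ∀ j x, iteratedDeriv j (fun z => F z - G z) x = iteratedDeriv j F x - iteratedDeriv j G x := fun j x => by
      rw [iteratedDeriv_fun_sub (sF.of_le (by exact_mod_cast le_top)).contDiffAt (sG.of_le (by exact_mod_cast le_top)).contDiffAt]
    rw [e, one_pow, mul_one]
    refine le_trans ?_ hd.le
    have hb : BddAbove (range fun x => |iteratedDeriv j F x - iteratedDeriv j G x|) := by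
      have sv : Sm (fun z => F z - G z) := sF.sub sG
      obtain ⟨C, hC⟩ := per_bdd (sv.iter j).continuous (per_iter (fun x => by rw [hF.2.1, hG.2.1]; ring) j)
      refine ⟨C, ?_⟩
      rintro _ ⟨x, rfl⟩
      have := hC x
      rwa [e] at this
    refine (le_ciSup hb x).trans ?_
    exact le_ciSup (f := fun j : Fin (r + 1) => ⨆ x : ℝ, |iteratedDeriv (j : ℕ) F x - iteratedDeriv (j : ℕ) G x|)
      (Set.finite_range _).bddAbove ⟨j, by omega⟩

lemma Wd.wl {S : Set Df} {n : ℕ} {g : Df} (h : Wd S n g) : ∃ l : List (Equiv.Perm S1), l.length ≤ n ∧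
    (∀ x ∈ l, x ∈ Subtype.val '' S ∨ x⁻¹ ∈ Subtype.val '' S) ∧ l.prod = g := by
  induction h with
  | one n => exact ⟨[], by simp⟩
  | @mul n s g hs _ ih =>
    obtain ⟨l, h1, h2, h3⟩ := ih
    refine ⟨(s : Equiv.Perm S1) :: l, by simpa using h1, ?_, by simp [h3]⟩
    intro x hx
    rcases List.mem_cons.1 hx with rfl | hx
    · exact Or.inl ⟨s, hs, rfl⟩
    · exact h2 x hx
  | @inv n s g hs _ ih =>
    obtain ⟨l, h1, h2, h3⟩ := ih
    refine ⟨(s : Equiv.Perm S1)⁻¹ :: l, by simpa using h1, ?_, by simp [h3]⟩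
    intro x hx
    rcases List.mem_cons.1 hx with rfl | hx
    · exact Or.inr ⟨s, hs, by simp⟩
    · exact h2 x hx

lemma Wd.wl_le {S : Set Df} {n : ℕ} {g : Df} (h : Wd S n g) : wordLength (Subtype.val '' S) g ≤ n := by
  obtain ⟨l, h1, h2, h3⟩ := h.wl
  refine le_trans ?_ h1
  rw [wordLength]
  exact Nat.sInf_le ⟨l, rfl, h2, h3⟩

lemma Wd.mem_cl {S : Set Df} {n : ℕ} {g : Df} (h : Wd S n g) : (g : Equiv.Perm S1) ∈ Subgroup.closure (Subtype.val '' S) := by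
  obtain ⟨l, h1, h2, h3⟩ := h.wl
  rw [← h3]
  refine Subgroup.list_prod_mem _ fun x hx => ?_
  rcases h2 x hx with h | h
  · exact Subgroup.subset_closure h
  · exact (Subgroup.inv_mem_iff _).1 (Subgroup.subset_closure h)

lemma Wd.list {S : Set Df} (l : List Df) (h : ∀ x ∈ l, ∃ n, Wd S n (x * rh * x⁻¹)) :
    ∃ n, Wd S n (l.map fun x => x * rh * x⁻¹).prod := by
  induction l with
  | nil => exact ⟨0, .one _⟩
  | cons a l ih =>
    obtain ⟨n, hn⟩ := ih fun x hx => h x (List.mem_cons_of_mem _ hx)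
    obtain ⟨m, hm⟩ := h a List.mem_cons_self
    exact ⟨m + n, by rw [List.map_cons, List.prod_cons]; exact hm.mul' hn⟩

lemma tendsto_wl (a : ℕ → ℕ) (d : ℕ) (H : ∀ m : ℕ, ∃ q L : ℕ, (m + 1) * (L + 1) ≤ q ∧ ∀ t s, a (q * t + s) ≤ t * L + s * d) :
    Tendsto (fun n : ℕ => (a n : ℝ) / n) atTop (nhds 0) := by
  rw [Metric.tendsto_atTop]
  intro ε hε
  obtain ⟨m, hm⟩ := exists_nat_one_div_lt (half_pos hε)
  obtain ⟨q, L, hq, ha⟩ := H m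
  have hq0 : 0 < q := lt_of_lt_of_le (by positivity) hq
  obtain ⟨n0, hn0⟩ := exists_nat_gt ((q * d : ℝ) / (ε / 2))
  refine ⟨n0 + 1, fun n hn => ?_⟩
  have hn1 : (0:ℝ) < n := by exact_mod_cast (by omega : 0 < n)
  have hn2 : (q * d : ℝ) < n * (ε / 2) := by
    rw [div_lt_iff₀ (half_pos hε)] at hn0
    have : (n0:ℝ) ≤ n := by exact_mod_cast (by omega : n0 ≤ n)
    nlinarith
  rw [Real.dist_eq, sub_zero, abs_of_nonneg (by positivity), div_lt_iff₀ hn1]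
  have h1 := ha (n / q) (n % q)
  rw [Nat.div_add_mod] at h1
  have h2 : (a n : ℝ) ≤ (n / q : ℕ) * L + q * d := by
    have : a n ≤ (n / q) * L + q * d := h1.trans (by gcongr; exact (Nat.mod_lt _ hq0).le)
    exact_mod_cast this
  have h3 : ((n / q : ℕ) : ℝ) * L * (m + 1) ≤ n := by
    have : (n / q) * L * (m + 1) ≤ n := by
      calc _ = (n / q) * ((m + 1) * L) := by ring
        _ ≤ (n / q) * q := by gcongr; exact le_trans (by gcongr; omega) hq
        _ ≤ n := Nat.div_mul_le_self _ _
    exact_mod_cast this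
  have h4 : ((n / q : ℕ) : ℝ) * L ≤ n * (1 / (m + 1)) := by
    rw [mul_one_div, le_div_iff₀ (by positivity)]; exact h3
  nlinarith

theorem main0 (f : ℕ → Equiv.Perm S1)
    (hlift : ∀ i, HasLift (f i)) (hrec : ∀ i, Recurrent (f i)) :
    ∃ S : Finset (Equiv.Perm S1), (∀ g ∈ S, HasLift g) ∧
      ∀ i, f i ∈ Subgroup.closure (S : Set (Equiv.Perm S1)) ∧
        Tendsto (fun n : ℕ => (wordLength (S : Set (Equiv.Perm S1)) (f i ^ n) : ℝ) / n)
          atTop (nhds 0) := by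
  obtain ⟨R, ε, L, hε, H⟩ := thmA
  set φ : ℕ → Df := fun i => ⟨f i, hlift i⟩ with hφ
  choose l hl using fun i => NN_list (thmB (φ i))
  have task : ∀ N : ℕ, ∃ (h : Df) (v : ℝ → ℝ), IsLift h (fun x => x + v x) ∧ Bd v (ε N) 1 (R N) ∧
      (∀ hN : N.unpair.2 < (l N.unpair.1).length, ∃ k, h ^ k = (l N.unpair.1)[N.unpair.2] * rh * ((l N.unpair.1)[N.unpair.2])⁻¹) ∧
      ((l N.unpair.1).length ≤ N.unpair.2 → ∃ q, (N + 1) * (L N + 1) ≤ q ∧ h = φ N.unpair.1 ^ q) := by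
    intro N
    by_cases hN : N.unpair.2 < (l N.unpair.1).length
    · obtain ⟨k, h, w, h1, h2, h3⟩ := conj_small ((l N.unpair.1)[N.unpair.2]) (R N) (hε N)
      exact ⟨h, w, h1, h2, fun _ => ⟨k, h3⟩, fun h => absurd hN (not_lt.2 h)⟩
    · obtain ⟨q, v, h1, h2, h3⟩ := rec_small (hlift N.unpair.1) (hrec N.unpair.1) (R N) (hε N) ((N + 1) * (L N + 1))
      exact ⟨φ N.unpair.1 ^ q, v, h2, h3, fun h => absurd h hN, fun _ => ⟨q, h1, rfl⟩⟩
  choose h v h1 h2 h3 h4 using task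
  obtain ⟨S, hS, hSn⟩ := H h v h1 h2
  refine ⟨(hS.image Subtype.val).toFinset, fun g hg => ?_, fun i => ?_⟩
  · rw [Set.Finite.mem_toFinset] at hg
    obtain ⟨g, -, rfl⟩ := hg
    exact g.2
  rw [Set.Finite.coe_toFinset]
  obtain ⟨d, hd⟩ : ∃ d, Wd S d (φ i) := by
    rw [hl i]
    refine Wd.list _ fun x hx => ?_
    obtain ⟨a, ha, rfl⟩ := List.getElem_of_mem hx
    have := h3 (Nat.pair i a)
    simp only [Nat.unpair_pair] at this
    obtain ⟨k, hk⟩ := this ha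
    rw [← hk]
    exact ⟨_, (hSn _).1.pow k⟩
  refine ⟨hd.mem_cl, tendsto_wl _ d fun m => ?_⟩
  have := h4 (Nat.pair i ((l i).length + m))
  simp only [Nat.unpair_pair] at this
  obtain ⟨q, hq, e⟩ := this (by omega)
  refine ⟨q, L (Nat.pair i ((l i).length + m)), le_trans ?_ hq, fun t s => ?_⟩
  · have := Nat.right_le_pair i ((l i).length + m)
    gcongr; omega
  · have hw := (hSn (Nat.pair i ((l i).length + m))).1
    rw [e] at hw
    have := ((hw.pow t).mul' (hd.pow s)).wl_le
    rw [← pow_mul, ← pow_add] at this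
    exact this


/-- any countable family of recurrent smooth circle diffeomorphisms can be made
simultaneously distortion elements of a single finitely generated subgroup of Diff^∞(ℝ/ℤ). -/
theorem countable_recurrent_simultaneous_distortion (f : ℕ → Equiv.Perm S1)
    (hlift : ∀ i, HasLift (f i)) (hrec : ∀ i, Recurrent (f i)) :
    ∃ S : Finset (Equiv.Perm S1), (∀ g ∈ S, HasLift g) ∧
      ∀ i, f i ∈ Subgroup.closure (S : Set (Equiv.Perm S1)) ∧
        Tendsto (fun n : ℕ => (wordLength (S : Set (Equiv.Perm S1)) (f i ^ n) : ℝ) / n)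
          atTop (nhds 0) := by
  exact main0 f hlift hrec

end
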